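/- Let S = k[x_1,x_2,x_3,x_4] with k a field of characteristic zero, and let R = S/(f,g) where f,g is a homogeneous S-regular sequence of quadrics such that R is normal. Let Ω_{R/k} be the module of Kähler differentials, Θ the transposed Jacobian matrix of f,g, and A = H^0_m(S(Ω_{R/k})) with m = (x_1,…,x_4), where S(Ω_{R/k}) ≅ B/(ℓ_1,ℓ_2,f,g), B = S[y_1,…,y_4], [ℓ_1 ℓ_2] = [y_1 … y_4]·Θ. Then: (i) A_2 is generated by det 𝔅 where 𝔅 = [B(Θ) | Θ], an equation of bidegree (2,2); (ii) ht I_2(Θ) = 3 and A_1 is minimally generated by four equations of bidegree (1,4); (iii) A_0 is a principal ideal of T = k[y_1,…,y_4], and if ht I(ρ) ≥ 2 its generator has bidegree (0,8), where ρ is the first map of the graded strand resolving S(Ω_{R/k})_2. In particular A is generated by six elements and the defining ideal J of the Rees algebra R(Ω_{R/k}) as a quotient of B is generated by ten elements. -/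

import Mathlib

/-!
STATEMENT 19: `S = k[x_1,…,x_4]`, `char k = 0`, `R = S/(f,g)` normal with `f,g` a
homogeneous regular sequence of quadrics, `Ω_{R/k}` the module of differentials, `Θ` the
transposed Jacobian of `f,g`, `S(Ω_{R/k}) ≅ B/L` with `B = S[y_1,…,y_4]`,
`L = (ℓ_1,ℓ_2,f,g)`, `[ℓ_1 ℓ_2] = [y_1 … y_4]·Θ`, and `A = H⁰_m(S(Ω_{R/k}))`.  Then:
(i) `A_2` is generated by `det 𝔅`, `𝔅 = [B(Θ) | Θ]`, of bidegree `(2,2)`;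
(ii) `ht I_2(Θ) = 3` and `A_1` is minimally generated by four equations of bidegree
`(1,4)`; (iii) `A_0` is a principal ideal of `T`, with generator of bidegree `(0,8)` if
`ht I(ρ) ≥ 2` for `ρ` a presentation matrix of `S(Ω_{R/k})_2`.  In particular `A` is
generated by six elements and the defining ideal `J ⊆ B` of the Rees algebra by ten.
-/

open MvPolynomial

noncomputable section

namespace Stmt19

variable (k : Type) [Field k] (d n : ℕ)

/-- `B = R ⊗_k T = k[x_1,…,x_d,y_1,…,y_n]`. -/
abbrev B := MvPolynomial (Fin d ⊕ Fin n) k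

/-- `T = k[y_1,…,y_n]`. -/
abbrev T := MvPolynomial (Fin n) k

/-- `B` is a `T`-algebra via `y_j ↦ y_j`. -/
instance : Algebra (T k n) (B k d n) :=
  ((rename Sum.inr : T k n →ₐ[k] B k d n).toRingHom).toAlgebra

/-- The bigrading weight: `bideg x_i = (1,0)`, `bideg y_j = (0,1)`. -/
def bwt : (Fin d ⊕ Fin n) → ℕ × ℕ := Sum.elim (fun _ => (1, 0)) (fun _ => (0, 1))

/-- The `x`-degree weight. -/
def wx : (Fin d ⊕ Fin n) → ℕ := Sum.elim (fun _ => 1) (fun _ => 0)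

/-- The ideal `m = (x_1,…,x_d)B`. -/
def mxB : Ideal (B k d n) := Ideal.span (Set.range fun i : Fin d => (X (Sum.inl i) : B k d n))

variable (I : Ideal (B k d n))

/-- `A = H⁰_m(S)`: elements of `S = B/I` annihilated by a power of `m`. -/
def H0 : Submodule (B k d n) (B k d n ⧸ I) :=
  ⨆ N : ℕ, Submodule.torsionBySet (B k d n) (B k d n ⧸ I)
    ((mxB k d n ^ N : Ideal (B k d n)) : Set (B k d n))

/-- The bigraded component of `S = B/I` in bidegree `p`. -/
def Scomp (p : ℕ × ℕ) : Submodule k (B k d n ⧸ I) :=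
  (weightedHomogeneousSubmodule k (bwt d n) p).map (Ideal.Quotient.mkₐ k I).toLinearMap

/-- The graded strand `S_j = ⊕_b S_{(j,b)}` of `S` in `x`-degree `j`, as a `T`-module. -/
def SxDeg (j : ℕ) : Submodule (T k n) (B k d n ⧸ I) :=
  Submodule.span (T k n) ((Ideal.Quotient.mk I) '' {g : B k d n | g.IsWeightedHomogeneous (wx d n) j})

/-- The graded strand of `S` in (possibly negative) `x`-degree `i : ℤ`. -/
def SxDegZ (i : ℤ) : Submodule (T k n) (B k d n ⧸ I) :=
  if 0 ≤ i then SxDeg k d n I i.toNat else ⊥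

/-- The graded strand `A_i = ⊕_b A_{(i,b)}` of `A = H⁰_m(S)`, as a `T`-module. -/
def AcompZ (i : ℤ) : Submodule (T k n) (B k d n ⧸ I) :=
  (H0 k d n I).restrictScalars (T k n) ⊓ SxDegZ k d n I i

/-- The graded component of `T` in (possibly negative) degree `j`. -/
def TcompZ (j : ℤ) : Submodule k (T k n) :=
  if 0 ≤ j then homogeneousSubmodule (Fin n) k j.toNat else ⊥

/-- The ideal of `t × t` minors of a matrix. -/
def minorsIdeal {R : Type} [CommRing R] {m' n' : Type} (M : Matrix m' n' R) (t : ℕ) :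
    Ideal R :=
  Ideal.span {x | ∃ (f : Fin t → m') (g : Fin t → n'), x = (M.submatrix f g).det}

/-- `ht I ≥ c`. -/
def htGE {R : Type} [CommRing R] (I : Ideal R) (c : ℕ) : Prop :=
  ∀ (p : Ideal R) (_ : p.IsPrime), I ≤ p →
    (c : WithBot ℕ∞) ≤ ringKrullDim (Localization.AtPrime p)

set_option synthInstance.maxHeartbeats 1000000
set_option maxHeartbeats 3000000


/-! Part 1 -/

/-! ### Part 1: linkage steps and the socle in diagonal coordinates -/

lemma link_step {A : Type*} [CommRing A] (c : Ideal A) {ι : Type*} (x : ι → A) (i0 : ι)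
    (u v d e : A) (hv0 : v = x i0)
    (hu : ∀ a, u * a ∈ c → a ∈ c) (hv : ∀ a, v * a ∈ c → a ∈ c)
    (he : v * e - u * d ∈ c)
    (H : ∀ b, (∀ i, ∃ r, x i * b - v * r ∈ c) → ∃ r t, b - v * r - t * d ∈ c)
    (a : A) (ha : ∀ i, ∃ r, x i * a - u * r ∈ c) :
    ∃ r t, a - u * r - t * e ∈ c := by
  obtain ⟨b, hb⟩ := ha i0
  rw [← hv0] at hb
  obtain ⟨r, t, hrt⟩ := H b (fun i => by
    obtain ⟨r, hr⟩ := ha i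
    refine ⟨r, hu _ ?_⟩
    have h1 := c.mul_mem_left v hr
    have h2 := c.mul_mem_left (x i) hb
    have := c.sub_mem h1 h2
    convert this using 1; ring)
  refine ⟨r, t, hv _ ?_⟩
  have h1 := c.mul_mem_left u hrt
  have h2 := c.mul_mem_left t he
  have := c.sub_mem (c.add_mem hb h1) h2
  convert this using 1; ring

lemma link_step' {A : Type*} [CommRing A] (c : Ideal A) (u v d e : A)
    (hu : ∀ a, u * a ∈ c → a ∈ c) (he : v * e - u * d ∈ c) (t : A)
    (ht : ∃ r, t * e - u * r ∈ c) : ∃ r, t * d - v * r ∈ c := by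
  obtain ⟨r, hr⟩ := ht
  refine ⟨r, hu _ ?_⟩
  have h1 := c.mul_mem_left v hr
  have h2 := c.mul_mem_left t he
  have := c.sub_mem h1 h2
  convert this using 1; ring

lemma coprime_nzd {P E : Type*} [CommRing P] [IsDomain P] [DecompositionMonoid P]
    [CommRing E] [Algebra P E] [Module.Free P E] (F F' G G' : E) (N M : P)
    (hF : F * F' = algebraMap P E N) (hG : G * G' = algebraMap P E M) (hN : N ≠ 0)
    (hNM : IsRelPrime N M) (a b : E) (h : G * a = F * b) : ∃ c, a = F * c := by
  have h1 : M • (F' * a) = N • (G' * b) := by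
    rw [Algebra.smul_def, Algebra.smul_def, ← hF, ← hG]
    linear_combination (F' * G') * h
  let bas := Module.Free.chooseBasis P E
  have h2 : ∀ i, N ∣ bas.repr (F' * a) i := by
    intro i
    have := congrArg (fun z => bas.repr z i) h1
    simp only [map_smul, Finsupp.smul_apply, smul_eq_mul] at this
    exact hNM.dvd_of_dvd_mul_left ⟨_, this⟩
  choose q hq using h2
  have h3 : ∃ c, F' * a = N • c := by
    classical
    refine ⟨bas.repr.symm (Finsupp.onFinset (bas.repr (F' * a)).support q ?_), ?_⟩
    · intro i hi
      rw [Finsupp.mem_support_iff, hq]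
      exact mul_ne_zero hN hi
    · apply bas.repr.injective
      ext i
      simp [hq]
  obtain ⟨c, hc⟩ := h3
  refine ⟨c, ?_⟩
  have h4 : N • (a - F * c) = 0 := by
    have : N • (a - F * c) = F * (F' * a - N • c) := by
      simp only [Algebra.smul_def]
      rw [← hF]; ring
    rw [this, hc]; simp
  rw [← sub_eq_zero]
  apply bas.repr.injective
  ext i
  have := congrArg (fun z => bas.repr z i) h4
  simpa [hN] using this

lemma dvd_subst {K σ : Type*} [Field K] [DecidableEq σ] (i : σ) (h N M : MvPolynomial σ K)
    (hN : N ≠ 0) (hi : degreeOf i N = 0) (h1 : h ∣ N) (h2 : h ∣ M) (c : K) :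
    h ∣ aeval (Function.update X i (C c)) M := by
  obtain ⟨q, rfl⟩ := h1
  have hh : h ≠ 0 := left_ne_zero_of_mul hN
  have hq : q ≠ 0 := right_ne_zero_of_mul hN
  rw [degreeOf_mul_eq hh hq] at hi
  have hi' : degreeOf i h = 0 := by omega
  have hv : i ∉ h.vars := by
    rw [mem_vars]
    rintro ⟨d, hd, hid⟩
    rw [Finsupp.mem_support_iff] at hid
    have := monomial_le_degreeOf i hd
    omega
  have : aeval (Function.update X i (C c)) h = h := by
    conv_rhs => rw [← aeval_X_left_apply h]
    refine eval₂Hom_congr' rfl ?_ rfl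
    intro j hj _
    rw [Function.update_of_ne]
    rintro rfl
    exact hv hj
  obtain ⟨r, rfl⟩ := h2
  rw [map_mul, this]
  exact dvd_mul_right _ _


lemma exists_sqrt (P : Type) [CommRing P] (q : P) :
    ∃ (E : Type) (_ : CommRing E) (_ : Algebra P E) (_ : Module.Free P E) (z : E),
      z ^ 2 = algebraMap P E q ∧
      (∀ U : Subring E, (∀ p, algebraMap P E p ∈ U) → z ∈ U → U = ⊤) ∧
      (∀ (D : Type) [CommRing D] (h : P →+* D) (w : D), w ^ 2 = h q →
        ∃ g : E →+* D, (∀ p, g (algebraMap P E p) = h p) ∧ g z = w) := by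
  refine ⟨AdjoinRoot (Polynomial.X ^ 2 - Polynomial.C q), inferInstance, inferInstance,
    (Polynomial.monic_X_pow_sub_C _ (by norm_num)).free_adjoinRoot, AdjoinRoot.root _, ?_, ?_, ?_⟩
  · have h := AdjoinRoot.eval₂_root (Polynomial.X ^ 2 - Polynomial.C q)
    rw [Polynomial.eval₂_sub, Polynomial.eval₂_C, Polynomial.eval₂_X_pow, sub_eq_zero] at h
    exact h
  · intro U h1 h2
    rw [eq_top_iff]
    intro p _
    obtain ⟨p, rfl⟩ := AdjoinRoot.mk_surjective p
    induction p using Polynomial.induction_on' with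
    | add p q hp hq => rw [map_add]; exact U.add_mem (hp trivial) (hq trivial)
    | monomial n a =>
      rw [← Polynomial.C_mul_X_pow_eq_monomial, map_mul, map_pow, AdjoinRoot.mk_X]
      exact U.mul_mem (h1 a) (U.pow_mem h2 n)
  · intro D _ h w hw
    refine ⟨AdjoinRoot.lift h w ?_, fun p => AdjoinRoot.lift_of _, AdjoinRoot.lift_root _⟩
    rw [Polynomial.eval₂_sub, Polynomial.eval₂_C, Polynomial.eval₂_X_pow, hw, sub_self]

lemma exists_sqrt2 (P : Type) [CommRing P] (q q' : P) :
    ∃ (E : Type) (_ : CommRing E) (_ : Algebra P E) (_ : Module.Free P E) (z z' : E),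
      z ^ 2 = algebraMap P E q ∧ z' ^ 2 = algebraMap P E q' ∧
      (∀ U : Subring E, (∀ p, algebraMap P E p ∈ U) → z ∈ U → z' ∈ U → U = ⊤) ∧
      (∀ (D : Type) [CommRing D] (h : P →+* D) (w w' : D), w ^ 2 = h q → w' ^ 2 = h q' →
        ∃ g : E →+* D, (∀ p, g (algebraMap P E p) = h p) ∧ g z = w ∧ g z' = w') := by
  obtain ⟨E1, _, _, _, z, hz, hU, hD⟩ := exists_sqrt P q
  obtain ⟨E, _, _, _, z', hz', hU', hD'⟩ := exists_sqrt E1 (algebraMap P E1 q')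
  letI : Algebra P E := ((algebraMap E1 E).comp (algebraMap P E1)).toAlgebra
  haveI : IsScalarTower P E1 E := IsScalarTower.of_algebraMap_eq (fun _ => rfl)
  refine ⟨E, inferInstance, inferInstance, Module.Free.trans (R := P) (S := E1) (M := E),
    algebraMap E1 E z, z', ?_, ?_, ?_, ?_⟩
  · rw [← map_pow, hz]; rfl
  · rw [hz']; rfl
  · intro U h1 h2 h3
    apply hU' U _ h3
    have := hU (U.comap (algebraMap E1 E)) (fun p => h1 p) h2
    intro p
    have hp : p ∈ U.comap (algebraMap E1 E) := by rw [this]; trivial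
    exact hp
  · intro D _ h w w' hw hw'
    obtain ⟨g1, h1, h2⟩ := hD D h w hw
    obtain ⟨g, h3, h4⟩ := hD' D g1 w' (by rw [hw', h1])
    exact ⟨g, fun p => by rw [← h1, ← h3]; rfl, by rw [h3, h2], h4⟩

section diag
variable (K : Type) [Field K]

/-- coefficient ring `k[z₃,z₄,y]` -/
abbrev PP := MvPolynomial (Fin 2 ⊕ Fin 4) K
/-- the ring `k[z,y]` -/
abbrev BB := MvPolynomial (Fin 4 ⊕ Fin 4) K

variable {K}
/-- the quadric `c₀ z₃² + c₁ z₄²` -/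
abbrev q1 (c : Fin 2 → K) : PP K :=
  C (c 0) * X (Sum.inl 0) ^ 2 + C (c 1) * X (Sum.inl 1) ^ 2

/-- first quadric -/
abbrev F1 (c : Fin 2 → K) : BB K :=
  X (Sum.inl 0) ^ 2 - (C (c 0) * X (Sum.inl 2) ^ 2 + C (c 1) * X (Sum.inl 3) ^ 2)
/-- second quadric -/
abbrev F2 (c : Fin 2 → K) : BB K :=
  X (Sum.inl 1) ^ 2 - (C (c 0) * X (Sum.inl 2) ^ 2 + C (c 1) * X (Sum.inl 3) ^ 2)

/-- norm of `A + B z₁ + D z₂` -/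
abbrev nrm (c c' : Fin 2 → K) (A B D : PP K) : PP K :=
  (A ^ 2 + B ^ 2 * q1 c - D ^ 2 * q1 c') ^ 2 - 4 * A ^ 2 * B ^ 2 * q1 c

/-- embedding `P → B` -/
abbrev emb : PP K →ₐ[K] BB K :=
  aeval (Sum.elim ![X (Sum.inl 2), X (Sum.inl 3)] (fun i => X (Sum.inr i)))

lemma nzd_of_norm (c c' : Fin 2 → K) (A B D A' B' D' : PP K)
    (hN : nrm c c' A B D ≠ 0)
    (hNM : IsRelPrime (nrm c c' A B D) (nrm c c' A' B' D')) (F G : BB K)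
    (hF : F = emb A + emb B * X (Sum.inl 0) + emb D * X (Sum.inl 1))
    (hG : G = emb A' + emb B' * X (Sum.inl 0) + emb D' * X (Sum.inl 1)) (a : BB K)
    (ha : G * a ∈ Ideal.span {F1 c, F2 c', F}) : a ∈ Ideal.span {F1 c, F2 c', F} := by
  obtain ⟨E, _, _, _, z1, z2, e1, e2, hU, hD⟩ := exists_sqrt2 (PP K) (q1 c) (q1 c')
  let psi : BB K →+* E := eval₂Hom ((algebraMap (PP K) E).comp C)
    (Sum.elim ![z1, z2, algebraMap (PP K) _ (X (Sum.inl 0)), algebraMap (PP K) _ (X (Sum.inl 1))]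
    (fun i => algebraMap (PP K) _ (X (Sum.inr i))))
  have psiz1 : psi (X (Sum.inl 0)) = z1 := by simp [psi]
  have psiz2 : psi (X (Sum.inl 1)) = z2 := by simp [psi]
  have psi_emb : ∀ p, psi (emb p) = algebraMap _ _ p := by
    intro p
    have : psi.comp (emb (K := K)).toRingHom = algebraMap _ _ := by
      apply MvPolynomial.ringHom_ext
      · intro r
        simp [psi]
      · rintro (i | i)
        · fin_cases i <;> simp [psi]
        · simp [psi]
    exact congrArg (fun f => f p) this
  have psi_F1 : psi (F1 c) = 0 := by
    have : F1 c = X (Sum.inl 0) ^ 2 - emb (q1 c) := by simp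
    rw [this, map_sub, psi_emb, map_pow, psiz1, e1, sub_self]
  have psi_F2 : psi (F2 c') = 0 := by
    have : F2 c' = X (Sum.inl 1) ^ 2 - emb (q1 c') := by simp
    rw [this, map_sub, psi_emb, map_pow, psiz2, e2, sub_self]
  have psi_surj : Function.Surjective psi := by
    have := hU psi.range (fun p => ⟨_, psi_emb p⟩) ⟨_, psiz1⟩ ⟨_, psiz2⟩
    exact RingHom.range_eq_top.1 this
  have psi_ker : ∀ b, psi b = 0 → b ∈ Ideal.span {F1 c, F2 c'} := by
    intro b hb
    set I : Ideal (BB K) := Ideal.span {F1 c, F2 c'} with hI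
    obtain ⟨g, hg1, hg2, hg3⟩ := hD (BB K ⧸ I) ((Ideal.Quotient.mk I).comp (emb (K := K)).toRingHom)
      (Ideal.Quotient.mk I (X (Sum.inl 0))) (Ideal.Quotient.mk I (X (Sum.inl 1)))
      (by
        rw [← map_pow, RingHom.comp_apply, Ideal.Quotient.eq]
        refine Ideal.subset_span ?_
        left
        simp)
      (by
        rw [← map_pow, RingHom.comp_apply, Ideal.Quotient.eq]
        refine Ideal.subset_span ?_
        right
        simp)
    have key : g.comp psi = Ideal.Quotient.mk I := by
      apply MvPolynomial.ringHom_ext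
      · intro r
        simp [psi, hg1]
      · rintro (i | i)
        · fin_cases i <;> simp [psi, hg1, hg2, hg3]
        · simp [psi, hg1]
    have h := congrArg (fun f => f b) key
    have h' : g (psi b) = Ideal.Quotient.mk I b := h
    rw [hb, map_zero] at h'
    exact Ideal.Quotient.eq_zero_iff_mem.1 h'.symm
  have nn : ∀ (A B D : PP K) (F : BB K)
      (_ : F = emb A + emb B * X (Sum.inl 0) + emb D * X (Sum.inl 1)),
      ∃ F', psi F * F' = algebraMap _ _ (nrm c c' A B D) := by
    intro A B D F hF
    set m := algebraMap (PP K) E with hm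
    refine ⟨(m A + m B * z1 - m D * z2) * (m A - m B * z1 + m D * z2) *
      (m A - m B * z1 - m D * z2), ?_⟩
    rw [hF]
    simp only [map_add, map_mul, psi_emb, psiz1, psiz2, ← hm]
    have : m (nrm c c' A B D) = (m A ^ 2 + m B ^ 2 * m (q1 c) - m D ^ 2 * m (q1 c')) ^ 2
      - 4 * m A ^ 2 * m B ^ 2 * m (q1 c) := by
      simp only [nrm, map_sub, map_add, map_mul, map_pow, map_ofNat]
    rw [this, ← e1, ← e2]
    ring
  obtain ⟨F', hF'⟩ := nn A B D F hF
  obtain ⟨G', hG'⟩ := nn A' B' D' G hG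
  have hmem : ∃ r, psi (G * a) = psi F * r := by
    rw [Ideal.mem_span_insert] at ha
    obtain ⟨r1, z, hz, h⟩ := ha
    rw [Ideal.mem_span_pair] at hz
    obtain ⟨r2, r3, rfl⟩ := hz
    refine ⟨psi r3, ?_⟩
    rw [h]
    simp only [map_add, map_mul psi, psi_F1, psi_F2]; ring
  obtain ⟨r, hr⟩ := hmem
  rw [map_mul] at hr
  obtain ⟨s, hs⟩ := coprime_nzd (psi F) F' (psi G) G' _ _ hF' hG' hN hNM _ _ hr
  obtain ⟨s, rfl⟩ := psi_surj s
  have h1 : a - F * s ∈ Ideal.span {F1 c, F2 c'} := psi_ker _ (by simp [hs])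
  rw [Ideal.mem_span_pair] at h1
  obtain ⟨r1, r2, h⟩ := h1
  have : a = r1 * F1 c + r2 * F2 c' + s * F := by linear_combination -h
  rw [this]
  refine Ideal.add_mem _ (Ideal.add_mem _ ?_ ?_) ?_ <;>
  exact Ideal.mul_mem_left _ _ (Ideal.subset_span (by simp))

end diag

/-! Part 2 -/

section diag2
variable {K : Type} [Field K]

lemma degreeOf_of_supported {σ : Type*} [DecidableEq σ] (i : σ) (N : MvPolynomial σ K)
    (h : N ∈ supported K ({i}ᶜ : Set σ)) : degreeOf i N = 0 := by
  rw [mem_supported] at h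
  by_contra hc
  have : i ∈ N.vars := by
    rw [vars_def]
    rw [degreeOf_def] at hc
    simpa using Multiset.count_ne_zero.1 hc
  exact h (Finset.mem_coe.2 this) rfl

lemma relPrime_X_pow {σ : Type*} (i : σ) (N : MvPolynomial σ K) (p : σ → K) (hp : p i = 0)
    (hN : eval p N ≠ 0) (m : ℕ) : IsRelPrime N (X i ^ m) := by
  have hX : Prime (X i : MvPolynomial σ K) := MvPolynomial.X_prime
  have : IsRelPrime (X i) N := by
    rw [hX.irreducible.isRelPrime_iff_not_dvd]
    rintro ⟨q, rfl⟩
    simp [hp] at hN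
  exact this.symm.pow_right

lemma dvd_twelve (hK : (12 : K) ≠ 0) {σ : Type*} (h w : MvPolynomial σ K)
    (H : h ∣ 12 * w) : h ∣ w := by
  have : w = C (12 : K)⁻¹ * (12 * w) := by
    have e : (12 : MvPolynomial σ K) = C 12 := (map_ofNat C 12).symm
    rw [e, ← mul_assoc, ← C_mul, inv_mul_cancel₀ hK]; simp
  rw [this]; exact H.mul_left _

lemma nrm34 (hK : (12 : K) ≠ 0) (c c' : Fin 2 → K) (A1 A2 B1 B2 : K) :
    IsRelPrime (nrm c c' (X (Sum.inr 2) * X (Sum.inl 0)) (C (-A1) * X (Sum.inr 0)) (C (-A2) * X (Sum.inr 1)))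
     (nrm c c' (X (Sum.inr 3) * X (Sum.inl 1)) (C (-B1) * X (Sum.inr 0)) (C (-B2) * X (Sum.inr 1))) := by
  set N := nrm c c' (X (Sum.inr 2) * X (Sum.inl 0)) (C (-A1) * X (Sum.inr 0)) (C (-A2) * X (Sum.inr 1)) with hNdef
  intro h h1 h2
  have hN1 : eval (Sum.elim ![1, 0] ![0,0,1,0]) N = 1 := by
    simp [hNdef, nrm, q1]
  have hN0 : N ≠ 0 := by
    intro h0; rw [h0] at hN1; simp at hN1
  have hd : degreeOf (Sum.inr 3 : Fin 2 ⊕ Fin 4) N = 0 := by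
    apply degreeOf_of_supported
    have hX : ∀ j : Fin 2 ⊕ Fin 4, j ≠ Sum.inr 3 → (X j : PP K) ∈ supported K ({Sum.inr 3}ᶜ : Set (Fin 2 ⊕ Fin 4)) := by
      intro j hj
      exact X_mem_supported.2 (by simpa using hj)
    have hC : ∀ r : K, (C r : PP K) ∈ supported K ({Sum.inr 3}ᶜ : Set (Fin 2 ⊕ Fin 4)) := fun r =>
      Subalgebra.algebraMap_mem _ r
    have h4 : (4 : PP K) ∈ supported K ({Sum.inr 3}ᶜ : Set (Fin 2 ⊕ Fin 4)) := by
      have : (4 : PP K) = C 4 := (map_ofNat C 4).symm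
      rw [this]; exact hC 4
    have e1 := hX (Sum.inr 2) (by decide)
    have e2 := hX (Sum.inr 1) (by decide)
    have e3 := hX (Sum.inr 0) (by decide)
    have e4 := hX (Sum.inl 0) (by decide)
    have e5 := hX (Sum.inl 1) (by decide)
    have hq : ∀ c : Fin 2 → K, q1 c ∈ supported K ({Sum.inr 3}ᶜ : Set (Fin 2 ⊕ Fin 4)) := fun c =>
      add_mem (mul_mem (hC _) (pow_mem e4 2)) (mul_mem (hC _) (pow_mem e5 2))
    have hA := mul_mem e1 e4
    have hB := mul_mem (hC (-A1)) e3
    have hD := mul_mem (hC (-A2)) e2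
    exact sub_mem (pow_mem (sub_mem (add_mem (pow_mem hA 2) (mul_mem (pow_mem hB 2) (hq c)))
      (mul_mem (pow_mem hD 2) (hq c'))) 2) (mul_mem (mul_mem (mul_mem h4 (pow_mem hA 2)) (pow_mem hB 2)) (hq c))
  have kk : ∀ s : K, h ∣ nrm c c' (C s * X (Sum.inl 1)) (C (-B1) * X (Sum.inr 0)) (C (-B2) * X (Sum.inr 1)) := by
    intro s
    have := dvd_subst _ h N _ hN0 hd h1 h2 s
    have u1 : Function.update (X : _ → PP K) (Sum.inr 3) (C s) (Sum.inr 3) = C s := Function.update_self ..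
    have u2 : ∀ j, j ≠ Sum.inr 3 → Function.update (X : _ → PP K) (Sum.inr 3) (C s) j = X j := fun j hj =>
      Function.update_of_ne hj ..
    simpa only [nrm, q1, map_sub, map_add, map_mul, map_pow, aeval_X, aeval_C, algebraMap_eq, map_ofNat,
      u1, u2 (Sum.inr 0) (by decide), u2 (Sum.inr 1) (by decide), u2 (Sum.inl 0) (by decide), u2 (Sum.inl 1) (by decide)] using this
  have key := dvd_add (dvd_sub (kk 2) ((kk 1).mul_left 4)) ((kk 0).mul_left 3)
  have key2 : h ∣ 12 * X (Sum.inl 1) ^ 4 := by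
    convert key using 1
    have e : (C (2:K) : PP K) = 2 := map_ofNat C 2
    simp only [nrm, C_1, C_0, e]
    ring
  have key3 := dvd_twelve hK _ _ key2
  refine relPrime_X_pow (Sum.inl 1) N (Sum.elim ![1, 0] ![0,0,1,0]) (by simp) (by rw [hN1]; simp) 4 h1 key3


lemma mem_span3 {A : Type*} [CommRing A] {a b c x : A} :
    x ∈ Ideal.span ({a, b, c} : Set A) ↔ ∃ r1 r2 r3, x = r1 * a + r2 * b + r3 * c := by
  simp only [Ideal.mem_span_insert, Ideal.mem_span_singleton']
  constructor
  · rintro ⟨r1, _, ⟨r2, _, ⟨r3, rfl⟩, rfl⟩, rfl⟩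
    exact ⟨r1, r2, r3, by ring⟩
  · rintro ⟨r1, r2, r3, rfl⟩
    exact ⟨r1, _, ⟨r2, _, ⟨r3, rfl⟩, rfl⟩, by ring⟩

lemma mem_span4 {A : Type*} [CommRing A] {a b c d x : A} :
    x ∈ Ideal.span ({a, b, c, d} : Set A) ↔
      ∃ r1 r2 r3 r4, x = r1 * a + r2 * b + r3 * c + r4 * d := by
  simp only [Ideal.mem_span_insert, Ideal.mem_span_singleton']
  constructor
  · rintro ⟨r1, _, ⟨r2, _, ⟨r3, _, ⟨r4, rfl⟩, rfl⟩, rfl⟩, rfl⟩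
    exact ⟨r1, r2, r3, r4, by ring⟩
  · rintro ⟨r1, r2, r3, r4, rfl⟩
    exact ⟨r1, _, ⟨r2, _, ⟨r3, _, ⟨r4, rfl⟩, rfl⟩, rfl⟩, by ring⟩

/-- third equation -/
abbrev F3 (A : Fin 2 → K) : BB K :=
  X (Sum.inr 2) * X (Sum.inl 2) - C (A 0) * X (Sum.inr 0) * X (Sum.inl 0)
    - C (A 1) * X (Sum.inr 1) * X (Sum.inl 1)
/-- fourth equation -/
abbrev F4 (A : Fin 2 → K) : BB K :=
  X (Sum.inr 3) * X (Sum.inl 3) - C (A 0) * X (Sum.inr 0) * X (Sum.inl 0)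
    - C (A 1) * X (Sum.inr 1) * X (Sum.inl 1)

lemma nzd_base (c c' : Fin 2 → K) (A B D : PP K) (p : Fin 2 ⊕ Fin 4 → K) (hp : p (Sum.inl 1) = 0)
    (hN : eval p (nrm c c' A B D) ≠ 0) (G : BB K)
    (hG : G = emb A + emb B * X (Sum.inl 0) + emb D * X (Sum.inl 1)) (a : BB K)
    (ha : G * a ∈ Ideal.span {F1 c, F2 c', X (Sum.inl 3)}) :
    a ∈ Ideal.span {F1 c, F2 c', X (Sum.inl 3)} := by
  refine nzd_of_norm c c' (X (Sum.inl 1)) 0 0 A B D ?_ ?_ _ G ?_ hG a ha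
  · simp [nrm]
  · have := relPrime_X_pow (Sum.inl 1) _ p hp hN 4
    have e : nrm c c' (X (Sum.inl 1)) 0 0 = (X (Sum.inl 1) : PP K) ^ 4 := by ring
    rw [e]; exact this.symm
  · simp

lemma nzd_F4 (hK : (12 : K) ≠ 0) (c c' A B : Fin 2 → K) (a : BB K)
    (ha : F4 B * a ∈ Ideal.span {F1 c, F2 c', F3 A}) :
    a ∈ Ideal.span {F1 c, F2 c', F3 A} := by
  refine nzd_of_norm c c' _ _ _ _ _ _ ?_ (nrm34 hK c c' (A 0) (A 1) (B 0) (B 1)) _ _ ?_ ?_ a ha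
  · intro h0
    have := congrArg (eval (Sum.elim ![1, 0] ![0,0,1,0])) h0
    simp [nrm, q1] at this
  · simp; ring
  · simp; ring

lemma nzd_z4 (c c' A : Fin 2 → K) (a : BB K)
    (ha : X (Sum.inl 3) * a ∈ Ideal.span {F1 c, F2 c', F3 A}) :
    a ∈ Ideal.span {F1 c, F2 c', F3 A} := by
  have hN1 : eval (Sum.elim ![1, 0] ![0,0,1,0]) (nrm c c' (X (Sum.inr 2) * X (Sum.inl 0)) (C (-(A 0)) * X (Sum.inr 0)) (C (-(A 1)) * X (Sum.inr 1))) = 1 := by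
    simp [nrm, q1]
  refine nzd_of_norm c c' (X (Sum.inr 2) * X (Sum.inl 0)) (C (-(A 0)) * X (Sum.inr 0)) (C (-(A 1)) * X (Sum.inr 1)) (X (Sum.inl 1)) 0 0 ?_ ?_ _ _ ?_ ?_ a ha
  · intro h0
    rw [h0] at hN1; simp at hN1
  · have := relPrime_X_pow (K := K) (Sum.inl 1) _ (Sum.elim ![1, 0] ![0,0,1,0]) rfl (hN1.trans_ne one_ne_zero) 4
    convert this using 1
    ring
  · simp; ring
  · simp

/-- base case -/
lemma soc_base (c c' : Fin 2 → K) (b : BB K)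
    (hb : ∀ i : Fin 4, ∃ r, X (Sum.inl i) * b - X (Sum.inl 2) * r ∈ Ideal.span {F1 c, F2 c', X (Sum.inl 3)}) :
    ∃ r t, b - X (Sum.inl 2) * r - t * (X (Sum.inl 0) * X (Sum.inl 1)) ∈ Ideal.span {F1 c, F2 c', X (Sum.inl 3)} := by
  classical
  let S : Set (Fin 4 ⊕ Fin 4 →₀ ℕ) := {Finsupp.single (Sum.inl 0) 2, Finsupp.single (Sum.inl 1) 2,
    Finsupp.single (Sum.inl 2) 1, Finsupp.single (Sum.inl 3) 1}
  let S' : Set (Fin 4 ⊕ Fin 4 →₀ ℕ) := insert (Finsupp.single (Sum.inl 0) 1 + Finsupp.single (Sum.inl 1) 1) S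
  have e1 : ((fun s => monomial s (1 : K)) '' S) = {X (Sum.inl 0) ^ 2, X (Sum.inl 1) ^ 2, X (Sum.inl 2), X (Sum.inl 3)} := by
    simp only [S, Set.image_insert_eq, Set.image_singleton, X_pow_eq_monomial]; rfl
  have e2 : ((fun s => monomial s (1 : K)) '' S') = {X (Sum.inl 0) * X (Sum.inl 1), X (Sum.inl 0) ^ 2, X (Sum.inl 1) ^ 2, X (Sum.inl 2), X (Sum.inl 3)} := by
    simp only [S', Set.image_insert_eq, e1]
    congr 1
    simp [X]
  have hb' : ∀ i : Fin 4, X (Sum.inl i) * b ∈ Ideal.span ((fun s => monomial s (1 : K)) '' S) := by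
    intro i
    obtain ⟨r, hr⟩ := hb i
    rw [mem_span3] at hr
    obtain ⟨r1, r2, r3, hr⟩ := hr
    rw [e1, mem_span4]
    refine ⟨r1, r2, r - r1 * C (c 0) * X (Sum.inl 2) - r2 * C (c' 0) * X (Sum.inl 2),
      r3 - r1 * C (c 1) * X (Sum.inl 3) - r2 * C (c' 1) * X (Sum.inl 3), ?_⟩
    linear_combination hr
  have hbS : b ∈ Ideal.span ((fun s => monomial s (1 : K)) '' S') := by
    rw [mem_ideal_span_monomial_image]
    intro m hm
    have key : ∀ i : Fin 4, ∃ si ∈ S, si ≤ m + Finsupp.single (Sum.inl i) 1 := by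
      intro i
      have := hb' i
      rw [mem_ideal_span_monomial_image] at this
      refine this (m + Finsupp.single (Sum.inl i) 1) ?_
      rw [mul_comm, mem_support_iff, coeff_mul_X]
      exact mem_support_iff.1 hm
    by_contra hcon
    push Not at hcon
    have hle : ∀ (j : Fin 4) (a : ℕ), ¬ (Finsupp.single (Sum.inl j : Fin 4 ⊕ Fin 4) a ≤ m) → m (Sum.inl j) < a := by
      intro j a h
      by_contra h'
      exact h (Finsupp.single_le_iff.2 (by omega))
    have h0 := hle 0 2 (hcon _ (by simp [S', S]))
    have h1 := hle 1 2 (hcon _ (by simp [S', S]))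
    have h2 := hle 2 1 (hcon _ (by simp [S', S]))
    have h3 := hle 3 1 (hcon _ (by simp [S', S]))
    have k0 : 1 ≤ m (Sum.inl 0) := by
      obtain ⟨si, hsi, hs⟩ := key 0
      simp only [S, Set.mem_insert_iff, Set.mem_singleton_iff] at hsi
      rcases hsi with rfl | rfl | rfl | rfl <;> rw [Finsupp.single_le_iff] at hs <;>
        simp [Finsupp.single_apply] at hs <;> omega
    have k1 : 1 ≤ m (Sum.inl 1) := by
      obtain ⟨si, hsi, hs⟩ := key 1
      simp only [S, Set.mem_insert_iff, Set.mem_singleton_iff] at hsi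
      rcases hsi with rfl | rfl | rfl | rfl <;> rw [Finsupp.single_le_iff] at hs <;>
        simp [Finsupp.single_apply] at hs <;> omega
    apply hcon (Finsupp.single (Sum.inl 0) 1 + Finsupp.single (Sum.inl 1) 1) (by simp [S'])
    intro j
    simp only [Finsupp.add_apply, Finsupp.single_apply]
    split_ifs with ha hb
    · rw [← ha] at hb; simp at hb
    · rw [← ha]; exact k0
    · rename_i hb; rw [← hb]; simpa using k1
    · simp
  rw [e2, Ideal.mem_span_insert] at hbS
  obtain ⟨t, z, hz, rfl⟩ := hbS
  rw [mem_span4] at hz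
  obtain ⟨r1, r2, r3, r4, rfl⟩ := hz
  refine ⟨r3 + r1 * C (c 0) * X (Sum.inl 2) + r2 * C (c' 0) * X (Sum.inl 2), t, ?_⟩
  rw [mem_span3]
  refine ⟨r1, r2, r4 + r1 * C (c 1) * X (Sum.inl 3) + r2 * C (c' 1) * X (Sum.inl 3), ?_⟩
  simp only [F1, F2]
  ring

lemma soc_base' (c c' : Fin 2 → K) (t : BB K)
    (ht : ∃ r, t * (X (Sum.inl 0) * X (Sum.inl 1)) - X (Sum.inl 2) * r ∈ Ideal.span {F1 c, F2 c', X (Sum.inl 3)}) :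
    t ∈ Ideal.span (Set.range fun i : Fin 4 => (X (Sum.inl i) : BB K)) := by
  classical
  let S : Set (Fin 4 ⊕ Fin 4 →₀ ℕ) := {Finsupp.single (Sum.inl 0) 2, Finsupp.single (Sum.inl 1) 2,
    Finsupp.single (Sum.inl 2) 1, Finsupp.single (Sum.inl 3) 1}
  let S' : Set (Fin 4 ⊕ Fin 4 →₀ ℕ) := Set.range fun i : Fin 4 => Finsupp.single (Sum.inl i) 1
  have e1 : ((fun s => monomial s (1 : K)) '' S) = {X (Sum.inl 0) ^ 2, X (Sum.inl 1) ^ 2, X (Sum.inl 2), X (Sum.inl 3)} := by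
    simp only [S, Set.image_insert_eq, Set.image_singleton, X_pow_eq_monomial]; rfl
  have e2 : ((fun s => monomial s (1 : K)) '' S') = Set.range fun i : Fin 4 => (X (Sum.inl i) : BB K) := by
    simp only [S', ← Set.range_comp]; rfl
  have hb' : t * (X (Sum.inl 0) * X (Sum.inl 1)) ∈ Ideal.span ((fun s => monomial s (1 : K)) '' S) := by
    obtain ⟨r, hr⟩ := ht
    rw [mem_span3] at hr
    obtain ⟨r1, r2, r3, hr⟩ := hr
    rw [e1, mem_span4]
    refine ⟨r1, r2, r - r1 * C (c 0) * X (Sum.inl 2) - r2 * C (c' 0) * X (Sum.inl 2),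
      r3 - r1 * C (c 1) * X (Sum.inl 3) - r2 * C (c' 1) * X (Sum.inl 3), ?_⟩
    linear_combination hr
  rw [← e2]
  rw [mem_ideal_span_monomial_image] at hb' ⊢
  intro m hm
  obtain ⟨si, hsi, hs⟩ := hb' (m + (Finsupp.single (Sum.inl 0) 1) + Finsupp.single (Sum.inl 1) 1) (by
    rw [← mul_assoc, mem_support_iff, coeff_mul_X, coeff_mul_X]
    exact mem_support_iff.1 hm)
  by_contra hcon
  push Not at hcon
  have h0 : ∀ j, m (Sum.inl j) = 0 := by
    intro j
    by_contra h'
    exact hcon (Finsupp.single (Sum.inl j) 1) ⟨j, rfl⟩ (Finsupp.single_le_iff.2 (by omega))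
  simp only [S, Set.mem_insert_iff, Set.mem_singleton_iff] at hsi
  rcases hsi with rfl | rfl | rfl | rfl <;> rw [Finsupp.single_le_iff] at hs <;>
    simp [Finsupp.single_apply, h0] at hs

/-- intermediate 3x3 determinant -/
abbrev e1 (c c' A : Fin 2 → K) : BB K :=
  - C (A 0) * C (c 0) * X (Sum.inr 0) * X (Sum.inl 1) * X (Sum.inl 2)
  - C (A 1) * C (c' 0) * X (Sum.inr 1) * X (Sum.inl 0) * X (Sum.inl 2)
  + X (Sum.inr 2) * X (Sum.inl 0) * X (Sum.inl 1)

/-- the matrix of coefficients of `F1,..,F4` -/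
abbrev mat4 (c c' A B : Fin 2 → K) : Matrix (Fin 4) (Fin 4) (BB K) :=
  !![X (Sum.inl 0), 0, -C (A 0) * X (Sum.inr 0), -C (B 0) * X (Sum.inr 0);
    0, X (Sum.inl 1), -C (A 1) * X (Sum.inr 1), -C (B 1) * X (Sum.inr 1);
    -C (c 0) * X (Sum.inl 2), -C (c' 0) * X (Sum.inl 2), X (Sum.inr 2), 0;
    -C (c 1) * X (Sum.inl 3), -C (c' 1) * X (Sum.inl 3), 0, X (Sum.inr 3)]

lemma det_fin_four {A : Type*} [CommRing A] (M : Matrix (Fin 4) (Fin 4) A) : M.det =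
    M 0 0 * (M 1 1 * (M 2 2 * M 3 3 - M 2 3 * M 3 2) - M 1 2 * (M 2 1 * M 3 3 - M 2 3 * M 3 1) + M 1 3 * (M 2 1 * M 3 2 - M 2 2 * M 3 1))
    - M 0 1 * (M 1 0 * (M 2 2 * M 3 3 - M 2 3 * M 3 2) - M 1 2 * (M 2 0 * M 3 3 - M 2 3 * M 3 0) + M 1 3 * (M 2 0 * M 3 2 - M 2 2 * M 3 0))
    + M 0 2 * (M 1 0 * (M 2 1 * M 3 3 - M 2 3 * M 3 1) - M 1 1 * (M 2 0 * M 3 3 - M 2 3 * M 3 0) + M 1 3 * (M 2 0 * M 3 1 - M 2 1 * M 3 0))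
    - M 0 3 * (M 1 0 * (M 2 1 * M 3 2 - M 2 2 * M 3 1) - M 1 1 * (M 2 0 * M 3 2 - M 2 2 * M 3 0) + M 1 2 * (M 2 0 * M 3 1 - M 2 1 * M 3 0)) := by
  simp [Matrix.det_succ_row_zero, Fin.sum_univ_succ, Fin.succAbove]
  ring

lemma det_mat4 (c c' A B : Fin 2 → K) : (mat4 c c' A B).det =
    C (A 0) * C (B 1) * C (c 0) * C (c' 1) * X (Sum.inr 0) * X (Sum.inr 1) * X (Sum.inl 2) * X (Sum.inl 3)
    - C (A 0) * C (B 1) * C (c 1) * C (c' 0) * X (Sum.inr 0) * X (Sum.inr 1) * X (Sum.inl 2) * X (Sum.inl 3)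
    - C (A 0) * C (c 0) * X (Sum.inr 0) * X (Sum.inr 3) * X (Sum.inl 1) * X (Sum.inl 2)
    - C (A 1) * C (B 0) * C (c 0) * C (c' 1) * X (Sum.inr 0) * X (Sum.inr 1) * X (Sum.inl 2) * X (Sum.inl 3)
    + C (A 1) * C (B 0) * C (c 1) * C (c' 0) * X (Sum.inr 0) * X (Sum.inr 1) * X (Sum.inl 2) * X (Sum.inl 3)
    - C (A 1) * C (c' 0) * X (Sum.inr 1) * X (Sum.inr 3) * X (Sum.inl 0) * X (Sum.inl 2)
    - C (B 0) * C (c 1) * X (Sum.inr 0) * X (Sum.inr 2) * X (Sum.inl 1) * X (Sum.inl 3)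
    - C (B 1) * C (c' 1) * X (Sum.inr 1) * X (Sum.inr 2) * X (Sum.inl 0) * X (Sum.inl 3)
    + X (Sum.inr 2) * X (Sum.inr 3) * X (Sum.inl 0) * X (Sum.inl 1) := by
  rw [det_fin_four]
  simp only [mat4, Matrix.of_apply, Matrix.cons_val', Matrix.cons_val_zero, Matrix.cons_val_one, Matrix.cons_val]
  ring

lemma he_B (c c' A : Fin 2 → K) :
    X (Sum.inl 2) * e1 c c' A - F3 A * (X (Sum.inl 0) * X (Sum.inl 1)) ∈ Ideal.span {F1 c, F2 c', X (Sum.inl 3)} := by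
  rw [mem_span3]
  refine ⟨C (A 0) * X (Sum.inr 0) * X (Sum.inl 1), C (A 1) * X (Sum.inr 1) * X (Sum.inl 0),
    C (A 0) * X (Sum.inr 0) * X (Sum.inl 1) * C (c 1) * X (Sum.inl 3) +
    C (A 1) * X (Sum.inr 1) * X (Sum.inl 0) * C (c' 1) * X (Sum.inl 3), ?_⟩
  simp only [e1, F1, F2, F3]
  ring

lemma he_A (c c' A B : Fin 2 → K) :
    X (Sum.inl 3) * (mat4 c c' A B).det - F4 B * e1 c c' A ∈ Ideal.span {F1 c, F2 c', F3 A} := by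
  rw [mem_span3, det_mat4]
  refine ⟨(C (A 0) * C (B 1) - C (A 1) * C (B 0)) * C (c' 0) * X (Sum.inr 0) * X (Sum.inr 1) * X (Sum.inl 2)
      + C (B 0) * X (Sum.inr 0) * X (Sum.inr 2) * X (Sum.inl 1),
    (C (A 1) * C (B 0) - C (A 0) * C (B 1)) * C (c 0) * X (Sum.inr 0) * X (Sum.inr 1) * X (Sum.inl 2)
      + C (B 1) * X (Sum.inr 1) * X (Sum.inr 2) * X (Sum.inl 0),
    C (B 0) * C (c 0) * X (Sum.inr 0) * X (Sum.inl 1) * X (Sum.inl 2) +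
    C (B 1) * C (c' 0) * X (Sum.inr 1) * X (Sum.inl 0) * X (Sum.inl 2), ?_⟩
  simp only [e1, F1, F2, F3, F4]
  ring

lemma nzd_F3_base (c c' A : Fin 2 → K) (a : BB K)
    (ha : F3 A * a ∈ Ideal.span {F1 c, F2 c', X (Sum.inl 3)}) :
    a ∈ Ideal.span {F1 c, F2 c', X (Sum.inl 3)} := by
  refine nzd_base c c' (X (Sum.inr 2) * X (Sum.inl 0)) (C (-(A 0)) * X (Sum.inr 0)) (C (-(A 1)) * X (Sum.inr 1))
    (Sum.elim ![1, 0] ![0,0,1,0]) rfl ?_ _ ?_ a ha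
  · simp [nrm, q1]
  · simp; ring

lemma nzd_z3_base (c c' : Fin 2 → K) (a : BB K)
    (ha : X (Sum.inl 2) * a ∈ Ideal.span {F1 c, F2 c', X (Sum.inl 3)}) :
    a ∈ Ideal.span {F1 c, F2 c', X (Sum.inl 3)} := by
  refine nzd_base c c' (X (Sum.inl 0)) 0 0
    (Sum.elim ![1, 0] ![0,0,1,0]) rfl ?_ _ ?_ a ha
  · simp [nrm, q1]
  · simp

lemma soc_B (c c' A : Fin 2 → K) (b : BB K)
    (hb : ∀ i : Fin 4, ∃ r, X (Sum.inl i) * b - X (Sum.inl 3) * r ∈ Ideal.span {F1 c, F2 c', F3 A}) :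
    ∃ r t, b - X (Sum.inl 3) * r - t * e1 c c' A ∈ Ideal.span {F1 c, F2 c', F3 A} := by
  obtain ⟨r, t, h⟩ := link_step (Ideal.span {F1 c, F2 c', X (Sum.inl 3)}) (fun i : Fin 4 => (X (Sum.inl i) : BB K)) 2
    (F3 A) (X (Sum.inl 2)) (X (Sum.inl 0) * X (Sum.inl 1)) (e1 c c' A) rfl
    (nzd_F3_base c c' A) (nzd_z3_base c c') (he_B c c' A) (soc_base c c') b (fun i => by
      obtain ⟨r, hr⟩ := hb i
      rw [mem_span3] at hr
      obtain ⟨r1, r2, r3, hr⟩ := hr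
      refine ⟨r3, ?_⟩
      rw [mem_span3]
      exact ⟨r1, r2, r, by linear_combination hr⟩)
  rw [mem_span3] at h
  obtain ⟨r1, r2, r3, h⟩ := h
  refine ⟨r3, t, ?_⟩
  rw [mem_span3]
  exact ⟨r1, r2, r, by linear_combination h⟩

lemma soc_B' (c c' A : Fin 2 → K) (t : BB K)
    (ht : ∃ r, t * e1 c c' A - X (Sum.inl 3) * r ∈ Ideal.span {F1 c, F2 c', F3 A}) :
    t ∈ Ideal.span (Set.range fun i : Fin 4 => (X (Sum.inl i) : BB K)) := by
  refine soc_base' c c' t (link_step' (Ideal.span {F1 c, F2 c', X (Sum.inl 3)}) (F3 A) (X (Sum.inl 2)) _ (e1 c c' A)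
    (nzd_F3_base c c' A) (he_B c c' A) t ?_)
  obtain ⟨r, hr⟩ := ht
  rw [mem_span3] at hr
  obtain ⟨r1, r2, r3, hr⟩ := hr
  refine ⟨r3, ?_⟩
  rw [mem_span3]
  exact ⟨r1, r2, r, by linear_combination hr⟩

lemma soc_A (hK : (12 : K) ≠ 0) (c c' A B : Fin 2 → K) (a : BB K)
    (ha : ∀ i : Fin 4, X (Sum.inl i) * a ∈ Ideal.span {F1 c, F2 c', F3 A, F4 B}) :
    ∃ t, a - t * (mat4 c c' A B).det ∈ Ideal.span {F1 c, F2 c', F3 A, F4 B} := by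
  obtain ⟨r, t, h⟩ := link_step (Ideal.span {F1 c, F2 c', F3 A}) (fun i : Fin 4 => (X (Sum.inl i) : BB K)) 3
    (F4 B) (X (Sum.inl 3)) (e1 c c' A) ((mat4 c c' A B).det) rfl
    (nzd_F4 hK c c' A B) (nzd_z4 c c' A) (he_A c c' A B) (soc_B c c' A) a (fun i => by
      have hr := ha i
      rw [mem_span4] at hr
      obtain ⟨r1, r2, r3, r4, hr⟩ := hr
      refine ⟨r4, ?_⟩
      rw [mem_span3]
      exact ⟨r1, r2, r3, by linear_combination hr⟩)
  rw [mem_span3] at h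
  obtain ⟨r1, r2, r3, h⟩ := h
  refine ⟨t, ?_⟩
  rw [mem_span4]
  exact ⟨r1, r2, r3, r, by linear_combination h⟩

lemma soc_A' (hK : (12 : K) ≠ 0) (c c' A B : Fin 2 → K) (t : BB K)
    (ht : t * (mat4 c c' A B).det ∈ Ideal.span {F1 c, F2 c', F3 A, F4 B}) :
    t ∈ Ideal.span (Set.range fun i : Fin 4 => (X (Sum.inl i) : BB K)) := by
  refine soc_B' c c' A t (link_step' (Ideal.span {F1 c, F2 c', F3 A}) (F4 B) (X (Sum.inl 3)) _ _
    (nzd_F4 hK c c' A B) (he_A c c' A B) t ?_)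
  rw [mem_span4] at ht
  obtain ⟨r1, r2, r3, r4, hr⟩ := ht
  refine ⟨r4, ?_⟩
  rw [mem_span3]
  exact ⟨r1, r2, r3, by linear_combination hr⟩

end diag2

/-! Part 3 -/

section diag3
variable {K : Type} [Field K]

/-- the ring `k[y]` -/
abbrev TT (K : Type) [Field K] := MvPolynomial (Fin 4) K

lemma X_mul_mem {σ : Type} (i : σ) (s : Set σ) (hi : i ∉ s) (a : MvPolynomial σ K)
    (h : X i * a ∈ Ideal.span (X '' s : Set (MvPolynomial σ K))) :
    a ∈ Ideal.span (X '' s : Set (MvPolynomial σ K)) := by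
  classical
  rw [mem_ideal_span_X_image] at h ⊢
  intro m hm
  obtain ⟨j, hj, hmj⟩ := h (m + Finsupp.single i 1) (by
    rw [mul_comm, mem_support_iff, coeff_mul_X]
    exact mem_support_iff.1 hm)
  refine ⟨j, hj, ?_⟩
  have : i ≠ j := by rintro rfl; exact hi hj
  simpa [Finsupp.single_apply, this] using hmj

lemma unscale {σ : Type} (u : K) (hu : u ≠ 0) (p : MvPolynomial σ K) : ∃ q, p = C u * q :=
  ⟨C u⁻¹ * p, by rw [← mul_assoc, ← C_mul, mul_inv_cancel₀ hu]; simp⟩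

lemma C_cancel {σ : Type} (u : K) (hu : u ≠ 0) {p q : MvPolynomial σ K} (h : C u * p = C u * q) :
    p = q := mul_left_cancel₀ (by simpa using hu) h

/-- syzygies: `X i * a + X j * b = X l * c` -/
lemma syz {σ : Type} (i j l : σ) (hij : i ≠ j) (hil : i ≠ l) (a b c : MvPolynomial σ K)
    (h : X i * a + X j * b = X l * c) : ∃ p q, a = X j * p + X l * q := by
  have h1 : X i * a ∈ Ideal.span (X '' {j, l} : Set (MvPolynomial σ K)) := by
    rw [Set.image_pair, Ideal.mem_span_pair]
    exact ⟨-b, c, by linear_combination -h⟩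
  have h2 := X_mul_mem i {j, l} (by simp [hij, hil]) a h1
  rw [Set.image_pair, Ideal.mem_span_pair] at h2
  obtain ⟨p, q, h2⟩ := h2
  exact ⟨p, q, by linear_combination -h2⟩

lemma syz1 {σ : Type} (i l : σ) (hil : i ≠ l) (a c : MvPolynomial σ K)
    (h : X i * a = X l * c) : ∃ q, a = X l * q := by
  have h1 : X i * a ∈ Ideal.span (X '' {l} : Set (MvPolynomial σ K)) := by
    rw [Set.image_singleton, Ideal.mem_span_singleton']
    exact ⟨c, by linear_combination -h⟩
  have h2 := X_mul_mem i {l} (by simp [hil]) a h1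
  rw [Set.image_singleton, Ideal.mem_span_singleton'] at h2
  obtain ⟨q, h2⟩ := h2
  exact ⟨q, by linear_combination -h2⟩

lemma ker_aux (D12 D13 D14 D23 D24 D34 : K) (h12 : D12 ≠ 0) (h13 : D13 ≠ 0) (h14 : D14 ≠ 0)
    (h23 : D23 ≠ 0) (h24 : D24 ≠ 0) (h34 : D34 ≠ 0)
    (hP : D12 * D34 - D13 * D24 + D14 * D23 = 0) (t : Fin 4 → TT K)
    (e4 : C D34 * X 2 * t 2 = - C D14 * X 0 * t 0 - C D24 * X 1 * t 1)
    (e3 : C D34 * X 3 * t 3 = C D13 * X 0 * t 0 + C D23 * X 1 * t 1) :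
    ∃ v : Fin 4 → TT K,
      t 0 = -(C D23 * X 1 * X 2 * v 3 - C D24 * X 1 * X 3 * v 2 + C D34 * X 2 * X 3 * v 1) ∧
      t 1 = (C D13 * X 0 * X 2 * v 3 - C D14 * X 0 * X 3 * v 2 + C D34 * X 2 * X 3 * v 0) ∧
      t 2 = -(C D12 * X 0 * X 1 * v 3 - C D14 * X 0 * X 3 * v 1 + C D24 * X 1 * X 3 * v 0) ∧
      t 3 = (C D12 * X 0 * X 1 * v 2 - C D13 * X 0 * X 2 * v 1 + C D23 * X 1 * X 2 * v 0) := by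
  have hPC : (C D12 * C D34 - C D13 * C D24 + C D14 * C D23 : TT K) = 0 := by
    simp only [← C_mul, ← C_sub, ← C_add, hP, C_0]
  obtain ⟨p0, q, hq⟩ := syz (K := K) (0 : Fin 4) 1 2 (by decide) (by decide) (C D14 * t 0) (C D24 * t 1) (- C D34 * t 2)
    (by linear_combination e4)
  obtain ⟨p0, rfl⟩ := unscale (D14 * D24) (mul_ne_zero h14 h24) p0
  obtain ⟨q, rfl⟩ := unscale D14 h14 q
  have hq1 : t 0 = C D24 * X 1 * p0 + X 2 * q := by
    apply C_cancel D14 h14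
    rw [hq, C_mul]; ring
  obtain ⟨q', hq'⟩ := syz1 (K := K) (1 : Fin 4) 2 (by decide) (C D24 * (t 1 + C D14 * X 0 * p0))
    (- C D34 * t 2 - C D14 * X 0 * q) (by
      rw [hq1] at e4; linear_combination e4)
  obtain ⟨q', rfl⟩ := unscale D24 h24 q'
  have hq2 : t 1 = - C D14 * X 0 * p0 + X 2 * q' := by
    have : t 1 + C D14 * X 0 * p0 = X 2 * q' := by
      apply C_cancel D24 h24; rw [hq']; ring
    linear_combination this
  have e3' : C D34 * X 3 * t 3 = X 0 * X 1 * p0 * (C D12 * C D34) + X 2 * (C D13 * X 0 * q + C D23 * X 1 * q') := by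
    rw [e3, hq1, hq2]; linear_combination (-(X 0 * X 1 * p0)) * hPC
  -- p0 ∈ (y2, y3)
  obtain ⟨p1, p2, hp⟩ : ∃ p1 p2, C D12 * C D34 * p0 = X 2 * p1 + X 3 * p2 := by
    have h1 : X 0 * (X 1 * (C D12 * C D34 * p0)) ∈ Ideal.span (X '' {2, 3} : Set (TT K)) := by
      rw [Set.image_pair, Ideal.mem_span_pair]
      exact ⟨-(C D13 * X 0 * q + C D23 * X 1 * q'), C D34 * t 3, by linear_combination e3'⟩
    have h2 := X_mul_mem _ _ (by simp) _ (X_mul_mem _ _ (by simp) _ h1)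
    rw [Set.image_pair, Ideal.mem_span_pair] at h2
    obtain ⟨p, q, h2⟩ := h2
    exact ⟨p, q, by linear_combination -h2⟩
  obtain ⟨p3, rfl⟩ := unscale (D12 * D34 * D23) (mul_ne_zero (mul_ne_zero h12 h34) h23) p1
  obtain ⟨p2, rfl⟩ := unscale (D12 * D34) (mul_ne_zero h12 h34) p2
  have hp0 : p0 = C D23 * X 2 * p3 + X 3 * p2 := by
    apply C_cancel (D12 * D34) (mul_ne_zero h12 h34)
    rw [C_mul, hp]; simp only [C_mul]; ring
  have e3'' : ∃ w, C D23 * X 0 * X 1 * p3 * (C D12 * C D34) + C D13 * X 0 * q + C D23 * X 1 * q' = X 3 * w := by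
    refine syz1 (K := K) (2 : Fin 4) 3 (by decide) _ (C D34 * t 3 - X 0 * X 1 * p2 * (C D12 * C D34)) ?_
    rw [hp0] at e3'
    linear_combination -e3'
  obtain ⟨w, hw⟩ := e3''
  obtain ⟨q2, q4, hq3⟩ := syz (K := K) (0 : Fin 4) 1 3 (by decide) (by decide) (C D13 * q)
    (C D23 * X 0 * p3 * (C D12 * C D34) + C D23 * q') w (by linear_combination hw)
  obtain ⟨q2, rfl⟩ := unscale (D13 * D23) (mul_ne_zero h13 h23) q2
  obtain ⟨v1, rfl⟩ := unscale (-D13 * D34) (mul_ne_zero (neg_ne_zero.2 h13) h34) q4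
  have hq4 : q = C D23 * X 1 * q2 - C D34 * X 3 * v1 := by
    apply C_cancel D13 h13
    rw [hq3]; simp only [C_mul, C_neg]; ring
  obtain ⟨v0, hv0⟩ := syz1 (K := K) (1 : Fin 4) 3 (by decide) (C D23 * (X 0 * (C D12 * C D34 * p3 + C D13 * q2) + q'))
    (w + C D13 * C D34 * X 0 * v1) (by
      rw [hq4] at hw
      linear_combination hw)
  obtain ⟨v0, rfl⟩ := unscale (D23 * D34) (mul_ne_zero h23 h34) v0
  have hq5 : q' = - X 0 * (C D12 * C D34 * p3 + C D13 * q2) + C D34 * X 3 * v0 := by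
    have : X 0 * (C D12 * C D34 * p3 + C D13 * q2) + q' = C D34 * X 3 * v0 := by
      apply C_cancel D23 h23
      rw [hv0]; simp only [C_mul]; ring
    linear_combination this
  have f0 : t 0 = -(C D23 * X 1 * X 2 * (-(C D24 * p3 + q2)) - C D24 * X 1 * X 3 * p2 + C D34 * X 2 * X 3 * v1) := by
    rw [hq1, hp0, hq4]; ring
  have f1 : t 1 = (C D13 * X 0 * X 2 * (-(C D24 * p3 + q2)) - C D14 * X 0 * X 3 * p2 + C D34 * X 2 * X 3 * v0) := by
    rw [hq2, hp0, hq5]; linear_combination (- X 0 * X 2 * p3) * hPC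
  refine ⟨![v0, v1, p2, -(C D24 * p3 + q2)], f0, f1, ?_, ?_⟩
  · have hX : (C D34 * X 2 : TT K) ≠ 0 := mul_ne_zero (by simpa using h34) (X_ne_zero _)
    apply mul_left_cancel₀ hX
    rw [e4, f0, f1]
    simp only [Matrix.cons_val]
    linear_combination (X 0 * X 1 * X 2 * (-(C D24 * p3 + q2))) * hPC
  · have hX : (C D34 * X 3 : TT K) ≠ 0 := mul_ne_zero (by simpa using h34) (X_ne_zero _)
    apply mul_left_cancel₀ hX
    rw [e3, f0, f1]
    simp only [Matrix.cons_val]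
    linear_combination (-X 0 * X 1 * X 3 * p2) * hPC


/-- linear form in the squares -/
abbrev m1 (A B : Fin 2 → K) : TT K :=
  C (A 0 * B 1 - A 1 * B 0) * X 0 ^ 2 - C (B 1) * X 2 ^ 2 + C (A 1) * X 3 ^ 2
/-- linear form in the squares -/
abbrev m2 (A B : Fin 2 → K) : TT K :=
  C (A 0 * B 1 - A 1 * B 0) * X 1 ^ 2 + C (B 0) * X 2 ^ 2 - C (A 0) * X 3 ^ 2
/-- quadratic form in the squares -/
abbrev GG (A B : Fin 2 → K) : TT K :=
  C (A 0 * B 1 ^ 2) * X 1 ^ 2 * X 2 ^ 2 - C (A 1 * B 0 ^ 2) * X 0 ^ 2 * X 2 ^ 2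
  - C (A 0 * B 1 - A 1 * B 0) * X 2 ^ 2 * X 3 ^ 2
  - C ((A 0 * B 1 + A 1 * B 0) * (A 0 * B 1 - A 1 * B 0)) * X 0 ^ 2 * X 1 ^ 2
  + C (A 0 ^ 2 * B 1) * X 0 ^ 2 * X 3 ^ 2 - C (A 1 ^ 2 * B 0) * X 1 ^ 2 * X 3 ^ 2

/-- The generator of the symmetric solutions, diagonal case. -/
def phiD (A B : Fin 2 → K) : Matrix (Fin 4) (Fin 4) (TT K) :=
  let p00 := 2 * (C (A 1 * B 1) * m2 A B * X 0 * X 1 * X 2 * X 3)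
  let p11 := 2 * (C (A 0 * B 0) * m1 A B * X 0 * X 1 * X 2 * X 3)
  let p01 := GG A B * X 2 * X 3
  let p02 := C (A 1) * X 1 * X 3 * (2 * (C (A 0 * B 1) * X 0 ^ 2 * m2 A B) + GG A B)
  let p03 := C (B 1) * X 1 * X 2 * (2 * (C (A 1 * B 0) * X 0 ^ 2 * m2 A B) + GG A B)
  let p12 := C (A 0) * X 0 * X 3 * (2 * (C (A 1 * B 0) * X 1 ^ 2 * m1 A B) + GG A B)
  let p13 := C (B 0) * X 0 * X 2 * (2 * (C (A 0 * B 1) * X 1 ^ 2 * m1 A B) + GG A B)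
  let p22 := C (A 0) * p00 + C (A 1) * p11
  let p33 := C (B 0) * p00 + C (B 1) * p11
  let p23 := X 0 * X 1 * (C (A 0 * B 1) * (2 * (C (A 1 * B 0) * X 0 ^ 2 * m2 A B) + GG A B) +
    C (A 1 * B 0) * (2 * (C (A 0 * B 1) * X 1 ^ 2 * m1 A B) + GG A B))
  !![p00, p01, p02, p03; p01, p11, p12, p13; p02, p12, p22, p23; p03, p13, p23, p33]

/-- normalized solution predicate -/
structure SolN (A B : Fin 2 → K) (t : Matrix (Fin 4) (Fin 4) (TT K)) : Prop where
  symm : ∀ i j, t i j = t j i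
  e2 : ∀ i, X 2 * t i 2 = C (A 0) * X 0 * t i 0 + C (A 1) * X 1 * t i 1
  e3 : ∀ i, X 3 * t i 3 = C (B 0) * X 0 * t i 0 + C (B 1) * X 1 * t i 1
  d2 : t 2 2 = C (A 0) * t 0 0 + C (A 1) * t 1 1
  d3 : t 3 3 = C (B 0) * t 0 0 + C (B 1) * t 1 1

lemma SolN_mk (A B : Fin 2 → K) (a b c d e f g h i j : TT K)
    (h1 : X 2 * c = C (A 0) * X 0 * a + C (A 1) * X 1 * b)
    (h2 : X 2 * f = C (A 0) * X 0 * b + C (A 1) * X 1 * e)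
    (h3 : X 2 * h = C (A 0) * X 0 * c + C (A 1) * X 1 * f)
    (h4 : X 2 * i = C (A 0) * X 0 * d + C (A 1) * X 1 * g)
    (k1 : X 3 * d = C (B 0) * X 0 * a + C (B 1) * X 1 * b)
    (k2 : X 3 * g = C (B 0) * X 0 * b + C (B 1) * X 1 * e)
    (k3 : X 3 * i = C (B 0) * X 0 * c + C (B 1) * X 1 * f)
    (k4 : X 3 * j = C (B 0) * X 0 * d + C (B 1) * X 1 * g)
    (l1 : h = C (A 0) * a + C (A 1) * e) (l2 : j = C (B 0) * a + C (B 1) * e) :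
    SolN A B !![a, b, c, d; b, e, f, g; c, f, h, i; d, g, i, j] := by
  constructor
  · intro i j
    fin_cases i <;> fin_cases j <;> rfl
  · intro i
    fin_cases i
    exacts [h1, h2, h3, h4]
  · intro i
    fin_cases i
    exacts [k1, k2, k3, k4]
  · exact l1
  · exact l2

lemma phiD_sol (A B : Fin 2 → K) : SolN A B (phiD A B) := by
  unfold phiD
  apply SolN_mk <;> simp only [C_mul, C_sub, C_add, C_pow, m1, m2, GG] <;> ring

lemma m_relPrime (A B : Fin 2 → K) (hE : A 0 * B 1 - A 1 * B 0 ≠ 0) :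
    IsRelPrime (m1 A B) (m2 A B) := by
  intro h h1 h2
  have hN0 : m1 A B ≠ 0 := by
    intro h0
    have := congrArg (eval ![1, 0, 0, 0]) h0
    simp at this
    exact hE this
  have hd : degreeOf (1 : Fin 4) (m1 A B) = 0 := by
    apply degreeOf_of_supported
    have hX : ∀ j : Fin 4, j ≠ 1 → (X j : TT K) ∈ supported K ({1}ᶜ : Set (Fin 4)) := by
      intro j hj
      exact X_mem_supported.2 (by simpa using hj)
    have hC : ∀ r : K, (C r : TT K) ∈ supported K ({1}ᶜ : Set (Fin 4)) := fun r =>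
      Subalgebra.algebraMap_mem _ r
    exact add_mem (sub_mem (mul_mem (hC _) (pow_mem (hX 0 (by decide)) 2)) (mul_mem (hC _) (pow_mem (hX 2 (by decide)) 2)))
      (mul_mem (hC _) (pow_mem (hX 3 (by decide)) 2))
  have kk : ∀ s : K, h ∣ C (A 0 * B 1 - A 1 * B 0) * C s ^ 2 + C (B 0) * X 2 ^ 2 - C (A 0) * X 3 ^ 2 := by
    intro s
    have := dvd_subst _ h _ _ hN0 hd h1 h2 s
    have u1 : Function.update (X : _ → TT K) 1 (C s) 1 = C s := Function.update_self ..
    have u2 : ∀ j, j ≠ 1 → Function.update (X : _ → TT K) 1 (C s) j = X j := fun j hj =>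
      Function.update_of_ne hj ..
    simpa only [map_sub, map_add, map_mul, map_pow, aeval_X, aeval_C, algebraMap_eq, map_ofNat,
      u1, u2 2 (by decide), u2 3 (by decide)] using this
  have key := dvd_sub (kk 1) (kk 0)
  have e : (C (A 0 * B 1 - A 1 * B 0) * C 1 ^ 2 + C (B 0) * X 2 ^ 2 - C (A 0) * X 3 ^ 2 -
    (C (A 0 * B 1 - A 1 * B 0) * C 0 ^ 2 + C (B 0) * X 2 ^ 2 - C (A 0) * X 3 ^ 2) : TT K) = C (A 0 * B 1 - A 1 * B 0) := by
    rw [C_1, C_0]; ring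
  rw [e] at key
  exact isUnit_of_dvd_unit key ((isUnit_iff_ne_zero.2 hE).map C)

lemma X_dvd_of (i : Fin 4) (s G : TT K) (p : Fin 4 → K) (hp : p i = 0) (hG : eval p G ≠ 0)
    (h : X i ∣ s * G) : X i ∣ s := by
  rcases (MvPolynomial.X_prime (R := K) (i := i)).dvd_or_dvd h with h | ⟨q, rfl⟩
  · exact h
  · simp [hp] at hG

lemma phiD_gen (h2 : (2 : K) ≠ 0) (A B : Fin 2 → K) (hA0 : A 0 ≠ 0) (hA1 : A 1 ≠ 0) (hB0 : B 0 ≠ 0) (hB1 : B 1 ≠ 0)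
    (hE : A 0 * B 1 - A 1 * B 0 ≠ 0) (t : Matrix (Fin 4) (Fin 4) (TT K)) (ht : SolN A B t) :
    ∃ s : TT K, ∀ i j, t i j = s * phiD A B i j := by
  obtain ⟨symm, e2, e3, d2, d3⟩ := ht
  have hE' : A 1 * B 0 - A 0 * B 1 ≠ 0 := fun h => hE (by linear_combination -h)
  have hX : ∀ i : Fin 4, (X i : TT K) ≠ 0 := fun i => X_ne_zero _
  have h2C : (2 : TT K) ≠ 0 := by
    have : (2 : TT K) = C 2 := (map_ofNat C 2).symm
    rw [this]; simpa using h2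
  have CA0 : (C (A 0) : TT K) ≠ 0 := by simpa using hA0
  have CA1 : (C (A 1) : TT K) ≠ 0 := by simpa using hA1
  have CB0 : (C (B 0) : TT K) ≠ 0 := by simpa using hB0
  have CB1 : (C (B 1) : TT K) ≠ 0 := by simpa using hB1
  have r1 : X 2 ^ 2 * (C (A 0) * t 0 0 + C (A 1) * t 1 1) = C (A 0) ^ 2 * X 0 ^ 2 * t 0 0 + 2 * C (A 0) * C (A 1) * X 0 * X 1 * t 0 1
      + C (A 1) ^ 2 * X 1 ^ 2 * t 1 1 := by
    have a := e2 2; have b := e2 0; have c := e2 1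
    rw [symm 2 0, symm 2 1] at a
    rw [symm 1 0] at c
    rw [d2] at a
    linear_combination X 2 * a + C (A 0) * X 0 * b + C (A 1) * X 1 * c
  have r2 : X 3 ^ 2 * (C (B 0) * t 0 0 + C (B 1) * t 1 1) = C (B 0) ^ 2 * X 0 ^ 2 * t 0 0 + 2 * C (B 0) * C (B 1) * X 0 * X 1 * t 0 1
      + C (B 1) ^ 2 * X 1 ^ 2 * t 1 1 := by
    have a := e3 3; have b := e3 0; have c := e3 1
    rw [symm 3 0, symm 3 1] at a
    rw [symm 1 0] at c
    rw [d3] at a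
    linear_combination X 3 * a + C (B 0) * X 0 * b + C (B 1) * X 1 * c
  have r3 : m2 A B * (C (A 1 * B 1) * t 1 1) = m1 A B * (C (A 0 * B 0) * t 0 0) := by
    simp only [m1, m2, C_mul, C_sub]
    linear_combination (C (B 0) * C (B 1)) * r1 - C (A 0) * C (A 1) * r2
  obtain ⟨s, hs⟩ := (m_relPrime A B hE).dvd_of_dvd_mul_left (Dvd.intro _ r3.symm)
  obtain ⟨s, rfl⟩ := unscale (A 0 * B 0 * (A 1 * B 1))
    (mul_ne_zero (mul_ne_zero hA0 hB0) (mul_ne_zero hA1 hB1)) s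
  have t11 : t 1 1 = C (A 0 * B 0) * m1 A B * s := by
    apply C_cancel (A 1 * B 1) (mul_ne_zero hA1 hB1)
    rw [hs]; simp only [C_mul]; ring
  have t00 : t 0 0 = C (A 1 * B 1) * m2 A B * s := by
    have hm1 : m1 A B ≠ 0 := by
      intro h0
      have := congrArg (eval ![1, 0, 0, 0]) h0
      simp at this
      exact hE this
    apply mul_left_cancel₀ (mul_ne_zero hm1 (mul_ne_zero CA0 CB0))
    rw [t11] at r3
    simp only [C_mul] at r3 ⊢
    linear_combination -r3
  have t01 : 2 * X 0 * X 1 * t 0 1 = s * GG A B := by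
    apply mul_left_cancel₀ (mul_ne_zero CA0 CA1)
    rw [t11, t00] at r1
    simp only [C_mul, C_sub, C_add, C_pow, m1, m2, GG] at r1 ⊢
    linear_combination -r1
  have s0 : X 0 ∣ s := by
    refine X_dvd_of 0 s (GG A B) ![0, 0, 1, 1] rfl ?_ ⟨2 * X 1 * t 0 1, by linear_combination -t01⟩
    simpa using hE'
  have s1 : X 1 ∣ s := by
    refine X_dvd_of 1 s (GG A B) ![0, 0, 1, 1] rfl ?_ ⟨2 * X 0 * t 0 1, by linear_combination -t01⟩
    simpa using hE'
  have t02 : 2 * X 0 * X 2 * t 0 2 = s * (C (A 1) * (2 * (C (A 0 * B 1) * X 0 ^ 2 * m2 A B) + GG A B)) := by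
    apply mul_left_cancel₀ (hX 1)
    have b := e2 0
    rw [t00] at b
    simp only [C_mul] at b ⊢
    linear_combination 2 * X 0 * X 1 * b + C (A 1) * X 1 * t01
  have s2 : X 2 ∣ s := by
    refine X_dvd_of 2 s (C (A 1) * (2 * (C (A 0 * B 1) * X 0 ^ 2 * m2 A B) + GG A B)) ![0, 1, 0, 1] rfl ?_ ⟨2 * X 0 * t 0 2, by linear_combination -t02⟩
    simp [hA1, hB0]
  have t03 : 2 * X 0 * X 3 * t 0 3 = s * (C (B 1) * (2 * (C (A 1 * B 0) * X 0 ^ 2 * m2 A B) + GG A B)) := by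
    apply mul_left_cancel₀ (hX 1)
    have b := e3 0
    rw [t00] at b
    simp only [C_mul] at b ⊢
    linear_combination 2 * X 0 * X 1 * b + C (B 1) * X 1 * t01
  have s3 : X 3 ∣ s := by
    refine X_dvd_of 3 s (C (B 1) * (2 * (C (A 1 * B 0) * X 0 ^ 2 * m2 A B) + GG A B)) ![0, 1, 1, 0] rfl ?_ ⟨2 * X 0 * t 0 3, by linear_combination -t03⟩
    simp [hB1, hA0]
  have hs4 : ∃ s', s = 2 * (X 0 * X 1 * X 2 * X 3 * s') := by
    obtain ⟨a, rfl⟩ := s0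
    obtain ⟨b, hb⟩ := s1
    obtain ⟨a, rfl⟩ := syz1 _ _ (by decide) _ _ hb
    obtain ⟨b, hb⟩ := s2
    obtain ⟨a, rfl⟩ := syz1 _ _ (by decide) _ _ (syz1 _ _ (by decide) _ _ hb).choose_spec
    obtain ⟨b, hb⟩ := s3
    obtain ⟨c, hc⟩ := syz1 _ _ (by decide) _ _ hb
    obtain ⟨c, hc⟩ := syz1 _ _ (by decide) _ _ hc
    obtain ⟨c, rfl⟩ := syz1 _ _ (by decide) _ _ hc
    obtain ⟨c, rfl⟩ := unscale 2 h2 c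
    refine ⟨c, ?_⟩
    have : (C 2 : TT K) = 2 := map_ofNat C 2
    rw [this]; ring
  obtain ⟨s', rfl⟩ := hs4
  have sol := phiD_sol A B
  have u00 : t 0 0 = s' * phiD A B 0 0 := by
    rw [t00]; simp only [phiD, Matrix.of_apply, Matrix.cons_val', Matrix.cons_val_zero]; ring
  have u11 : t 1 1 = s' * phiD A B 1 1 := by
    rw [t11]; simp only [phiD, Matrix.of_apply, Matrix.cons_val', Matrix.cons_val_zero, Matrix.cons_val_one]; ring
  have u01 : t 0 1 = s' * phiD A B 0 1 := by
    apply mul_left_cancel₀ (mul_ne_zero (mul_ne_zero h2C (hX 0)) (hX 1))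
    rw [t01]; simp only [phiD, Matrix.of_apply, Matrix.cons_val', Matrix.cons_val_zero, Matrix.cons_val_one]; ring
  have w2 : ∀ i, t i 0 = s' * phiD A B i 0 → t i 1 = s' * phiD A B i 1 → t i 2 = s' * phiD A B i 2 := by
    intro i h0 h1
    apply mul_left_cancel₀ (hX 2)
    rw [e2 i, h0, h1]
    linear_combination - s' * sol.e2 i
  have w3 : ∀ i, t i 0 = s' * phiD A B i 0 → t i 1 = s' * phiD A B i 1 → t i 3 = s' * phiD A B i 3 := by
    intro i h0 h1
    apply mul_left_cancel₀ (hX 3)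
    rw [e3 i, h0, h1]
    linear_combination - s' * sol.e3 i
  have u10 : t 1 0 = s' * phiD A B 1 0 := by rw [symm, u01, sol.symm]
  have u20 : t 2 0 = s' * phiD A B 2 0 := by rw [symm, w2 0 u00 u01, sol.symm]
  have u21 : t 2 1 = s' * phiD A B 2 1 := by rw [symm, w2 1 u10 u11, sol.symm]
  have u30 : t 3 0 = s' * phiD A B 3 0 := by rw [symm, w3 0 u00 u01, sol.symm]
  have u31 : t 3 1 = s' * phiD A B 3 1 := by rw [symm, w3 1 u10 u11, sol.symm]
  refine ⟨s', fun i j => ?_⟩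
  fin_cases i <;> fin_cases j
  exacts [u00, u01, w2 0 u00 u01, w3 0 u00 u01, u10, u11, w2 1 u10 u11, w3 1 u10 u11,
    u20, u21, w2 2 u20 u21, w3 2 u20 u21, u30, u31, w2 3 u30 u31, w3 3 u30 u31]

lemma phiD_ne (A B : Fin 2 → K) (hE : A 0 * B 1 - A 1 * B 0 ≠ 0) : phiD A B 0 1 ≠ 0 := by
  intro h0
  have := congrArg (eval ![0, 0, 1, 1]) h0
  simp [phiD] at this
  exact hE (by linear_combination -this)

lemma phiD_hom (A B : Fin 2 → K) (i j : Fin 4) : (phiD A B i j).IsHomogeneous 6 := by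
  have hX : ∀ i : Fin 4, (X i : TT K).IsHomogeneous 1 := fun i => isHomogeneous_X K i
  have hC : ∀ r : K, (C r : TT K).IsHomogeneous 0 := fun r => isHomogeneous_C _ r
  have h2 : (2 : TT K).IsHomogeneous 0 := by
    have : (2 : TT K) = C 2 := (map_ofNat C 2).symm
    rw [this]; exact hC 2
  have q : ∀ (r : K) i, (C r * X i ^ 2 : TT K).IsHomogeneous 2 := fun r i => (hC r).mul ((hX i).pow 2)
  have q4 : ∀ (r : K) i j, (C r * X i ^ 2 * X j ^ 2 : TT K).IsHomogeneous 4 := fun r i j => (q r i).mul ((hX j).pow 2)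
  have hm1 : (m1 A B).IsHomogeneous 2 := ((q _ _).sub (q _ _)).add (q _ _)
  have hm2 : (m2 A B).IsHomogeneous 2 := ((q _ _).add (q _ _)).sub (q _ _)
  have hG : (GG A B).IsHomogeneous 4 :=
    (((((q4 _ _ _).sub (q4 _ _ _)).sub (q4 _ _ _)).sub (q4 _ _ _)).add (q4 _ _ _)).sub (q4 _ _ _)
  have a1 : ∀ (r : K) (m : TT K), m.IsHomogeneous 2 → (2 * (C r * m * X 0 * X 1 * X 2 * X 3)).IsHomogeneous 6 :=
    fun r m hm => h2.mul ((((((hC r).mul hm).mul (hX 0)).mul (hX 1)).mul (hX 2)).mul (hX 3))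
  have a2 : ∀ (r : K) (i : Fin 4) (m : TT K), m.IsHomogeneous 2 → (2 * (C r * X i ^ 2 * m) + GG A B).IsHomogeneous 4 :=
    fun r i m hm => (h2.mul ((q r i).mul hm)).add hG
  have a3 : ∀ (r : K) (i j : Fin 4) (m : TT K), m.IsHomogeneous 4 → (C r * X i * X j * m).IsHomogeneous 6 :=
    fun r i j m hm => (((hC r).mul (hX i)).mul (hX j)).mul hm
  have p01 : (GG A B * X 2 * X 3).IsHomogeneous 6 := (hG.mul (hX 2)).mul (hX 3)
  have p23 := ((hX 0).mul (hX 1)).mul (((hC (A 0 * B 1)).mul (a2 (A 1 * B 0) 0 _ hm2)).add ((hC (A 1 * B 0)).mul (a2 (A 0 * B 1) 1 _ hm1)))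
  have p22 : ∀ r s : K, (C r * (2 * (C (A 1 * B 1) * m2 A B * X 0 * X 1 * X 2 * X 3)) +
    C s * (2 * (C (A 0 * B 0) * m1 A B * X 0 * X 1 * X 2 * X 3)) : TT K).IsHomogeneous 6 := fun r s =>
     ((hC r).mul (a1 _ _ hm2)).add ((hC s).mul (a1 _ _ hm1))
  fin_cases i <;> fin_cases j
  exacts [a1 _ _ hm2, p01, a3 _ _ _ _ (a2 _ _ _ hm2), a3 _ _ _ _ (a2 _ _ _ hm2), p01, a1 _ _ hm1,
    a3 _ _ _ _ (a2 _ _ _ hm1), a3 _ _ _ _ (a2 _ _ _ hm1), a3 _ _ _ _ (a2 _ _ _ hm2), a3 _ _ _ _ (a2 _ _ _ hm1),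
    p22 _ _, p23, a3 _ _ _ _ (a2 _ _ _ hm2), a3 _ _ _ _ (a2 _ _ _ hm1), p23, p22 _ _]

end diag3

/-! Part 4 -/

section gen
variable {K : Type} [Field K]

/-- `x` as a vector -/
abbrev vx (K : Type) [Field K] : Fin 4 → BB K := fun j => X (Sum.inl j)
/-- `y` as a vector -/
abbrev vy (K : Type) [Field K] : Fin 4 → BB K := fun j => X (Sum.inr j)
/-- `M x` -/
def hx (M : Matrix (Fin 4) (Fin 4) K) : Fin 4 → BB K := (M.map C).mulVec (vx K)
/-- `M y` -/
def hy (M : Matrix (Fin 4) (Fin 4) K) : Fin 4 → BB K := (M.map C).mulVec (vy K)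
/-- `M y` in `T` -/
def ly (M : Matrix (Fin 4) (Fin 4) K) : Fin 4 → TT K := (M.map C).mulVec X
/-- `xᵀ M x` -/
def qf (M : Matrix (Fin 4) (Fin 4) K) : BB K := dotProduct (vx K) (hx M)
/-- `yᵀ M x` -/
def bl (M : Matrix (Fin 4) (Fin 4) K) : BB K := dotProduct (vy K) (hx M)
/-- the ideal -/
def LL (M N : Matrix (Fin 4) (Fin 4) K) : Ideal (BB K) := Ideal.span {qf M, qf N, bl M, bl N}
/-- the determinant -/
def Det (M N : Matrix (Fin 4) (Fin 4) K) : BB K := (Matrix.of ![hy M, hy N, hx M, hx N]).det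
/-- the cross product -/
def cr (M N : Matrix (Fin 4) (Fin 4) K) (v : Fin 4 → TT K) : Fin 4 → TT K :=
  fun i => (Matrix.of ![ly M, ly N, v, Pi.single i 1]).det

/-- symmetric solutions -/
structure Sol (M N : Matrix (Fin 4) (Fin 4) K) (t : Matrix (Fin 4) (Fin 4) (TT K)) : Prop where
  symm : t.transpose = t
  e1 : t.mulVec (ly M) = 0
  e2 : t.mulVec (ly N) = 0
  d1 : (M.map C * t).trace = 0
  d2 : (N.map C * t).trace = 0

/-- The facts about a pair of quadrics that we need. -/
structure Good (M N : Matrix (Fin 4) (Fin 4) K) : Prop where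
  soc : ∀ a, (∀ i, X (Sum.inl i) * a ∈ LL M N) → ∃ t, a - t * Det M N ∈ LL M N
  soc' : ∀ t, t * Det M N ∈ LL M N → t ∈ Ideal.span (Set.range (vx K))
  ker : ∀ t : Fin 4 → TT K, dotProduct t (ly M) = 0 → dotProduct t (ly N) = 0 → ∃ v, t = cr M N v
  kerc : ∀ v : Fin 4 → K, cr M N (fun i => C (v i)) = 0 → v = 0
  sol : ∃ φ, Sol M N φ ∧ (∃ i j, φ i j ≠ 0) ∧ (∀ i j, (φ i j).IsHomogeneous 6) ∧
    ∀ t, Sol M N t → ∃ s, ∀ i j, t i j = s * φ i j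

/-- the 2x2 minor -/
abbrev DD (α β : Fin 4 → K) (i j : Fin 4) : K := α i * β j - α j * β i

lemma hx_diag (α : Fin 4 → K) : hx (Matrix.diagonal α) = fun i => C (α i) * X (Sum.inl i) := by
  funext i
  simp [hx, Matrix.diagonal_map, Matrix.mulVec_diagonal]
lemma hy_diag (α : Fin 4 → K) : hy (Matrix.diagonal α) = fun i => C (α i) * X (Sum.inr i) := by
  funext i
  simp [hy, Matrix.diagonal_map, Matrix.mulVec_diagonal]
lemma ly_diag (α : Fin 4 → K) : ly (Matrix.diagonal α) = fun i => C (α i) * X i := by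
  funext i
  simp [ly, Matrix.diagonal_map, Matrix.mulVec_diagonal]

lemma C_unit {σ : Type} (u : K) (hu : u ≠ 0) : IsUnit (C u : MvPolynomial σ K) :=
  (isUnit_iff_ne_zero.2 hu).map C

lemma det_rows {A : Type*} [CommRing A] (a b c d : Fin 4 → A) :
    (Matrix.of ![a, b, c, d]).det =
    a 0 * (b 1 * (c 2 * d 3 - c 3 * d 2) - b 2 * (c 1 * d 3 - c 3 * d 1) + b 3 * (c 1 * d 2 - c 2 * d 1))
    - a 1 * (b 0 * (c 2 * d 3 - c 3 * d 2) - b 2 * (c 0 * d 3 - c 3 * d 0) + b 3 * (c 0 * d 2 - c 2 * d 0))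
    + a 2 * (b 0 * (c 1 * d 3 - c 3 * d 1) - b 1 * (c 0 * d 3 - c 3 * d 0) + b 3 * (c 0 * d 1 - c 1 * d 0))
    - a 3 * (b 0 * (c 1 * d 2 - c 2 * d 1) - b 1 * (c 0 * d 2 - c 2 * d 0) + b 2 * (c 0 * d 1 - c 1 * d 0)) := by
  rw [det_fin_four]; rfl

lemma pair_aux {A : Type*} [CommRing A] (J : Ideal A) (a0 a1 b0 b1 u q q' p p' : A) (hu : IsUnit u)
    (e : u = a0 * b1 - a1 * b0) (h1 : u * p = b1 * q - a1 * q') (h2 : u * p' = - b0 * q + a0 * q') :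
    (p ∈ J ∧ p' ∈ J) ↔ (q ∈ J ∧ q' ∈ J) := by
  constructor
  · rintro ⟨hp, hp'⟩
    rw [← Ideal.unit_mul_mem_iff_mem J hu, ← Ideal.unit_mul_mem_iff_mem J (x := q') hu]
    have e1 : u * q = (a0 * u) * p + (a1 * u) * p' := by
      linear_combination q * e - a0 * h1 - a1 * h2
    have e2 : u * q' = (b0 * u) * p + (b1 * u) * p' := by
      linear_combination q' * e - b0 * h1 - b1 * h2
    rw [e1, e2]
    exact ⟨add_mem (J.mul_mem_left _ hp) (J.mul_mem_left _ hp'), add_mem (J.mul_mem_left _ hp) (J.mul_mem_left _ hp')⟩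
  · rintro ⟨hp, hp'⟩
    rw [← Ideal.unit_mul_mem_iff_mem J hu, ← Ideal.unit_mul_mem_iff_mem J (x := p') hu, h1, h2]
    exact ⟨sub_mem (J.mul_mem_left _ hp) (J.mul_mem_left _ hp'), add_mem (J.mul_mem_left _ hp) (J.mul_mem_left _ hp')⟩

/-- `L` in the normalized form -/
lemma LL_diag (α β : Fin 4 → K) (h12 : DD α β 0 1 ≠ 0) (h34 : DD α β 2 3 ≠ 0)
    (c c' A B : Fin 2 → K) (hc0 : DD α β 0 1 * c 0 = DD α β 1 2) (hc1 : DD α β 0 1 * c 1 = DD α β 1 3)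
    (hc0' : DD α β 0 1 * c' 0 = - DD α β 0 2) (hc1' : DD α β 0 1 * c' 1 = - DD α β 0 3)
    (hA0 : DD α β 2 3 * A 0 = - DD α β 0 3) (hA1 : DD α β 2 3 * A 1 = - DD α β 1 3)
    (hB0 : DD α β 2 3 * B 0 = DD α β 0 2) (hB1 : DD α β 2 3 * B 1 = DD α β 1 2) :
    LL (Matrix.diagonal α) (Matrix.diagonal β) = Ideal.span {F1 c, F2 c', F3 A, F4 B} ∧
    Associated ((mat4 c c' A B).det) (Det (Matrix.diagonal α) (Matrix.diagonal β)) := by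
  have cc : ∀ {u v : K}, u = v → (C u : BB K) = C v := fun h => by rw [h]
  replace hc0 := cc hc0
  replace hc1 := cc hc1
  replace hc0' := cc hc0'
  replace hc1' := cc hc1'
  replace hA0 := cc hA0
  replace hA1 := cc hA1
  replace hB0 := cc hB0
  replace hB1 := cc hB1
  simp only [C_mul, C_sub, C_neg] at hc0 hc1 hc0' hc1' hA0 hA1 hB0 hB1
  have q : ∀ α : Fin 4 → K, qf (Matrix.diagonal α) = C (α 0) * X (Sum.inl 0) ^ 2 + C (α 1) * X (Sum.inl 1) ^ 2
      + C (α 2) * X (Sum.inl 2) ^ 2 + C (α 3) * X (Sum.inl 3) ^ 2 := by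
    intro α
    simp only [qf, hx_diag, dotProduct, Fin.sum_univ_four]; ring
  have b : ∀ α : Fin 4 → K, bl (Matrix.diagonal α) = C (α 0) * (X (Sum.inr 0) * X (Sum.inl 0)) + C (α 1) * (X (Sum.inr 1) * X (Sum.inl 1))
      + C (α 2) * (X (Sum.inr 2) * X (Sum.inl 2)) + C (α 3) * (X (Sum.inr 3) * X (Sum.inl 3)) := by
    intro α
    simp only [bl, hx_diag, dotProduct, Fin.sum_univ_four]; ring
  have u12 := C_unit (σ := Fin 4 ⊕ Fin 4) _ h12
  have u34 := C_unit (σ := Fin 4 ⊕ Fin 4) _ h34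
  have e1 : C (DD α β 0 1) * F1 c = C (β 1) * qf (Matrix.diagonal α) - C (α 1) * qf (Matrix.diagonal β) := by
    rw [q, q]; simp only [F1, C_mul, C_sub, C_neg]
    linear_combination -X (Sum.inl 2) ^ 2 * hc0 - X (Sum.inl 3) ^ 2 * hc1
  have e2 : C (DD α β 0 1) * F2 c' = -C (β 0) * qf (Matrix.diagonal α) + C (α 0) * qf (Matrix.diagonal β) := by
    rw [q, q]; simp only [F1, C_mul, C_sub, C_neg]
    linear_combination -X (Sum.inl 2) ^ 2 * hc0' - X (Sum.inl 3) ^ 2 * hc1'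
  have e3 : C (DD α β 2 3) * F3 A = C (β 3) * bl (Matrix.diagonal α) - C (α 3) * bl (Matrix.diagonal β) := by
    rw [b, b]; simp only [F1, C_mul, C_sub, C_neg]
    linear_combination -X (Sum.inl 0) * X (Sum.inr 0) * hA0 - X (Sum.inl 1) * X (Sum.inr 1) * hA1
  have e4 : C (DD α β 2 3) * F4 B = -C (β 2) * bl (Matrix.diagonal α) + C (α 2) * bl (Matrix.diagonal β) := by
    rw [b, b]; simp only [F1, C_mul, C_sub, C_neg]
    linear_combination -X (Sum.inl 0) * X (Sum.inr 0) * hB0 - X (Sum.inl 1) * X (Sum.inr 1) * hB1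
  have dd : ∀ i j, (C (DD α β i j) : BB K) = C (α i) * C (β j) - C (α j) * C (β i) := fun i j => by
    simp only [C_mul, C_sub]
  have P1 := fun J : Ideal (BB K) => pair_aux J _ _ _ _ _ _ _ _ _ u12 (dd 0 1) e1 e2
  have P2 := fun J : Ideal (BB K) => pair_aux J _ _ _ _ _ _ _ _ _ u34 (dd 2 3) e3 e4
  constructor
  · apply le_antisymm
    · rw [LL, Ideal.span_le]
      simp only [Set.insert_subset_iff, Set.singleton_subset_iff, SetLike.mem_coe]
      have h1 := (P1 (Ideal.span {F1 c, F2 c', F3 A, F4 B})).1 ⟨Ideal.subset_span (by simp), Ideal.subset_span (by simp)⟩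
      have h2 := (P2 (Ideal.span {F1 c, F2 c', F3 A, F4 B})).1 ⟨Ideal.subset_span (by simp), Ideal.subset_span (by simp)⟩
      exact ⟨h1.1, h1.2, h2⟩
    · rw [Ideal.span_le]
      simp only [Set.insert_subset_iff, Set.singleton_subset_iff, SetLike.mem_coe]
      have h1 := (P1 (LL (Matrix.diagonal α) (Matrix.diagonal β))).2 ⟨Ideal.subset_span (by simp), Ideal.subset_span (by simp)⟩
      have h2 := (P2 (LL (Matrix.diagonal α) (Matrix.diagonal β))).2 ⟨Ideal.subset_span (by simp), Ideal.subset_span (by simp)⟩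
      exact ⟨h1.1, h1.2, h2⟩
  · have key : Matrix.diagonal ![C (DD α β 0 1), C (DD α β 0 1), C (DD α β 2 3), C (DD α β 2 3)] * (mat4 c c' A B).transpose
      = !![C (β 1), -C (α 1), 0, 0; -C (β 0), C (α 0), 0, 0; 0, 0, C (β 3), - C (α 3); 0, 0, - C (β 2), C (α 2)] *
        Matrix.of ![hx (Matrix.diagonal α), hx (Matrix.diagonal β), hy (Matrix.diagonal α), hy (Matrix.diagonal β)] := by
      funext i j
      rw [Matrix.diagonal_mul, Matrix.mul_apply, Fin.sum_univ_four, hx_diag, hx_diag, hy_diag, hy_diag]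
      fin_cases i <;> fin_cases j <;> simp [-mul_neg, -neg_mul]
      · ring
      · ring
      · linear_combination - X (Sum.inl 2) * hc0
      · linear_combination - X (Sum.inl 3) * hc1
      · ring
      · ring
      · linear_combination - X (Sum.inl 2) * hc0'
      · linear_combination - X (Sum.inl 3) * hc1'
      · linear_combination - X (Sum.inr 0) * hA0
      · linear_combination - X (Sum.inr 1) * hA1
      · ring
      · ring
      · linear_combination - X (Sum.inr 0) * hB0
      · linear_combination - X (Sum.inr 1) * hB1
      · ring
      · ring
    replace key := congrArg Matrix.det key
    rw [Matrix.det_mul, Matrix.det_mul, Matrix.det_diagonal, Matrix.det_transpose, Fin.prod_univ_four] at key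
    have w : (!![C (β 1), -C (α 1), 0, 0; -C (β 0), C (α 0), 0, 0; 0, 0, C (β 3), - C (α 3); 0, 0, - C (β 2), C (α 2)] : Matrix _ _ (BB K)).det =
      C (DD α β 0 1) * C (DD α β 2 3) := by
      rw [det_fin_four, dd, dd]
      simp
      ring
    have w2 : (Matrix.of ![hx (Matrix.diagonal α), hx (Matrix.diagonal β), hy (Matrix.diagonal α), hy (Matrix.diagonal β)]).det =
      Det (Matrix.diagonal α) (Matrix.diagonal β) := by
      rw [Det, det_rows, det_rows]; ring
    rw [w, w2] at key
    obtain ⟨v, hv⟩ := u12.mul u34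
    refine ⟨v, ?_⟩
    rw [hv]
    apply mul_left_cancel₀ (u12.mul u34).ne_zero
    simp only [Matrix.cons_val] at key
    linear_combination key

lemma Good_diag [CharZero K] (α β : Fin 4 → K) (hD : ∀ i j, i ≠ j → DD α β i j ≠ 0) :
    Good (Matrix.diagonal α) (Matrix.diagonal β) := by
  have h12 := hD 0 1 (by decide)
  have h13 := hD 0 2 (by decide)
  have h14 := hD 0 3 (by decide)
  have h23 := hD 1 2 (by decide)
  have h24 := hD 1 3 (by decide)
  have h34 := hD 2 3 (by decide)
  let c : Fin 2 → K := ![DD α β 1 2 / DD α β 0 1, DD α β 1 3 / DD α β 0 1]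
  let c' : Fin 2 → K := ![- DD α β 0 2 / DD α β 0 1, - DD α β 0 3 / DD α β 0 1]
  let A : Fin 2 → K := ![- DD α β 0 3 / DD α β 2 3, - DD α β 1 3 / DD α β 2 3]
  let B : Fin 2 → K := ![DD α β 0 2 / DD α β 2 3, DD α β 1 2 / DD α β 2 3]
  have hA0 : DD α β 2 3 * A 0 = - DD α β 0 3 := mul_div_cancel₀ _ h34
  have hA1 : DD α β 2 3 * A 1 = - DD α β 1 3 := mul_div_cancel₀ _ h34
  have hB0 : DD α β 2 3 * B 0 = DD α β 0 2 := mul_div_cancel₀ _ h34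
  have hB1 : DD α β 2 3 * B 1 = DD α β 1 2 := mul_div_cancel₀ _ h34
  obtain ⟨hL, u, hu⟩ := LL_diag α β h12 h34 c c' A B (mul_div_cancel₀ _ h12) (mul_div_cancel₀ _ h12) (mul_div_cancel₀ _ h12)
    (mul_div_cancel₀ _ h12) hA0 hA1 hB0 hB1
  have hK : (12 : K) ≠ 0 := by norm_num
  have nA0 : A 0 ≠ 0 := div_ne_zero (neg_ne_zero.2 h14) h34
  have nA1 : A 1 ≠ 0 := div_ne_zero (neg_ne_zero.2 h24) h34
  have nB0 : B 0 ≠ 0 := div_ne_zero h13 h34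
  have nB1 : B 1 ≠ 0 := div_ne_zero h23 h34
  have hE : A 0 * B 1 - A 1 * B 0 ≠ 0 := by
    intro h
    apply mul_ne_zero h12 h34
    have : (DD α β 2 3 * A 0) * (DD α β 2 3 * B 1) - (DD α β 2 3 * A 1) * (DD α β 2 3 * B 0) = 0 := by
      linear_combination (DD α β 2 3) ^ 2 * h
    rw [hA0, hA1, hB0, hB1] at this
    linear_combination this
  have CC : ∀ {u v : K}, u = v → (C u : TT K) = C v := fun h => by rw [h]
  have CA0 := CC hA0
  have CA1 := CC hA1
  have CB0 := CC hB0
  have CB1 := CC hB1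
  simp only [C_mul, C_sub, C_neg] at CA0 CA1 CB0 CB1
  have hc34 : (C (DD α β 2 3) : TT K) ≠ 0 := (C_unit _ h34).ne_zero
  have solN : ∀ t, Sol (Matrix.diagonal α) (Matrix.diagonal β) t ↔ SolN A B t := by
    intro t
    have tr : ∀ α : Fin 4 → K, ((Matrix.diagonal α).map C * t).trace = C (α 0) * t 0 0 + C (α 1) * t 1 1 + C (α 2) * t 2 2 + C (α 3) * t 3 3 := by
      intro α
      rw [Matrix.diagonal_map (map_zero _)]
      simp [Matrix.trace, Matrix.diagonal_mul, Fin.sum_univ_four]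
    have mv : ∀ (α : Fin 4 → K) i, t.mulVec (ly (Matrix.diagonal α)) i = C (α 0) * (X 0 * t i 0) + C (α 1) * (X 1 * t i 1)
        + C (α 2) * (X 2 * t i 2) + C (α 3) * (X 3 * t i 3) := by
      intro α i
      simp only [ly_diag, Matrix.mulVec, dotProduct, Fin.sum_univ_four]; ring
    simp only [C_sub, C_mul] at hc34
    constructor
    · rintro ⟨s, a1, a2, d1, d2⟩
      rw [tr] at d1 d2
      refine ⟨fun i j => congrFun (congrFun s j) i, fun i => ?_, fun i => ?_, ?_, ?_⟩
      · have b1 := congrFun a1 i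
        have b2 := congrFun a2 i
        rw [mv] at b1 b2
        simp only [Pi.zero_apply] at b1 b2
        apply mul_left_cancel₀ hc34
        linear_combination C (β 3) * b1 - C (α 3) * b2 - X 0 * t i 0 * CA0 - X 1 * t i 1 * CA1
      · have b1 := congrFun a1 i
        have b2 := congrFun a2 i
        rw [mv] at b1 b2
        simp only [Pi.zero_apply] at b1 b2
        apply mul_left_cancel₀ hc34
        linear_combination -C (β 2) * b1 + C (α 2) * b2 - X 0 * t i 0 * CB0 - X 1 * t i 1 * CB1
      · apply mul_left_cancel₀ hc34
        linear_combination C (β 3) * d1 - C (α 3) * d2 - t 0 0 * CA0 - t 1 1 * CA1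
      · apply mul_left_cancel₀ hc34
        linear_combination -C (β 2) * d1 + C (α 2) * d2 - t 0 0 * CB0 - t 1 1 * CB1
    · rintro ⟨s, a1, a2, d1, d2⟩
      refine ⟨?_, ?_, ?_, ?_, ?_⟩
      · funext i j; exact s j i
      · funext i
        rw [mv]
        apply mul_left_cancel₀ hc34
        simp only [Pi.zero_apply, mul_zero]
        rw [a1, a2]
        linear_combination C (α 2) * (X 0 * t i 0 * CA0 + X 1 * t i 1 * CA1) + C (α 3) * (X 0 * t i 0 * CB0 + X 1 * t i 1 * CB1)
      · funext i
        rw [mv]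
        apply mul_left_cancel₀ hc34
        simp only [Pi.zero_apply, mul_zero]
        rw [a1, a2]
        linear_combination C (β 2) * (X 0 * t i 0 * CA0 + X 1 * t i 1 * CA1) + C (β 3) * (X 0 * t i 0 * CB0 + X 1 * t i 1 * CB1)
      · rw [tr]
        apply mul_left_cancel₀ hc34
        rw [d1, d2]
        linear_combination C (α 2) * (t 0 0 * CA0 + t 1 1 * CA1) + C (α 3) * (t 0 0 * CB0 + t 1 1 * CB1)
      · rw [tr]
        apply mul_left_cancel₀ hc34
        rw [d1, d2]
        linear_combination C (β 2) * (t 0 0 * CA0 + t 1 1 * CA1) + C (β 3) * (t 0 0 * CB0 + t 1 1 * CB1)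
  have crf : ∀ v, cr (Matrix.diagonal α) (Matrix.diagonal β) v = ![
      -(C (DD α β 1 2) * X 1 * X 2 * v 3 - C (DD α β 1 3) * X 1 * X 3 * v 2 + C (DD α β 2 3) * X 2 * X 3 * v 1),
      (C (DD α β 0 2) * X 0 * X 2 * v 3 - C (DD α β 0 3) * X 0 * X 3 * v 2 + C (DD α β 2 3) * X 2 * X 3 * v 0),
      -(C (DD α β 0 1) * X 0 * X 1 * v 3 - C (DD α β 0 3) * X 0 * X 3 * v 1 + C (DD α β 1 3) * X 1 * X 3 * v 0),
      (C (DD α β 0 1) * X 0 * X 1 * v 2 - C (DD α β 0 2) * X 0 * X 2 * v 1 + C (DD α β 1 2) * X 1 * X 2 * v 0)] := by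
    intro v
    funext i
    rw [cr, det_rows, ly_diag, ly_diag]
    fin_cases i <;> simp <;> ring
  constructor
  · intro a ha
    rw [hL] at ha ⊢
    obtain ⟨t, ht⟩ := soc_A hK c c' A B a ha
    refine ⟨t * ↑u⁻¹, ?_⟩
    convert ht using 2
    rw [← hu, mul_assoc, mul_left_comm (↑u⁻¹ : BB K), Units.inv_mul, mul_one]
  · intro t ht
    rw [hL, ← hu, ← mul_assoc, mul_comm _ (u : BB K), Ideal.unit_mul_mem_iff_mem _ u.isUnit] at ht
    exact soc_A' hK c c' A B t ht
  · intro t h1 h2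
    rw [ly_diag, dotProduct, Fin.sum_univ_four] at h1 h2
    obtain ⟨v, v0, v1, v2, v3⟩ := ker_aux _ _ _ _ _ _ h12 h13 h14 h23 h24 h34 (by ring) t (by
      simp only [C_sub, C_mul]; linear_combination C (β 3) * h1 - C (α 3) * h2) (by
      simp only [C_sub, C_mul]; linear_combination - C (β 2) * h1 + C (α 2) * h2)
    refine ⟨v, ?_⟩
    rw [crf]
    funext i
    fin_cases i
    exacts [v0, v1, v2, v3]
  · intro v hv
    rw [crf] at hv
    have a0 := congrArg (eval ![1, 1, 1, 1]) (congrFun hv 0)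
    have a1 := congrArg (eval ![1, 1, 1, -1]) (congrFun hv 0)
    have a2 := congrArg (eval ![1, 1, -1, -1]) (congrFun hv 0)
    have a3 := congrArg (eval ![1, 1, 1, 1]) (congrFun hv 1)
    have a4 := congrArg (eval ![1, 1, 1, -1]) (congrFun hv 1)
    have a5 := congrArg (eval ![1, 1, -1, -1]) (congrFun hv 1)
    simp [-mul_eq_zero] at a0 a1 a2 a3 a4 a5
    have n2 : (2 : K) ≠ 0 := by norm_num
    have w1 : v 1 = 0 := by
      apply (mul_eq_zero.1 (_ : (2 * DD α β 2 3) * v 1 = 0)).resolve_left (mul_ne_zero n2 h34)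
      linear_combination -a0 - a2
    have w0 : v 0 = 0 := by
      apply (mul_eq_zero.1 (_ : (2 * DD α β 2 3) * v 0 = 0)).resolve_left (mul_ne_zero n2 h34)
      linear_combination a3 + a5
    have w3 : v 3 = 0 := by
      apply (mul_eq_zero.1 (_ : (2 * DD α β 1 2) * v 3 = 0)).resolve_left (mul_ne_zero n2 h23)
      linear_combination -a0 - a1
    have w2 : v 2 = 0 := by
      apply (mul_eq_zero.1 (_ : (2 * DD α β 1 3) * v 2 = 0)).resolve_left (mul_ne_zero n2 h24)
      linear_combination -a1 - a2
    funext i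
    fin_cases i
    exacts [w0, w1, w2, w3]
  · refine ⟨phiD A B, (solN _).2 (phiD_sol A B), ⟨0, 1, phiD_ne A B hE⟩, phiD_hom A B, fun t ht => ?_⟩
    exact phiD_gen (by norm_num) A B nA0 nA1 nB0 nB1 hE t ((solN t).1 ht)

end gen

/-! Part 5 -/

section trans
variable {K : Type} [Field K]

/-- coordinate change -/
def eP (P : Matrix (Fin 4) (Fin 4) K) : BB K →ₐ[K] BB K := aeval (Sum.elim (hx P) (hy P))
/-- coordinate change -/
def eT (P : Matrix (Fin 4) (Fin 4) K) : TT K →ₐ[K] TT K := aeval (ly P)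

lemma C_map_mul {σ : Type} (A B : Matrix (Fin 4) (Fin 4) K) :
    ((A * B).map C : Matrix _ _ (MvPolynomial σ K)) = A.map C * B.map C := Matrix.map_mul

lemma hx_mul (A B : Matrix (Fin 4) (Fin 4) K) : hx (A * B) = (A.map C).mulVec (hx B) := by
  simp only [hx, C_map_mul, Matrix.mulVec_mulVec]
lemma hy_mul (A B : Matrix (Fin 4) (Fin 4) K) : hy (A * B) = (A.map C).mulVec (hy B) := by
  simp only [hy, C_map_mul, Matrix.mulVec_mulVec]
lemma ly_mul (A B : Matrix (Fin 4) (Fin 4) K) : ly (A * B) = (A.map C).mulVec (ly B) := by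
  simp only [ly, C_map_mul, Matrix.mulVec_mulVec]

lemma eP_hx (P M : Matrix (Fin 4) (Fin 4) K) (i : Fin 4) : eP P (hx M i) = hx (M * P) i := by
  rw [hx_mul]
  simp [hx, eP, Matrix.mulVec, dotProduct, map_sum]
lemma eP_hy (P M : Matrix (Fin 4) (Fin 4) K) (i : Fin 4) : eP P (hy M i) = hy (M * P) i := by
  rw [hy_mul]
  simp [hy, eP, Matrix.mulVec, dotProduct, map_sum]
lemma eT_ly (P M : Matrix (Fin 4) (Fin 4) K) (i : Fin 4) : eT P (ly M i) = ly (M * P) i := by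
  rw [ly_mul]
  simp [ly, eT, Matrix.mulVec, dotProduct, map_sum]

lemma hx_one : hx (1 : Matrix (Fin 4) (Fin 4) K) = vx K := by
  simp [hx, Matrix.map_one _ (C_0) (C_1)]
lemma hy_one : hy (1 : Matrix (Fin 4) (Fin 4) K) = vy K := by
  simp [hy, Matrix.map_one _ (C_0) (C_1)]
lemma ly_one : ly (1 : Matrix (Fin 4) (Fin 4) K) = X := by
  simp [ly, Matrix.map_one _ (C_0) (C_1)]

lemma eP_eP (P Q : Matrix (Fin 4) (Fin 4) K) (h : P * Q = 1) (a : BB K) : eP Q (eP P a) = a := by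
  have : (eP Q).comp (eP P) = AlgHom.id K _ := by
    apply algHom_ext
    rintro (i | i)
    · simp only [AlgHom.comp_apply, eP, aeval_X, Sum.elim_inl]
      have := eP_hx Q P i
      rw [h, hx_one] at this
      exact this
    · simp only [AlgHom.comp_apply, eP, aeval_X, Sum.elim_inr]
      have := eP_hy Q P i
      rw [h, hy_one] at this
      exact this
  exact DFunLike.congr_fun this a
lemma eT_eT (P Q : Matrix (Fin 4) (Fin 4) K) (h : P * Q = 1) (a : TT K) : eT Q (eT P a) = a := by
  have : (eT Q).comp (eT P) = AlgHom.id K _ := by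
    apply algHom_ext
    rintro i
    simp only [AlgHom.comp_apply, eT, aeval_X]
    have := eT_ly Q P i
    rw [h, ly_one] at this
    exact this
  exact DFunLike.congr_fun this a

lemma eP_qf (P M : Matrix (Fin 4) (Fin 4) K) : eP P (qf M) = qf (P.transpose * M * P) := by
  have h1 : eP P (qf M) = dotProduct (hx P) (hx (M * P)) := by
    simp only [qf, dotProduct, map_sum, map_mul, eP_hx]
    simp [eP]
  rw [h1, qf, Matrix.mul_assoc, hx_mul P.transpose, Matrix.dotProduct_mulVec]
  congr 1
  rw [Matrix.transpose_map, Matrix.vecMul_transpose]; rfl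

lemma eP_bl (P M : Matrix (Fin 4) (Fin 4) K) : eP P (bl M) = bl (P.transpose * M * P) := by
  have h1 : eP P (bl M) = dotProduct (hy P) (hx (M * P)) := by
    simp only [bl, dotProduct, map_sum, map_mul, eP_hx]
    simp [eP]
  rw [h1, bl, Matrix.mul_assoc, hx_mul P.transpose, Matrix.dotProduct_mulVec]
  congr 1
  rw [Matrix.transpose_map, Matrix.vecMul_transpose]; rfl

lemma eP_LL (P M N : Matrix (Fin 4) (Fin 4) K) (a : BB K) (ha : a ∈ LL M N) :
    eP P a ∈ LL (P.transpose * M * P) (P.transpose * N * P) := by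
  have : LL M N ≤ (LL (P.transpose * M * P) (P.transpose * N * P)).comap (eP P) := by
    rw [LL, Ideal.span_le]
    simp only [Set.insert_subset_iff, Set.singleton_subset_iff, SetLike.mem_coe, Ideal.mem_comap, eP_qf, eP_bl]
    refine ⟨?_, ?_, ?_, ?_⟩ <;> exact Ideal.subset_span (by simp)
  exact this ha

lemma det_rows_mul {A : Type*} [CommRing A] (a b c d : Fin 4 → A) (P : Matrix (Fin 4) (Fin 4) A) :
    (Matrix.of ![P.transpose.mulVec a, P.transpose.mulVec b, P.transpose.mulVec c, P.transpose.mulVec d]).det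
      = (Matrix.of ![a, b, c, d]).det * P.det := by
  rw [← Matrix.det_mul]
  congr 1
  funext i
  fin_cases i <;> simp [Matrix.mulVec_transpose]

lemma map_det_rows {A A' : Type*} [CommRing A] [CommRing A'] {G : Type*} [FunLike G A A'] [RingHomClass G A A'] (f : G) (a b c d : Fin 4 → A) :
    f (Matrix.of ![a, b, c, d]).det = (Matrix.of ![f ∘ a, f ∘ b, f ∘ c, f ∘ d]).det := by
  rw [det_rows, det_rows]
  simp

lemma eP_Det (P M N : Matrix (Fin 4) (Fin 4) K) :
    Det (P.transpose * M * P) (P.transpose * N * P) = C P.det * eP P (Det M N) := by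
  have h := map_det_rows (eP P) (hy M) (hy N) (hx M) (hx N)
  have e1 : ∀ M : Matrix (Fin 4) (Fin 4) K, (eP P) ∘ hx M = hx (M * P) := by
    intro M; funext i; rw [Function.comp_apply, eP_hx]
  have e2 : ∀ M : Matrix (Fin 4) (Fin 4) K, (eP P) ∘ hy M = hy (M * P) := by
    intro M; funext i; rw [Function.comp_apply, eP_hy]
  rw [e1, e1, e2, e2] at h
  change eP P (Det M N) = _ at h
  rw [h, Det]
  simp only [Matrix.mul_assoc P.transpose, hx_mul P.transpose, hy_mul P.transpose, Matrix.transpose_map]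
  rw [det_rows_mul, mul_comm]
  congr 1
  exact (RingHom.map_det C P).symm

lemma eT_cr (P M N : Matrix (Fin 4) (Fin 4) K) (v : Fin 4 → TT K) :
    ((P.map C).mulVec (cr (P.transpose * M * P) (P.transpose * N * P) ((P.transpose.map C).mulVec (eT P ∘ v)))) =
     fun i => C P.det * eT P (cr M N v i) := by
  funext i
  have h := map_det_rows (eT P) (ly M) (ly N) v (Pi.single i 1)
  have e1 : ∀ M : Matrix (Fin 4) (Fin 4) K, (eT P) ∘ ly M = ly (M * P) := by
    intro M; funext i; rw [Function.comp_apply, eT_ly]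
  have e2 : (eT P) ∘ (Pi.single i 1 : Fin 4 → TT K) = Pi.single i 1 := by
    funext j
    by_cases hj : j = i
    · subst hj; simp
    · simp [hj]
  rw [e1, e1, e2] at h
  change eT P (cr M N v i) = _ at h
  have h2 := det_rows_mul (ly (M * P)) (ly (N * P)) (eT P ∘ v) (Pi.single i 1) (P.map C)
  have h3 : (P.map C : Matrix _ _ (TT K)).det = C P.det := (RingHom.map_det C P).symm
  rw [h, ← h3, mul_comm, ← h2, det_rows]
  simp only [cr, det_rows, Matrix.mul_assoc P.transpose, ly_mul P.transpose, Matrix.mulVec, dotProduct, Fin.sum_univ_four, Matrix.transpose_map,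
    Matrix.transpose_apply]
  fin_cases i <;> simp <;> ring

end trans

/-! Part 6 -/

section trans2
variable {K : Type} [Field K]

lemma eT_hom (P : Matrix (Fin 4) (Fin 4) K) (p : TT K) (n : ℕ) (h : p.IsHomogeneous n) : (eT P p).IsHomogeneous n := by
  have := h.aeval (ly P) (n := 1) ?_
  · rw [eT]; simpa only [one_mul, mul_one] using this
  · intro i
    simp only [ly, Matrix.mulVec, dotProduct]
    exact IsHomogeneous.sum _ _ _ fun j _ => by
      simpa using (isHomogeneous_C (Fin 4) (P i j)).mul (isHomogeneous_X K j)

lemma Sol_trans (P Q M N : Matrix (Fin 4) (Fin 4) K) (hPQ : P * Q = 1)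
    (t : Matrix (Fin 4) (Fin 4) (TT K)) (ht : Sol M N t) :
    Sol (P.transpose * M * P) (P.transpose * N * P)
      (Q.map C * t.map (eT P) * (Q.map C).transpose) := by
  have hPQ' : (P.map C * Q.map C : Matrix _ _ (TT K)) = 1 := by
    rw [← C_map_mul, hPQ, Matrix.map_one _ C_0 C_1]
  have hQP' : (Q.map C * P.map C : Matrix _ _ (TT K)) = 1 := mul_eq_one_comm.1 hPQ'
  have hT : (Q.map C).transpose * (P.map C).transpose = (1 : Matrix _ _ (TT K)) := by
    rw [← Matrix.transpose_mul, hPQ', Matrix.transpose_one]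
  have e : ∀ M : Matrix (Fin 4) (Fin 4) K, t.mulVec (ly M) = 0 →
      (Q.map C * t.map (eT P) * (Q.map C).transpose).mulVec (ly (P.transpose * M * P)) = 0 := by
    intro M h
    rw [Matrix.mul_assoc P.transpose, ly_mul P.transpose, Matrix.mulVec_mulVec, Matrix.mul_assoc (Q.map C * _), Matrix.transpose_map, hT,
      Matrix.mul_one, ← Matrix.mulVec_mulVec]
    have : (t.map (eT P)).mulVec (ly (M * P)) = 0 := by
      funext i
      have h1 := congrArg (eT P) (congrFun h i)
      simp only [Matrix.mulVec, dotProduct, map_sum, map_mul, eT_ly, Pi.zero_apply, map_zero] at h1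
      exact h1
    rw [this, Matrix.mulVec_zero]
  have d : ∀ M : Matrix (Fin 4) (Fin 4) K, (M.map C * t).trace = 0 →
      ((P.transpose * M * P).map C * (Q.map C * t.map (eT P) * (Q.map C).transpose)).trace = 0 := by
    intro M h
    rw [C_map_mul, C_map_mul, ← Matrix.mul_assoc, Matrix.trace_mul_comm, ← Matrix.mul_assoc, ← Matrix.mul_assoc, ← Matrix.mul_assoc, ← Matrix.mul_assoc,
      Matrix.transpose_map, hT, Matrix.one_mul, Matrix.mul_assoc (M.map C), hPQ', Matrix.mul_one]
    have h1 := congrArg (eT P) h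
    rw [map_zero] at h1
    rw [← h1]
    simp [Matrix.trace, Matrix.mul_apply, map_sum, eT]
  refine ⟨?_, e M ht.e1, e N ht.e2, d M ht.d1, d N ht.d2⟩
  rw [Matrix.transpose_mul, Matrix.transpose_mul, Matrix.transpose_transpose, Matrix.mul_assoc, ← Matrix.transpose_map, ht.symm]

lemma Good_trans (P Q M N : Matrix (Fin 4) (Fin 4) K) (hPQ : P * Q = 1)
    (h : Good (P.transpose * M * P) (P.transpose * N * P)) : Good M N := by
  have hQP : Q * P = 1 := mul_eq_one_comm.1 hPQ
  have hT : Q.transpose * P.transpose = 1 := by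
    rw [← Matrix.transpose_mul, hPQ, Matrix.transpose_one]
  have hT' : P.transpose * Q.transpose = 1 := mul_eq_one_comm.1 hT
  have back : ∀ M : Matrix (Fin 4) (Fin 4) K, Q.transpose * (P.transpose * M * P) * Q = M := by
    intro M
    rw [← Matrix.mul_assoc, ← Matrix.mul_assoc, hT, Matrix.one_mul, Matrix.mul_assoc, hPQ, Matrix.mul_one]
  have backL : ∀ a, a ∈ LL (P.transpose * M * P) (P.transpose * N * P) → eP Q a ∈ LL M N := by
    intro a ha
    have := eP_LL Q _ _ a ha
    rwa [back, back] at this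
  have hdP : P.det ≠ 0 := by
    intro h0
    have := congrArg Matrix.det hPQ
    rw [Matrix.det_mul, h0] at this
    simp at this
  have hPQ' : (P.map C * Q.map C : Matrix _ _ (TT K)) = 1 := by
    rw [← C_map_mul, hPQ, Matrix.map_one _ C_0 C_1]
  have hQP' : (Q.map C * P.map C : Matrix _ _ (TT K)) = 1 := mul_eq_one_comm.1 hPQ'
  have hTT : (Q.map C).transpose * (P.map C).transpose = (1 : Matrix _ _ (TT K)) := by
    rw [← Matrix.transpose_mul, hPQ', Matrix.transpose_one]
  have hTT' : (P.map C).transpose * (Q.map C).transpose = (1 : Matrix _ _ (TT K)) := mul_eq_one_comm.1 hTT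
  have eD := eP_Det P M N
  constructor
  · intro a ha
    obtain ⟨t, ht⟩ := h.soc (eP P a) (fun i => by
      have e : X (Sum.inl i) * eP P a = eP P (eP Q (X (Sum.inl i)) * a) := by
        rw [map_mul, eP_eP Q P hQP]
      rw [e]
      apply eP_LL
      simp only [eP, aeval_X, Sum.elim_inl, hx, Matrix.mulVec, dotProduct, Finset.sum_mul, mul_assoc]
      exact Ideal.sum_mem _ fun j _ => Ideal.mul_mem_left _ _ (ha j))
    refine ⟨eP Q (t * C P.det), ?_⟩
    have := backL _ ht
    rw [eD, map_sub, eP_eP P Q hPQ, ← mul_assoc, map_mul, eP_eP P Q hPQ] at this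
    exact this
  · intro t ht
    have h1 := eP_LL P _ _ _ ht
    have h2 := h.soc' (eP P t) (by
      rw [eD, mul_left_comm, ← map_mul]
      exact Ideal.mul_mem_left _ _ h1)
    have h3 : Ideal.span (Set.range (vx K)) ≤ (Ideal.span (Set.range (vx K))).comap (eP Q) := by
      rw [Ideal.span_le]
      rintro _ ⟨i, rfl⟩
      simp only [SetLike.mem_coe, Ideal.mem_comap, eP, aeval_X, Sum.elim_inl, hx, Matrix.mulVec, dotProduct]
      exact Ideal.sum_mem _ fun j _ => Ideal.mul_mem_left _ _ (Ideal.subset_span ⟨j, rfl⟩)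
    have := h3 h2
    rwa [Ideal.mem_comap, eP_eP P Q hPQ] at this
  · intro t h1 h2
    have aux : ∀ M : Matrix (Fin 4) (Fin 4) K, dotProduct t (ly M) = 0 →
        dotProduct ((Q.map C).mulVec (eT P ∘ t)) (ly (P.transpose * M * P)) = 0 := by
      intro M h
      rw [Matrix.mul_assoc, ly_mul P.transpose, Matrix.dotProduct_mulVec, Matrix.transpose_map, Matrix.vecMul_transpose,
        Matrix.mulVec_mulVec, hPQ', Matrix.one_mulVec]
      have := congrArg (eT P) h
      simp only [dotProduct, map_sum, map_mul, map_zero, eT_ly] at this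
      exact this
    obtain ⟨v, hv⟩ := h.ker _ (aux M h1) (aux N h2)
    obtain ⟨w, hw⟩ : ∃ w : Fin 4 → TT K, v = (P.transpose.map C).mulVec (eT P ∘ w) := by
      refine ⟨eT Q ∘ ((Q.map C).transpose.mulVec v), ?_⟩
      have : eT P ∘ eT Q ∘ ((Q.map C).transpose.mulVec v) = (Q.map C).transpose.mulVec v := by
        funext i; simp only [Function.comp_apply]; rw [eT_eT Q P hQP]
      rw [this, Matrix.mulVec_mulVec, Matrix.transpose_map, hTT', Matrix.one_mulVec]
    have key := eT_cr P M N w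
    rw [← hw, ← hv, Matrix.mulVec_mulVec, hPQ', Matrix.one_mulVec] at key
    refine ⟨fun i => C P.det * w i, ?_⟩
    funext i
    have := congrArg (eT Q) (congrFun key i)
    rw [Function.comp_apply, eT_eT P Q hPQ, map_mul, eT_eT P Q hPQ] at this
    rw [this]
    simp only [cr, det_rows]
    simp [eT]
    ring
  · intro v hv
    have hC : (eT P ∘ fun i => C (v i)) = (fun i => C (v i)) := by funext i; simp [eT]
    have key := eT_cr P M N (fun i => C (v i))
    rw [hv, hC] at key
    have e1 : (P.transpose.map C).mulVec (fun i => (C (v i) : TT K)) = fun i => C (P.transpose.mulVec v i) := by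
      funext i; simp [Matrix.mulVec, dotProduct, map_sum]
    rw [e1] at key
    have k2 : (fun i : Fin 4 => (C P.det * eT P ((0 : Fin 4 → TT K) i) : TT K)) = 0 := by funext i; simp
    rw [k2] at key
    have k3 := congrArg ((Q.map C).mulVec) key
    rw [Matrix.mulVec_mulVec, hQP', Matrix.one_mulVec, Matrix.mulVec_zero] at k3
    have k4 := h.kerc _ k3
    have k5 := congrArg (Q.transpose.mulVec) k4
    rwa [Matrix.mulVec_mulVec, hT, Matrix.one_mulVec, Matrix.mulVec_zero] at k5
  · obtain ⟨φ, s, ⟨i0, j0, hne⟩, hh, gen⟩ := h.sol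
    have s1 := Sol_trans Q P _ _ hQP _ s
    rw [back, back] at s1
    refine ⟨_, s1, ?_, ?_, ?_⟩
    · by_contra! hcon
      have z : P.map C * φ.map (eT Q) * (P.map C).transpose = 0 := by funext i j; exact hcon i j
      have z2 : φ.map (eT Q) = 0 := by
        have := congrArg (fun m => Q.map C * m * (Q.map C).transpose) z
        simp only [← Matrix.mul_assoc, hQP', Matrix.one_mul, Matrix.mul_zero, Matrix.zero_mul] at this
        rwa [Matrix.mul_assoc, hTT', Matrix.mul_one] at this
      have := congrArg (eT P) (congrFun (congrFun z2 i0) j0)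
      rw [Matrix.map_apply, eT_eT Q P hQP] at this
      exact hne (by rw [this]; simp)
    · intro i j
      simp only [Matrix.mul_apply, Matrix.map_apply, Matrix.transpose_apply]
      refine IsHomogeneous.sum _ _ _ fun a _ => ?_
      have : IsHomogeneous (∑ x, C (P i x) * (eT Q) (φ x a)) 6 :=
        IsHomogeneous.sum _ _ _ fun b _ => by
          simpa using (isHomogeneous_C (Fin 4) (P i b)).mul (eT_hom Q _ _ (hh b a))
      simpa using this.mul (isHomogeneous_C (Fin 4) (P j a))
    · intro t ht
      obtain ⟨c, hc⟩ := gen _ (Sol_trans P Q M N hPQ t ht)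
      have hc' : Q.map C * t.map (eT P) * (Q.map C).transpose = c • φ := by funext i j; exact hc i j
      have h2 : t.map (eT P) = c • (P.map C * φ * (P.map C).transpose) := by
        have := congrArg (fun m => P.map C * m * (P.map C).transpose) hc'
        simp only [← Matrix.mul_assoc, hPQ', Matrix.one_mul] at this
        rw [Matrix.mul_assoc, hTT, Matrix.mul_one] at this
        rw [this]; simp
      refine ⟨eT Q c, fun i j => ?_⟩
      have h3 := congrArg (eT Q) (congrFun (congrFun h2 i) j)
      rw [Matrix.map_apply, eT_eT P Q hPQ] at h3
      rw [h3, Matrix.smul_apply, smul_eq_mul, map_mul]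
      congr 1
      simp [Matrix.mul_apply, map_sum, eT]

end trans2

/-! Part 7 -/

section desc
variable {F K : Type} [Field F] [Field K] [Algebra F K]

/-- coefficientwise retraction -/
def ret {σ : Type} (π : K →ₗ[F] F) (p : MvPolynomial σ K) : MvPolynomial σ F :=
  ∑ m ∈ p.support, monomial m (π (coeff m p))

lemma coeff_ret {σ : Type} (π : K →ₗ[F] F) (p : MvPolynomial σ K) (m : σ →₀ ℕ) :
    coeff m (ret π p) = π (coeff m p) := by
  classical
  simp only [ret, coeff_sum, coeff_monomial]
  rw [Finset.sum_ite_eq' p.support m]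
  split_ifs with h
  · rfl
  · rw [notMem_support_iff.1 h, map_zero]

lemma ret_add {σ : Type} (π : K →ₗ[F] F) (p q : MvPolynomial σ K) : ret π (p + q) = ret π p + ret π q := by
  ext m; simp [coeff_ret]

lemma ret_zero {σ : Type} (π : K →ₗ[F] F) : ret π (0 : MvPolynomial σ K) = 0 := by
  ext m; simp [coeff_ret]

lemma ret_sum {σ ι : Type} (π : K →ₗ[F] F) (s : Finset ι) (p : ι → MvPolynomial σ K) :
    ret π (∑ i ∈ s, p i) = ∑ i ∈ s, ret π (p i) := by
  ext m; simp [coeff_ret, coeff_sum]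

lemma ret_mul {σ : Type} (π : K →ₗ[F] F) (b : MvPolynomial σ F) (c : MvPolynomial σ K) :
    ret π (map (algebraMap F K) b * c) = b * ret π c := by
  classical
  ext m
  simp only [coeff_ret, coeff_mul, map_sum, coeff_map]
  refine Finset.sum_congr rfl fun x _ => ?_
  rw [← Algebra.smul_def, map_smul, smul_eq_mul]

lemma ret_mul' {σ : Type} (π : K →ₗ[F] F) (b : MvPolynomial σ F) (c : MvPolynomial σ K) :
    ret π (c * map (algebraMap F K) b) = ret π c * b := by
  rw [mul_comm, ret_mul, mul_comm]

lemma ret_map {σ : Type} (π : K →ₗ[F] F) (hπ : π 1 = 1) (b : MvPolynomial σ F) :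
    ret π (map (algebraMap F K) b) = b := by
  ext m
  rw [coeff_ret, coeff_map, Algebra.algebraMap_eq_smul_one, map_smul, hπ, smul_eq_mul, mul_one]

lemma exists_pi (c : K) (hc : c ≠ 0) : ∃ π : K →ₗ[F] F, π c ≠ 0 := by
  by_contra! h
  exact hc ((Module.forall_dual_apply_eq_zero_iff F c).1 h)

lemma exists_pi1 : ∃ π : K →ₗ[F] F, π 1 = 1 := by
  obtain ⟨π, h⟩ := exists_pi (F := F) (1 : K) one_ne_zero
  exact ⟨(π 1)⁻¹ • π, by simp [h]⟩

variable (M N : Matrix (Fin 4) (Fin 4) F)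

/-- base change of a matrix -/
abbrev bc (K : Type) [Field K] [Algebra F K] (M : Matrix (Fin 4) (Fin 4) F) : Matrix (Fin 4) (Fin 4) K := M.map (algebraMap F K)

lemma map_hx (i) : map (algebraMap F K) (hx M i) = hx (bc K M) i := by
  simp [hx, Matrix.mulVec, dotProduct, map_sum]
lemma map_hy (i) : map (algebraMap F K) (hy M i) = hy (bc K M) i := by
  simp [hy, Matrix.mulVec, dotProduct, map_sum]
lemma map_ly (i) : map (algebraMap F K) (ly M i) = ly (bc K M) i := by
  simp [ly, Matrix.mulVec, dotProduct, map_sum]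
lemma map_qf : map (algebraMap F K) (qf M) = qf (bc K M) := by
  simp only [qf, dotProduct, map_sum, map_mul, map_hx, map_X]
lemma map_bl : map (algebraMap F K) (bl M) = bl (bc K M) := by
  simp only [bl, dotProduct, map_sum, map_mul, map_hx, map_X]
lemma map_Det : map (algebraMap F K) (Det M N) = Det (bc K M) (bc K N) := by
  simp only [Det, map_det_rows]
  congr 3
  · funext i; exact map_hy M i
  congr 1
  · funext i; exact map_hy N i
  congr 1
  · funext i; exact map_hx M i
  congr 1
  · funext i; exact map_hx N i
lemma map_cr (v : Fin 4 → TT F) (i) : map (algebraMap F K) (cr M N v i) = cr (bc K M) (bc K N) (fun j => map (algebraMap F K) (v j)) i := by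
  simp only [cr, det_rows, map_sub, map_add, map_mul, map_ly]
  fin_cases i <;> simp
lemma cr_lin (v : Fin 4 → TT F) (i) : cr M N v i = ∑ j, cr M N (Pi.single j 1) i * v j := by
  simp only [cr, det_rows, Fin.sum_univ_four]
  fin_cases i <;> simp <;> ring

lemma map_LL (a : BB F) (ha : a ∈ LL M N) : map (algebraMap F K) a ∈ LL (bc K M) (bc K N) := by
  rw [LL, mem_span4] at ha ⊢
  obtain ⟨r1, r2, r3, r4, rfl⟩ := ha
  exact ⟨_, _, _, _, by simp only [map_add, map_mul, map_qf, map_bl]; rfl⟩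

lemma Good_desc (h : Good (bc K M) (bc K N)) : Good M N := by
  obtain ⟨π, hπ⟩ := exists_pi1 (F := F) (K := K)
  constructor
  · intro a ha
    obtain ⟨t, ht⟩ := h.soc (map (algebraMap F K) a) (fun i => by
      have := map_LL (K := K) _ _ _ (ha i)
      simpa using this)
    refine ⟨ret π t, ?_⟩
    rw [LL, mem_span4] at ht ⊢
    obtain ⟨r1, r2, r3, r4, hr⟩ := ht
    have e : map (algebraMap F K) a = t * map (algebraMap F K) (Det M N) + r1 * map (algebraMap F K) (qf M) + r2 * map (algebraMap F K) (qf N)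
      + r3 * map (algebraMap F K) (bl M) + r4 * map (algebraMap F K) (bl N) := by
      rw [map_Det, map_qf, map_qf, map_bl, map_bl]
      linear_combination hr
    have e2 := congrArg (ret π) e
    simp only [ret_add, ret_mul', ret_map π hπ] at e2
    exact ⟨ret π r1, ret π r2, ret π r3, ret π r4, by linear_combination e2⟩
  · intro t ht
    have h1 := h.soc' (map (algebraMap F K) t) (by
      have := map_LL (K := K) _ _ _ ht
      rwa [map_mul, map_Det] at this)
    rw [Ideal.mem_span_range_iff_exists_fun] at h1 ⊢
    obtain ⟨c, hc⟩ := h1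
    refine ⟨fun i => ret π (c i), ?_⟩
    have := congrArg (ret π) hc
    rw [ret_map π hπ, ret_sum] at this
    rw [← this]
    refine Finset.sum_congr rfl fun i _ => ?_
    rw [← ret_mul', map_X]
  · intro t h1 h2
    have aux : ∀ M : Matrix (Fin 4) (Fin 4) F, dotProduct t (ly M) = 0 →
        dotProduct (fun i => map (algebraMap F K) (t i)) (ly (bc K M)) = 0 := by
      intro M h
      have := congrArg (map (algebraMap F K)) h
      simpa only [dotProduct, map_sum, map_mul, map_ly, map_zero] using this
    obtain ⟨v, hv⟩ := h.ker _ (aux M h1) (aux N h2)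
    refine ⟨fun i => ret π (v i), ?_⟩
    funext i
    have := congrFun hv i
    rw [cr_lin] at this
    rw [cr_lin, ← ret_map π hπ (t i), this, ret_sum]
    refine Finset.sum_congr rfl fun j _ => ?_
    rw [← ret_mul, map_cr]
    congr 4
    funext l
    by_cases hl : l = j
    · subst hl; simp
    · simp [hl]
  · intro v hv
    have := h.kerc (fun i => algebraMap F K (v i)) (by
      funext i
      have := congrArg (map (algebraMap F K)) (congrFun hv i)
      rw [map_cr] at this
      simpa using this)
    funext i
    simpa using congrFun this i
  · obtain ⟨φ, s, ⟨i0, j0, hne⟩, hh, gen⟩ := h.sol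
    obtain ⟨m, hm⟩ := ne_zero_iff.1 hne
    obtain ⟨ρ, hρ⟩ := exists_pi (F := F) _ hm
    have hφm : ∀ M : Matrix (Fin 4) (Fin 4) F, φ.mulVec (ly (bc K M)) = 0 → (φ.map (ret ρ)).mulVec (ly M) = 0 := by
      intro M h
      funext i
      have := congrArg (ret ρ) (congrFun h i)
      simp only [Matrix.mulVec, dotProduct, ret_sum, ← map_ly, ret_mul', Pi.zero_apply, ret_zero] at this
      exact this
    have hφd : ∀ M : Matrix (Fin 4) (Fin 4) F, ((bc K M).map C * φ).trace = 0 → (M.map C * φ.map (ret ρ)).trace = 0 := by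
      intro M h
      have := congrArg (ret ρ) h
      have e : ∀ i j, (C (algebraMap F K (M i j)) : TT K) = map (algebraMap F K) (C (M i j)) := fun i j => by simp
      simp only [Matrix.trace, Matrix.diag, Matrix.mul_apply, Matrix.map_apply, ret_sum, e, ret_mul, ret_zero] at this
      exact this
    have hS : Sol M N (φ.map (ret ρ)) := by
      refine ⟨?_, hφm M s.e1, hφm N s.e2, hφd M s.d1, hφd N s.d2⟩
      rw [← Matrix.transpose_map, s.symm]
    have mapSol : ∀ t, Sol M N t → Sol (bc K M) (bc K N) (t.map (map (algebraMap F K))) := by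
      intro t ht
      have a1 : ∀ M : Matrix (Fin 4) (Fin 4) F, t.mulVec (ly M) = 0 → (t.map (map (algebraMap F K))).mulVec (ly (bc K M)) = 0 := by
        intro M h
        funext i
        have := congrArg (map (algebraMap F K)) (congrFun h i)
        simpa only [Matrix.mulVec, dotProduct, Matrix.map_apply, map_sum, map_mul, map_ly, Pi.zero_apply, map_zero] using this
      have a2 : ∀ M : Matrix (Fin 4) (Fin 4) F, (M.map C * t).trace = 0 → ((bc K M).map C * t.map (map (algebraMap F K))).trace = 0 := by
        intro M h
        have := congrArg (map (algebraMap F K)) h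
        simpa only [Matrix.trace, Matrix.diag, Matrix.mul_apply, Matrix.map_apply, map_sum, map_mul, map_C, map_zero] using this
      refine ⟨?_, a1 M ht.e1, a1 N ht.e2, a2 M ht.d1, a2 N ht.d2⟩
      rw [← Matrix.transpose_map, ht.symm]
    have hne' : ret ρ (φ i0 j0) ≠ 0 := by
      intro h0
      apply hρ
      rw [← coeff_ret, h0, coeff_zero]
    have hhom : ∀ i j, (ret ρ (φ i j)).IsHomogeneous 6 := by
      intro i j d hd
      apply hh i j
      intro h0
      apply hd
      rw [coeff_ret, h0, map_zero]
    refine ⟨φ.map (ret ρ), hS, ⟨i0, j0, hne'⟩, hhom, ?_⟩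
    obtain ⟨c, hc⟩ := gen _ (mapSol _ hS)
    have hc0 := hc i0 j0
    simp only [Matrix.map_apply] at hc0
    have hmne : map (algebraMap F K) (ret ρ (φ i0 j0)) ≠ 0 := by
      rw [Ne, map_eq_zero_iff _ (map_injective _ (algebraMap F K).injective)]
      exact hne'
    have hcne : c ≠ 0 := by
      rintro rfl
      rw [zero_mul] at hc0
      exact hmne hc0
    have hcdeg : c.totalDegree = 0 := by
      have d1 := ((hhom i0 j0).map (algebraMap F K)).totalDegree hmne
      have d2 := (hh i0 j0).totalDegree hne
      rw [hc0, totalDegree_mul_of_isDomain hcne hne, d2] at d1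
      omega
    rw [totalDegree_eq_zero_iff_eq_C] at hcdeg
    have hu : coeff 0 c ≠ 0 := by
      intro h0
      rw [h0, C_0] at hcdeg
      exact hcne hcdeg
    intro t ht
    obtain ⟨b, hb⟩ := gen _ (mapSol t ht)
    refine ⟨ret π (b * C (coeff 0 c)⁻¹), fun i j => ?_⟩
    have h1 := hb i j
    have h2 := hc i j
    simp only [Matrix.map_apply] at h1 h2 ⊢
    have : map (algebraMap F K) (t i j) = (b * C (coeff 0 c)⁻¹) * map (algebraMap F K) (ret ρ (φ i j)) := by
      rw [h1, h2]
      nth_rewrite 2 [hcdeg]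
      have : (C (coeff 0 c)⁻¹ * C (coeff 0 c) : TT K) = 1 := by
        rw [← C_mul, inv_mul_cancel₀ hu, C_1]
      linear_combination - b * φ i j * this
    rw [← ret_mul', ← this, ret_map π hπ]

end desc

/-! Part 8 -/

section dgl
variable {K : Type} [Field K]

/-- nondegeneracy of a pencil -/
def NPair {V : Type} [AddCommGroup V] [Module K V] (b c : V →ₗ[K] V →ₗ[K] K) : Prop :=
  ∀ v, v ≠ 0 → b v v = 0 → c v v = 0 → ∀ s t : K, s • b v + t • c v = 0 → s = 0 ∧ t = 0

lemma exists_sing [IsAlgClosed K] {V : Type} [AddCommGroup V] [Module K V] [FiniteDimensional K V] [Nontrivial V]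
    (b c : V →ₗ[K] V →ₗ[K] K) : ∃ v, v ≠ 0 ∧ ∃ s t : K, (s ≠ 0 ∨ t ≠ 0) ∧ s • b v + t • c v = 0 := by
  by_cases hc : Function.Injective c
  · let e : V ≃ₗ[K] (V →ₗ[K] K) := LinearEquiv.ofInjectiveOfFinrankEq c hc (by
      exact (Subspace.dual_finrank_eq (K := K) (V := V)).symm)
    obtain ⟨μ, hμ⟩ := Module.End.exists_eigenvalue (K := K) (e.symm.toLinearMap ∘ₗ b : Module.End K V)
    obtain ⟨v, hv⟩ := hμ.exists_hasEigenvector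
    refine ⟨v, hv.2, 1, -μ, Or.inl one_ne_zero, ?_⟩
    have h1 := hv.apply_eq_smul
    have h2 : b v = μ • c v := by
      have h3 := congrArg e h1
      rw [map_smul, LinearMap.comp_apply, LinearEquiv.coe_coe, LinearEquiv.apply_symm_apply] at h3
      exact h3
    rw [h2]; module
  · rw [← LinearMap.ker_eq_bot, Submodule.eq_bot_iff] at hc
    push Not at hc
    obtain ⟨v, hv, hv0⟩ := hc
    refine ⟨v, hv0, 0, 1, Or.inr one_ne_zero, ?_⟩
    rw [LinearMap.mem_ker.1 hv]; simp

lemma exists_orth [IsAlgClosed K] (n : ℕ) : ∀ {V : Type} [AddCommGroup V] [Module K V] [FiniteDimensional K V]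
    (b c : V →ₗ[K] V →ₗ[K] K) (hb : ∀ u v, b u v = b v u) (hc : ∀ u v, c u v = c v u) (hN : NPair b c),
    Module.finrank K V = n → ∃ e : Module.Basis (Fin n) K V, ∀ i j, i ≠ j → b (e i) (e j) = 0 ∧ c (e i) (e j) = 0 := by
  induction n with
  | zero =>
    intro V _ _ _ b c hb hc hN hn
    exact ⟨Module.finBasisOfFinrankEq K V hn, fun i => i.elim0⟩
  | succ n ih =>
    intro V _ _ _ b c hb hc hN hn
    haveI : Nontrivial V := Module.nontrivial_of_finrank_pos (R := K) (by omega)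
    obtain ⟨v, hv, s, t, hst, h0⟩ := exists_sing b c
    obtain ⟨ℓ, hℓv, p, q, hp, hq⟩ : ∃ ℓ : V →ₗ[K] K, ℓ v ≠ 0 ∧ ∃ p q : K, b v = p • ℓ ∧ c v = q • ℓ := by
      by_cases h1 : b v v = 0
      · have h2 : c v v ≠ 0 := by
          intro h2
          have := hN v hv h1 h2 s t h0
          tauto
        have hs : s ≠ 0 := by
          rintro rfl
          have ht : t ≠ 0 := by tauto
          have := DFunLike.congr_fun h0 v
          simp [ht, h2] at this
        refine ⟨c v, h2, -(s⁻¹ * t), 1, ?_, by simp⟩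
        have : s⁻¹ • (s • b v + t • c v) = 0 := by rw [h0, smul_zero]
        rw [smul_add, smul_smul, inv_mul_cancel₀ hs, one_smul, smul_smul] at this
        rw [eq_neg_of_add_eq_zero_left this]; module
      · have ht : t ≠ 0 := by
          rintro rfl
          have ht : s ≠ 0 := by tauto
          have := DFunLike.congr_fun h0 v
          simp [ht, h1] at this
        refine ⟨b v, h1, 1, -(t⁻¹ * s), by simp, ?_⟩
        have : t⁻¹ • (s • b v + t • c v) = 0 := by rw [h0, smul_zero]
        rw [smul_add, smul_smul t⁻¹ t, inv_mul_cancel₀ ht, one_smul, smul_smul] at this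
        rw [eq_neg_of_add_eq_zero_right this]; module
    let W : Submodule K V := LinearMap.ker ℓ
    have hbW : ∀ w : W, b v w = 0 := fun w => by
      rw [hp, LinearMap.smul_apply, LinearMap.mem_ker.1 w.2, smul_zero]
    have hcW : ∀ w : W, c v w = 0 := fun w => by
      rw [hq, LinearMap.smul_apply, LinearMap.mem_ker.1 w.2, smul_zero]
    have dec : ∀ u : V, ∃ (r : K) (w : W), u = r • v + w := by
      intro u
      refine ⟨ℓ u / ℓ v, ⟨u - (ℓ u / ℓ v) • v, ?_⟩, by simp⟩
      simp only [W, LinearMap.mem_ker, map_sub, map_smul, smul_eq_mul]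
      field_simp; ring
    have hWn : Module.finrank K W = n := by
      have h1 := LinearMap.finrank_range_add_finrank_ker ℓ
      have h2 : LinearMap.range ℓ = ⊤ := LinearMap.range_eq_top.2 (LinearMap.surjective (fun h => hℓv (by rw [h]; rfl)))
      rw [h2, finrank_top, Module.finrank_self, hn] at h1
      have : Module.finrank K W = Module.finrank K (LinearMap.ker ℓ) := rfl
      omega
    have hNW : NPair (b.domRestrict₁₂ W W) (c.domRestrict₁₂ W W) := by
      intro w hw h1 h2 s t h
      refine hN w (by simpa using hw) h1 h2 s t ?_
      ext u
      obtain ⟨r, x, rfl⟩ := dec u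
      have := DFunLike.congr_fun h x
      simp only [LinearMap.add_apply, LinearMap.smul_apply, LinearMap.domRestrict₁₂_apply, LinearMap.zero_apply, smul_eq_mul] at this
      simp only [LinearMap.add_apply, LinearMap.smul_apply, map_add, map_smul, LinearMap.zero_apply, hb w v, hc w v, hbW, hcW, smul_eq_mul]
      linear_combination this
    obtain ⟨e, he⟩ := ih (b.domRestrict₁₂ W W) (c.domRestrict₁₂ W W) (fun u v => hb _ _) (fun u v => hc _ _) hNW hWn
    have hli : ∀ (a : K), ∀ x ∈ W, a • v + x = 0 → a = 0 := by
      intro a x hx h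
      have := congrArg ℓ h
      rw [map_add, LinearMap.mem_ker.1 hx] at this
      simpa [hℓv] using this
    have hsp : ∀ z : V, ∃ a : K, z + a • v ∈ W := by
      intro z
      obtain ⟨r, w, rfl⟩ := dec z
      refine ⟨-r, ?_⟩
      have : r • v + (w : V) + (-r) • v = w := by module
      rw [this]; exact w.2
    refine ⟨Module.Basis.mkFinCons v e hli hsp, ?_⟩
    intro i j
    rw [Module.Basis.coe_mkFinCons]
    refine Fin.cases ?_ (fun i => ?_) i <;> refine Fin.cases ?_ (fun j => ?_) j
    · simp
    · intro _
      simp only [Fin.cons_zero, Fin.cons_succ, Function.comp_apply]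
      exact ⟨hbW _, hcW _⟩
    · intro _
      simp only [Fin.cons_zero, Fin.cons_succ, Function.comp_apply]
      rw [hb, hc]
      exact ⟨hbW _, hcW _⟩
    · intro hij
      simp only [Fin.cons_succ, Function.comp_apply]
      exact he i j (by simpa using hij)

lemma exists_diag [IsAlgClosed K] (M N : Matrix (Fin 4) (Fin 4) K) (hM : M.transpose = M) (hN : N.transpose = N)
    (h : ∀ v : Fin 4 → K, v ≠ 0 → dotProduct v (M.mulVec v) = 0 → dotProduct v (N.mulVec v) = 0 →
      ∀ s t : K, s • M.mulVec v + t • N.mulVec v = 0 → s = 0 ∧ t = 0) :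
    ∃ (P Q : Matrix (Fin 4) (Fin 4) K) (α β : Fin 4 → K), P * Q = 1 ∧ P.transpose * M * P = Matrix.diagonal α ∧
      P.transpose * N * P = Matrix.diagonal β ∧ ∀ i j, i ≠ j → DD α β i j ≠ 0 := by
  let b : Matrix (Fin 4) (Fin 4) K → ((Fin 4 → K) →ₗ[K] (Fin 4 → K) →ₗ[K] K) := fun M => Matrix.toLinearMap₂' K M
  have hbv : ∀ M u v, b M u v = dotProduct u (M.mulVec v) := fun M u v => by
    simp only [b, Matrix.toLinearMap₂'_apply']
  have sy : ∀ M : Matrix (Fin 4) (Fin 4) K, M.transpose = M → ∀ u v, b M u v = b M v u := by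
    intro M hM u v
    rw [hbv, hbv, Matrix.dotProduct_mulVec, ← Matrix.mulVec_transpose, hM, dotProduct_comm]
  have hNP : NPair (b M) (b N) := by
    intro v hv h1 h2 s t h0
    rw [hbv] at h1 h2
    refine h v hv h1 h2 s t ?_
    funext i
    have := DFunLike.congr_fun h0 (Pi.single i 1)
    simp only [LinearMap.add_apply, LinearMap.smul_apply, sy M hM v, sy N hN v, hbv, LinearMap.zero_apply, single_dotProduct, one_mul] at this
    exact this
  obtain ⟨e, he⟩ := exists_orth 4 (b M) (b N) (sy M hM) (sy N hN) hNP (by simp)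
  let P : Matrix (Fin 4) (Fin 4) K := (Pi.basisFun K (Fin 4)).toMatrix e
  have hP : ∀ i j, P i j = e j i := fun i j => by simp [P, Module.Basis.toMatrix_apply]
  have hPM : ∀ M i j, (P.transpose * M * P) i j = b M (e i) (e j) := by
    intro M i j
    rw [hbv, Matrix.mul_assoc]
    simp only [Matrix.mul_apply, dotProduct, Matrix.mulVec, Matrix.transpose_apply, hP]
  refine ⟨P, e.toMatrix (Pi.basisFun K (Fin 4)), fun i => b M (e i) (e i), fun i => b N (e i) (e i), ?_, ?_, ?_, ?_⟩
  · exact Module.Basis.toMatrix_mul_toMatrix_flip _ _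
  · funext i j
    rw [hPM, Matrix.diagonal_apply]
    split_ifs with h
    · rw [h]
    · exact (he i j h).1
  · funext i j
    rw [hPM, Matrix.diagonal_apply]
    split_ifs with h
    · rw [h]
    · exact (he i j h).2
  · intro i j hij h0
    simp only [DD] at h0
    have d1 : (!![b M (e i) (e i), b M (e j) (e j); b N (e i) (e i), b N (e j) (e j)]).det = 0 := by
      rw [Matrix.det_fin_two_of]; exact h0
    obtain ⟨x, hx, hx0⟩ := Matrix.exists_mulVec_eq_zero_iff.2 d1
    obtain ⟨y, hy, hy0⟩ := Matrix.exists_vecMul_eq_zero_iff.2 d1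
    obtain ⟨a0, ha0⟩ := IsAlgClosed.exists_pow_nat_eq (x 0) (n := 2) (by norm_num)
    obtain ⟨a1, ha1⟩ := IsAlgClosed.exists_pow_nat_eq (x 1) (n := 2) (by norm_num)
    have x1 := congrFun hx0 0
    have x2 := congrFun hx0 1
    have y1 := congrFun hy0 0
    have y2 := congrFun hy0 1
    simp [Matrix.mulVec, Matrix.vecMul, dotProduct, Fin.sum_univ_two] at x1 x2 y1 y2
    rw [← ha0, ← ha1] at x1 x2
    have hv : a0 • e i + a1 • e j ≠ 0 := by
      intro hv
      have hi := congrArg (fun z => e.repr z i) hv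
      have hj := congrArg (fun z => e.repr z j) hv
      simp [Finsupp.single_apply, hij, hij.symm] at hi hj
      apply hx
      funext l
      fin_cases l
      · simp [← ha0, hi]
      · simp [← ha1, hj]
    have q : ∀ c : (Fin 4 → K) →ₗ[K] (Fin 4 → K) →ₗ[K] K, c (e i) (e j) = 0 → c (e j) (e i) = 0 →
        c (a0 • e i + a1 • e j) (a0 • e i + a1 • e j) = c (e i) (e i) * a0 ^ 2 + c (e j) (e j) * a1 ^ 2 := by
      intro c h1 h2
      simp only [map_add, map_smul, LinearMap.add_apply, LinearMap.smul_apply, smul_eq_mul, h1, h2]; ring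
    have := hNP (a0 • e i + a1 • e j) hv (by rw [q _ (he i j hij).1 (he j i hij.symm).1]; exact x1)
      (by rw [q _ (he i j hij).2 (he j i hij.symm).2]; exact x2) (y 0) (y 1) (by
        apply e.ext
        intro l
        simp only [map_add, map_smul, LinearMap.add_apply, LinearMap.smul_apply, smul_eq_mul, LinearMap.zero_apply]
        by_cases h1 : l = i
        · subst h1
          rw [(he j l hij.symm).1, (he j l hij.symm).2]
          linear_combination a0 * y1
        by_cases h2 : l = j
        · subst h2
          rw [(he i l hij).1, (he i l hij).2]
          linear_combination a1 * y2
        rw [(he i l (Ne.symm h1)).1, (he i l (Ne.symm h1)).2, (he j l (Ne.symm h2)).1, (he j l (Ne.symm h2)).2]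
        ring)
    apply hy
    funext l
    fin_cases l
    · exact this.1
    · exact this.2

end dgl

/-! Part 9 -/

section nrm
variable {F : Type} [Field F]

lemma two_homs {A : Type} [CommRing A] [Algebra F A] (q τ : MvPolynomial (Fin 4) F →ₐ[F] A)
    (hsq : ∀ p p', (q p - τ p) * (q p' - τ p') = 0) (p : MvPolynomial (Fin 4) F) :
    q p - τ p = ∑ i, q (pderiv i p) * (q (X i) - τ (X i)) := by
  induction p using MvPolynomial.induction_on with
  | C a =>
    simp only [pderiv_C, map_zero, zero_mul, Finset.sum_const_zero]
    rw [← MvPolynomial.algebraMap_eq, AlgHom.commutes, AlgHom.commutes, sub_self]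
  | add p p' h h' =>
    simp only [map_add, add_mul, Finset.sum_add_distrib, ← h, ← h']; ring
  | mul_X p j h =>
    have e1 : ∑ i, q (pderiv i (p * X j)) * (q (X i) - τ (X i)) =
        q (X j) * (∑ i, q (pderiv i p) * (q (X i) - τ (X i))) + q p * (q (X j) - τ (X j)) := by
      rw [Finset.mul_sum]
      have : ∀ i, q (pderiv i (p * X j)) * (q (X i) - τ (X i)) =
          q (X j) * (q (pderiv i p) * (q (X i) - τ (X i))) + (if i = j then q p * (q (X j) - τ (X j)) else 0) := by
        intro i
        rw [Derivation.leibniz, pderiv_X, smul_eq_mul, smul_eq_mul, map_add, map_mul, map_mul]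
        split_ifs with hij
        · subst hij; rw [Pi.single_eq_same, map_one]; ring
        · rw [Pi.single_eq_of_ne (Ne.symm hij), map_zero]; ring
      rw [Finset.sum_congr rfl (fun i _ => this i), Finset.sum_add_distrib]
      simp
    rw [e1, ← h, map_mul, map_mul]
    linear_combination -(hsq p (X j))

lemma taylor_aux [CharZero F] (A : Type) [CommRing A] [IsLocalRing A] [Algebra F A] [Algebra.EssFiniteType F A]
    (φ : MvPolynomial (Fin 4) F →ₐ[F] A) (h : MvPolynomial (Fin 4) F)
    (hP : φ h ∈ IsLocalRing.maximalIdeal A) (hd : ∀ i, φ (pderiv i h) ∈ IsLocalRing.maximalIdeal A) :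
    φ h ∈ (IsLocalRing.maximalIdeal A) ^ 2 := by
  let g : (A ⧸ (IsLocalRing.maximalIdeal A) ^ 2) →ₐ[F] IsLocalRing.ResidueField A :=
    Ideal.Quotient.liftₐ ((IsLocalRing.maximalIdeal A) ^ 2) (IsScalarTower.toAlgHom F A (IsLocalRing.ResidueField A)) (by
    intro a ha
    have : a ∈ (IsLocalRing.maximalIdeal A) := Ideal.pow_le_self two_ne_zero ha
    exact (IsLocalRing.residue_eq_zero_iff a).2 this)
  have hgm : ∀ a : A, g (Ideal.Quotient.mk _ a) = IsLocalRing.residue A a := fun a => rfl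
  have hg : Function.Surjective g := by
    intro c
    obtain ⟨a, rfl⟩ := IsLocalRing.residue_surjective (R := A) c
    exact ⟨Ideal.Quotient.mk _ a, rfl⟩
  have hker : ∀ a b, g a = 0 → g b = 0 → a * b = 0 := by
    intro a b ha hb
    obtain ⟨a, rfl⟩ := Ideal.Quotient.mk_surjective a
    obtain ⟨b, rfl⟩ := Ideal.Quotient.mk_surjective b
    rw [hgm, IsLocalRing.residue_eq_zero_iff] at ha hb
    rw [← map_mul, Ideal.Quotient.eq_zero_iff_mem, pow_two]
    exact Ideal.mul_mem_mul ha hb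
  have hnil : IsNilpotent (RingHom.ker (g : (A ⧸ (IsLocalRing.maximalIdeal A) ^ 2) →+* IsLocalRing.ResidueField A)) := by
    refine ⟨2, ?_⟩
    rw [Ideal.zero_eq_bot, eq_bot_iff]
    refine (pow_two (RingHom.ker (g : (A ⧸ (IsLocalRing.maximalIdeal A) ^ 2) →+* IsLocalRing.ResidueField A))).le.trans ?_
    rw [Ideal.mul_le]
    intro a ha b hb
    exact hker a b ha hb
  have : Algebra.EssFiniteType F (IsLocalRing.ResidueField A) := Algebra.EssFiniteType.comp F A _
  have : Algebra.FormallySmooth F (IsLocalRing.ResidueField A) := Algebra.FormallySmooth.of_perfectField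
  obtain ⟨σ, hσ⟩ : ∃ σ : IsLocalRing.ResidueField A →ₐ[F] (A ⧸ (IsLocalRing.maximalIdeal A) ^ 2), ∀ x, g (σ x) = x :=
    ⟨Algebra.FormallySmooth.liftOfSurjective (AlgHom.id F _) g hg hnil,
      fun x => Algebra.FormallySmooth.liftOfSurjective_apply (AlgHom.id F _) g hg hnil x⟩
  let q := (Ideal.Quotient.mkₐ F ((IsLocalRing.maximalIdeal A) ^ 2)).comp φ
  let τ := (σ.comp g).comp q
  have hz : ∀ p, g (q p - τ p) = 0 := fun p => by
    rw [map_sub, sub_eq_zero]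
    exact (hσ (g (q p))).symm
  have hqP : ∀ p, φ p ∈ (IsLocalRing.maximalIdeal A) → g (q p) = 0 := by
    intro p hp
    exact (IsLocalRing.residue_eq_zero_iff _).2 hp
  have key := two_homs q τ (fun p p' => hker _ _ (hz p) (hz p')) h
  have h0 : q h = 0 := by
    have : τ h = 0 := by
      change σ (g (q h)) = 0
      rw [hqP h hP, map_zero]
    rw [this, sub_zero] at key
    rw [key]
    exact Finset.sum_eq_zero fun i _ => hker _ _ (hqP _ (hd i)) (hz _)
  exact Ideal.Quotient.eq_zero_iff_mem.1 h0

lemma taylor [CharZero F] (P : Ideal (MvPolynomial (Fin 4) F)) [P.IsPrime] (h : MvPolynomial (Fin 4) F)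
    (hP : h ∈ P) (hd : ∀ i, pderiv i h ∈ P) :
    algebraMap _ (Localization.AtPrime P) h ∈ (IsLocalRing.maximalIdeal (Localization.AtPrime P)) ^ 2 := by
  have h1 : Algebra.EssFiniteType (MvPolynomial (Fin 4) F) (Localization.AtPrime P) :=
    Algebra.EssFiniteType.of_isLocalization _ P.primeCompl
  have h2 : Algebra.EssFiniteType F (Localization.AtPrime P) := Algebra.EssFiniteType.comp F (MvPolynomial (Fin 4) F) _
  exact taylor_aux (Localization.AtPrime P) (IsScalarTower.toAlgHom F (MvPolynomial (Fin 4) F) _) h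
    ((IsLocalization.AtPrime.to_map_mem_maximal_iff _ P h).2 hP)
    (fun i => (IsLocalization.AtPrime.to_map_mem_maximal_iff _ P _).2 (hd i))

end nrm

/-! Part 10 -/

section nrm2
variable {F : Type} [Field F]

lemma height_le_four (P : Ideal (MvPolynomial (Fin 4) F)) (hP : P ≠ ⊤) : P.height ≤ 4 := by
  have h1 := Ideal.height_le_ringKrullDim_of_ne_top hP
  rw [MvPolynomial.ringKrullDim_of_isNoetherianRing, ringKrullDim_eq_zero_of_field] at h1
  simp only [Nat.card_eq_fintype_card, Fintype.card_fin, zero_add] at h1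
  exact WithBot.coe_le_coe.1 h1

lemma reg_facts (f g : MvPolynomial (Fin 4) F)
    (hfg : RingTheory.Sequence.IsRegular (MvPolynomial (Fin 4) F) [f, g]) :
    f ≠ 0 ∧ ∀ a, g * a ∈ Ideal.span {f} → a ∈ Ideal.span {f} := by
  rw [RingTheory.Sequence.isRegular_cons_iff, RingTheory.Sequence.isRegular_cons_iff] at hfg
  obtain ⟨h1, h2, _⟩ := hfg
  refine ⟨?_, ?_⟩
  · rintro rfl
    have := h1 (a₁ := (0 : MvPolynomial (Fin 4) F)) (a₂ := 1) (by simp)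
    exact zero_ne_one this
  · intro a ha
    have e : ∀ b : MvPolynomial (Fin 4) F, (Submodule.Quotient.mk b : QuotSMulTop f (MvPolynomial (Fin 4) F)) = 0 ↔ b ∈ Ideal.span {f} := by
      intro b
      rw [Submodule.Quotient.mk_eq_zero, Submodule.mem_smul_pointwise_iff_exists, Ideal.mem_span_singleton']
      constructor
      · rintro ⟨c, -, rfl⟩; exact ⟨c, by rw [smul_eq_mul, mul_comm]⟩
      · rintro ⟨c, rfl⟩; exact ⟨c, trivial, by rw [smul_eq_mul, mul_comm]⟩
    rw [← e]
    rw [← e] at ha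
    apply h2
    simp only [smul_zero]
    rw [← ha]; rfl

lemma ht_I0 (f g : MvPolynomial (Fin 4) F) (hf : f ≠ 0) (hg : ∀ a, g * a ∈ Ideal.span {f} → a ∈ Ideal.span {f})
    [hI : (Ideal.span {f, g}).IsPrime] : 2 ≤ (Ideal.span {f, g} : Ideal (MvPolynomial (Fin 4) F)).height := by
  have hfI : f ∈ (Ideal.span {f, g} : Ideal (MvPolynomial (Fin 4) F)) := Ideal.subset_span (by simp)
  have hgI : g ∈ (Ideal.span {f, g} : Ideal (MvPolynomial (Fin 4) F)) := Ideal.subset_span (by simp)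
  obtain ⟨p, hp, hpI, hdvd⟩ : ∃ p, Prime p ∧ p ∈ (Ideal.span {f, g} : Ideal (MvPolynomial (Fin 4) F)) ∧ p ∣ f := by
    have h1 := UniqueFactorizationMonoid.exists_prime_factors f hf
    obtain ⟨s, hs, u, hu⟩ := h1
    have h2 : s.prod ∈ (Ideal.span {f, g} : Ideal (MvPolynomial (Fin 4) F)) := by
      have : s.prod = f * ↑(u⁻¹ : (MvPolynomial (Fin 4) F)ˣ) := by rw [← hu]; simp
      rw [this]; exact Ideal.mul_mem_right _ _ hfI
    obtain ⟨p, hps, hpI⟩ := (Ideal.IsPrime.multiset_prod_mem_iff_exists_mem hI s).1 h2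
    exact ⟨p, hs p hps, hpI, (Multiset.dvd_prod hps).trans ⟨_, hu.symm⟩⟩
  have hpp : (Ideal.span {p} : Ideal (MvPolynomial (Fin 4) F)).IsPrime := (Ideal.span_singleton_prime hp.ne_zero).2 hp
  have l1 : (⊥ : Ideal (MvPolynomial (Fin 4) F)) < Ideal.span {p} := by
    rw [bot_lt_iff_ne_bot, Ne, Ideal.span_singleton_eq_bot]; exact hp.ne_zero
  have l2 : (Ideal.span {p} : Ideal (MvPolynomial (Fin 4) F)) < Ideal.span {f, g} := by
    refine lt_of_le_of_ne (by rw [Ideal.span_singleton_le_iff_mem]; exact hpI) ?_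
    intro he
    obtain ⟨a, ha⟩ := hdvd
    obtain ⟨b, hb⟩ := Ideal.mem_span_singleton'.1 (he ▸ hgI)
    have h3 := hg a (by rw [← hb, ha]; exact Ideal.mem_span_singleton'.2 ⟨b, by ring⟩)
    obtain ⟨c, hc⟩ := Ideal.mem_span_singleton'.1 h3
    have ha0 : a ≠ 0 := by rintro rfl; exact hf (by rw [ha, mul_zero])
    have : a * (c * p) = a * 1 := by rw [mul_one]; conv_rhs => rw [← hc, ha]
                                     ring
    have h4 := mul_left_cancel₀ ha0 this
    exact hp.not_isUnit (IsUnit.of_mul_eq_one c (by rw [mul_comm]; exact h4))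
  have a1 := Ideal.height_add_one_le_of_lt_of_isPrime l1
  have a2 := Ideal.height_add_one_le_of_lt_of_isPrime l2
  calc (2 : ℕ∞) = 0 + 1 + 1 := by norm_num
    _ ≤ _ := le_trans (add_le_add (le_trans (add_le_add bot_le le_rfl) a1) le_rfl) a2

lemma loc_gen (I0 : Ideal (MvPolynomial (Fin 4) F)) [IsDomain (MvPolynomial (Fin 4) F ⧸ I0)]
    [IsIntegrallyClosed (MvPolynomial (Fin 4) F ⧸ I0)] [hI : I0.IsPrime] (h2 : 2 ≤ I0.height)
    (P : Ideal (MvPolynomial (Fin 4) F)) [hP : P.IsPrime] (hIP : I0 ≤ P) (h3 : P.height ≤ 3) :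
    ∃ a ∈ P, ∀ x ∈ P, ∃ s, s ∉ P ∧ ∃ b, s * x - b * a ∈ I0 := by
  let π := Ideal.Quotient.mk I0
  have hπ : Function.Surjective π := Ideal.Quotient.mk_surjective
  have hk : RingHom.ker π ≤ P := by rw [Ideal.mk_ker]; exact hIP
  have hp : (P.map π).IsPrime := Ideal.map_isPrime_of_surjective hπ hk
  have hmem : ∀ x, π x ∈ P.map π ↔ x ∈ P := by
    intro x
    rw [← Ideal.mem_comap, Ideal.comap_map_of_surjective' π hπ, sup_eq_left.2 hk]
  have hle : (P.map π).primeCompl ≤ nonZeroDivisors _ := Ideal.primeCompl_le_nonZeroDivisors _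
  have : IsIntegrallyClosed (Localization.AtPrime (P.map π)) := isIntegrallyClosed_of_isLocalization _ _ hle
  have hinj := IsLocalization.injective (Localization.AtPrime (P.map π)) hle
  have hmax := (tfae_of_isNoetherianRing_of_isLocalRing_of_isDomain (R := Localization.AtPrime (P.map π))).out 3 4
  have hpr := hmax.1 ⟨inferInstance, by
    intro q hq hqp
    by_contra hne
    have hlt : q < IsLocalRing.maximalIdeal _ := lt_of_le_of_ne (IsLocalRing.le_maximalIdeal hqp.ne_top) hne
    have c1 := (IsLocalization.AtPrime.comap_maximalIdeal (Localization.AtPrime (P.map π)) (P.map π))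
    have hqc : q.comap (algebraMap _ _) < P.map π := by
      refine lt_of_le_of_ne ((Ideal.comap_mono hlt.le).trans c1.le) ?_
      intro he
      have := congrArg (Ideal.map (algebraMap _ (Localization.AtPrime (P.map π)))) (he.trans c1.symm)
      rw [IsLocalization.map_comap (P.map π).primeCompl, IsLocalization.map_comap (P.map π).primeCompl] at this
      exact hne this
    have hq0 : q.comap (algebraMap (MvPolynomial (Fin 4) F ⧸ I0) _) ≠ ⊥ := by
      intro he
      have := congrArg (Ideal.map (algebraMap _ (Localization.AtPrime (P.map π)))) he
      rw [IsLocalization.map_comap (P.map π).primeCompl, Ideal.map_bot] at this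
      exact hq this
    have l1 : I0 < (q.comap (algebraMap _ _)).comap π := by
      refine lt_of_le_of_ne ?_ ?_
      · intro x hx
        have : π x = 0 := Ideal.Quotient.eq_zero_iff_mem.2 hx
        rw [Ideal.mem_comap, this]; exact Ideal.zero_mem _
      · intro he
        apply hq0
        rw [eq_bot_iff]
        intro x hx
        obtain ⟨x, rfl⟩ := hπ x
        have : x ∈ I0 := by rw [he]; exact hx
        exact Ideal.Quotient.eq_zero_iff_mem.2 this
    have l2 : (q.comap (algebraMap _ _)).comap π < P := by
      refine lt_of_le_of_ne ?_ ?_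
      · intro x hx
        exact (hmem x).1 (hqc.le hx)
      · intro he
        refine hqc.ne ?_
        refine le_antisymm hqc.le ?_
        rw [Ideal.map_le_iff_le_comap, he]
    have a1 := Ideal.height_add_one_le_of_lt_of_isPrime l1
    have a2 := Ideal.height_add_one_le_of_lt_of_isPrime l2
    have : (2 : ℕ∞) + 1 + 1 ≤ 3 := le_trans (add_le_add (le_trans (add_le_add h2 le_rfl) a1) le_rfl) (a2.trans h3)
    norm_num at this⟩
  obtain ⟨u, hu⟩ := hpr
  obtain ⟨a, s, rfl⟩ := IsLocalization.exists_mk'_eq (P.map π).primeCompl u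
  obtain ⟨a, rfl⟩ := hπ a
  have hum : IsLocalization.mk' (Localization.AtPrime (P.map π)) (π a) s ∈ IsLocalRing.maximalIdeal (Localization.AtPrime (P.map π)) := by
    rw [hu]; exact Submodule.mem_span_singleton_self _
  refine ⟨a, ?_, ?_⟩
  · rwa [IsLocalization.AtPrime.mk'_mem_maximal_iff _ (P.map π), hmem] at hum
  · intro x hx
    have hxm := (IsLocalization.AtPrime.to_map_mem_maximal_iff (Localization.AtPrime (P.map π)) (P.map π) (π x)).2 ((hmem x).2 hx)
    rw [hu] at hxm
    obtain ⟨r, hr⟩ := Submodule.mem_span_singleton.1 hxm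
    obtain ⟨b, t, rfl⟩ := IsLocalization.exists_mk'_eq (P.map π).primeCompl r
    rw [smul_eq_mul, ← IsLocalization.mk'_mul, IsLocalization.mk'_eq_iff_eq_mul, ← map_mul] at hr
    have hr := hinj hr
    obtain ⟨b, rfl⟩ := hπ b
    obtain ⟨s', hs'⟩ := hπ ((t * s : (P.map π).primeCompl) : _)
    refine ⟨s', ?_, b, ?_⟩
    · rw [← hmem, hs']; exact (t * s).2
    · rw [← Ideal.Quotient.eq_zero_iff_mem, map_sub, map_mul, map_mul]
      change π s' * π x - π b * π a = 0
      rw [hr, hs']; ring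

lemma nak [CharZero F] (f g a c d : MvPolynomial (Fin 4) F) (P : Ideal (MvPolynomial (Fin 4) F)) [hP : P.IsPrime]
    (hf : f ∈ P) (hg : g ∈ P) (hc : c ∉ P) (hd : ∀ i, c * pderiv i f + d * pderiv i g ∈ P)
    (hx : ∀ x ∈ P, ∃ s, s ∉ P ∧ ∃ b, s * x - b * a ∈ Ideal.span {f, g}) :
    IsLocalRing.maximalIdeal (Localization.AtPrime P) ≤
      Ideal.span {algebraMap _ (Localization.AtPrime P) g, algebraMap _ (Localization.AtPrime P) a} := by
  have hh : algebraMap _ (Localization.AtPrime P) (c * f + d * g) ∈ (IsLocalRing.maximalIdeal (Localization.AtPrime P)) ^ 2 := by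
    apply taylor
    · exact Ideal.add_mem _ (Ideal.mul_mem_left _ _ hf) (Ideal.mul_mem_left _ _ hg)
    · intro i
      have : pderiv i (c * f + d * g) = (c * pderiv i f + d * pderiv i g) + (f * pderiv i c + g * pderiv i d) := by
        simp only [map_add, Derivation.leibniz, smul_eq_mul]; ring
      rw [this]
      exact Ideal.add_mem _ (hd i) (Ideal.add_mem _ (Ideal.mul_mem_right _ _ hf) (Ideal.mul_mem_right _ _ hg))
  apply Submodule.le_of_le_smul_of_le_jacobson_bot (I := IsLocalRing.maximalIdeal (Localization.AtPrime P))
    (IsNoetherian.noetherian _) (IsLocalRing.maximalIdeal_le_jacobson _)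
  set N : Ideal (Localization.AtPrime P) := Ideal.span {algebraMap _ (Localization.AtPrime P) g, algebraMap _ (Localization.AtPrime P) a} with hN
  rw [smul_eq_mul, ← pow_two]
  have hu : ∀ s, s ∉ P → ∀ (J : Ideal (Localization.AtPrime P)) z, algebraMap _ (Localization.AtPrime P) s * z ∈ J → z ∈ J := by
    intro s hs J z hz
    have : IsUnit (algebraMap _ (Localization.AtPrime P) s) := (IsLocalization.AtPrime.isUnit_to_map_iff _ P s).2 hs
    exact (Ideal.unit_mul_mem_iff_mem J this).1 hz
  have hgN : algebraMap _ (Localization.AtPrime P) g ∈ N ⊔ (IsLocalRing.maximalIdeal (Localization.AtPrime P)) ^ 2 :=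
    Ideal.mem_sup_left (Ideal.subset_span (by simp))
  have haN : algebraMap _ (Localization.AtPrime P) a ∈ N ⊔ (IsLocalRing.maximalIdeal (Localization.AtPrime P)) ^ 2 :=
    Ideal.mem_sup_left (Ideal.subset_span (by simp))
  have hfN : algebraMap _ (Localization.AtPrime P) f ∈ N ⊔ (IsLocalRing.maximalIdeal (Localization.AtPrime P)) ^ 2 := by
    apply hu c hc
    have := Ideal.sub_mem _ (Ideal.mem_sup_right (S := N) hh) (Ideal.mul_mem_left _ (algebraMap _ (Localization.AtPrime P) d) hgN)
    rw [map_add, map_mul, map_mul, add_sub_cancel_right] at this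
    exact this
  rw [← Localization.AtPrime.map_eq_maximalIdeal, Ideal.map_le_iff_le_comap]
  intro x hxP
  rw [Localization.AtPrime.map_eq_maximalIdeal, Ideal.mem_comap]
  obtain ⟨s, hs, b, hb⟩ := hx x hxP
  obtain ⟨p, q, hpq⟩ := Ideal.mem_span_pair.1 hb
  apply hu s hs
  have : s * x = p * f + q * g + b * a := by rw [hpq]; ring
  rw [← map_mul, this, map_add, map_add, map_mul, map_mul, map_mul]
  exact Ideal.add_mem _ (Ideal.add_mem _ (Ideal.mul_mem_left _ _ hfN) (Ideal.mul_mem_left _ _ hgN)) (Ideal.mul_mem_left _ _ haN)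

lemma ht_of_span (P : Ideal (MvPolynomial (Fin 4) F)) [hP : P.IsPrime] (s : Finset (Localization.AtPrime P))
    (h : IsLocalRing.maximalIdeal (Localization.AtPrime P) ≤ Ideal.span (s : Set (Localization.AtPrime P)))
    (h' : (s : Set (Localization.AtPrime P)) ⊆ IsLocalRing.maximalIdeal (Localization.AtPrime P)) :
    P.height ≤ s.card := by
  have e : IsLocalRing.maximalIdeal (Localization.AtPrime P) = Ideal.span (s : Set (Localization.AtPrime P)) :=
    le_antisymm h (Ideal.span_le.2 h')
  have h1 := Ideal.height_le_spanFinrank (IsLocalRing.maximalIdeal (Localization.AtPrime P)) (Ideal.IsPrime.ne_top inferInstance)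
  have h2 := IsLocalization.AtPrime.ringKrullDim_eq_height P (Localization.AtPrime P)
  rw [← IsLocalRing.maximalIdeal_height_eq_ringKrullDim] at h2
  rw [← WithBot.coe_injective h2]
  refine h1.trans ?_
  rw [e]
  have h3 := Submodule.spanFinrank_span_le_ncard_of_finite (R := Localization.AtPrime P) (s.finite_toSet)
  rw [Set.ncard_coe_finset] at h3
  exact_mod_cast h3

lemma M1_aux [CharZero F] (f g c d : MvPolynomial (Fin 4) F) (h2 : 2 ≤ (Ideal.span {f, g}).height)
    [IsDomain (MvPolynomial (Fin 4) F ⧸ Ideal.span {f, g})] [IsIntegrallyClosed (MvPolynomial (Fin 4) F ⧸ Ideal.span {f, g})]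
    (P : Ideal (MvPolynomial (Fin 4) F)) [hP : P.IsPrime]
    (hf : f ∈ P) (hg : g ∈ P) (h3 : P.height ≤ 3) (hc : c ∉ P) (hd : ∀ i, c * pderiv i f + d * pderiv i g ∈ P) : False := by
  have hI : (Ideal.span {f, g}).IsPrime := (Ideal.Quotient.isDomain_iff_prime _).1 inferInstance
  have hIP : Ideal.span {f, g} ≤ P := by
    rw [Ideal.span_le]; rintro x (rfl | rfl) <;> assumption
  have hmm := fun x => (IsLocalization.AtPrime.to_map_mem_maximal_iff (Localization.AtPrime P) P x)
  classical
  rcases hIP.eq_or_lt with he | hlt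
  · have h := nak f g 0 c d P hf hg hc hd (fun x hx => ⟨1, fun h => hP.ne_top ((Ideal.eq_top_iff_one _).2 h), 0, by
      rw [he]; simpa using hx⟩)
    have := ht_of_span P {algebraMap _ (Localization.AtPrime P) g} (h.trans (by
      rw [Ideal.span_le]; rintro x (rfl | rfl)
      · exact Ideal.subset_span (by simp)
      · rw [map_zero]; exact Ideal.zero_mem _)) (by
      intro x hx; simp at hx; rw [hx]; exact (hmm g).2 hg)
    rw [he] at h2
    have := h2.trans this
    norm_num at this
  · obtain ⟨a, ha, hx⟩ := loc_gen (Ideal.span {f, g}) h2 P hIP h3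
    have h := nak f g a c d P hf hg hc hd hx
    have h4 := ht_of_span P {algebraMap _ (Localization.AtPrime P) g, algebraMap _ (Localization.AtPrime P) a} (by simpa using h) (by
      intro x hx; simp at hx; rcases hx with rfl | rfl
      · exact (hmm _).2 hg
      · exact (hmm _).2 ha)
    have h5 := Ideal.height_add_one_le_of_lt_of_isPrime hlt
    have h6 : (2 : ℕ∞) + 1 ≤ 2 := (add_le_add h2 le_rfl).trans (h5.trans (h4.trans (by exact_mod_cast Finset.card_le_two)))
    norm_num at h6

/-- the prime ideal of the line through `v` -/
def lineHom (K : Type) [Field K] [Algebra F K] (v : Fin 4 → K) : MvPolynomial (Fin 4) F →ₐ[F] Polynomial K :=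
  aeval (fun i => Polynomial.C (v i) * Polynomial.X)

lemma lineHom_hom (K : Type) [Field K] [Algebra F K] (v : Fin 4 → K) (p : MvPolynomial (Fin 4) F) (m : ℕ)
    (hp : p.IsHomogeneous m) : lineHom K v p = Polynomial.C (aeval v p) * Polynomial.X ^ m := by
  rw [lineHom, aeval_def, aeval_def, eval₂_eq', eval₂_eq', map_sum, Finset.sum_mul]
  refine Finset.sum_congr rfl fun e he => ?_
  have hm : ∑ i, e i = m := by
    have := hp (mem_support_iff.1 he)
    rw [← this, Finsupp.weight_apply, Finsupp.sum_fintype] <;> simp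
  simp only [mul_pow, Finset.prod_mul_distrib, Finset.prod_pow_eq_pow_sum, hm, map_mul, map_prod, map_pow]
  rw [← mul_assoc]
  congr 2

lemma line_prime (K : Type) [Field K] [Algebra F K] (v : Fin 4 → K) : (RingHom.ker (lineHom (F := F) K v)).IsPrime :=
  RingHom.ker_isPrime _

lemma line_lt (K : Type) [Field K] [Algebra F K] (v : Fin 4 → K) (hv : v ≠ 0) :
    RingHom.ker (lineHom (F := F) K v) < RingHom.ker (constantCoeff (σ := Fin 4) (R := F)) := by
  have h2 : ∀ p, Polynomial.eval 0 (lineHom (F := F) K v p) = algebraMap F K (constantCoeff p) := by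
    intro p
    induction p using MvPolynomial.induction_on with
    | C a => simp [lineHom]
    | add p q h h' => rw [map_add, Polynomial.eval_add, h, h', map_add, map_add]
    | mul_X p i h => simp [lineHom]
  refine lt_of_le_of_ne ?_ ?_
  · intro p hp
    rw [RingHom.mem_ker] at hp ⊢
    have h1 := congrArg (Polynomial.eval 0) hp
    rw [h2, Polynomial.eval_zero] at h1
    exact (map_eq_zero _).1 h1
  · intro he
    apply hv
    funext i
    have : (X i : MvPolynomial (Fin 4) F) ∈ RingHom.ker (lineHom (F := F) K v) := by
      rw [he, RingHom.mem_ker]; simp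
    rw [RingHom.mem_ker] at this
    simpa [lineHom] using this

lemma line_ht (K : Type) [Field K] [Algebra F K] (v : Fin 4 → K) (hv : v ≠ 0) :
    (RingHom.ker (lineHom (F := F) K v)).height ≤ 3 := by
  have h0 := line_prime (F := F) K v
  have h1 : (RingHom.ker (constantCoeff (σ := Fin 4) (R := F))).IsPrime := RingHom.ker_isPrime _
  have h2 := Ideal.height_add_one_le_of_lt_of_isPrime (line_lt (F := F) K v hv)
  have h3 := h2.trans (height_le_four _ h1.ne_top)
  have : (4 : ℕ∞) = 3 + 1 := by norm_num
  rw [this] at h3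
  exact (ENat.add_le_add_iff_right (by norm_num)).1 h3

lemma M1 [CharZero F] (f g : MvPolynomial (Fin 4) F) (hf : f.IsHomogeneous 2) (hg : g.IsHomogeneous 2)
    (hfg : RingTheory.Sequence.IsRegular (MvPolynomial (Fin 4) F) [f, g])
    [IsDomain (MvPolynomial (Fin 4) F ⧸ Ideal.span {f, g})] [IsIntegrallyClosed (MvPolynomial (Fin 4) F ⧸ Ideal.span {f, g})]
    (K : Type) [Field K] [Algebra F K] (v : Fin 4 → K) (hv : v ≠ 0) (hfv : aeval v f = 0) (hgv : aeval v g = 0)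
    (s t : K) (hst : ∀ i, s * aeval v (pderiv i f) + t * aeval v (pderiv i g) = 0) : s = 0 ∧ t = 0 := by
  have hI : (Ideal.span {f, g}).IsPrime := (Ideal.Quotient.isDomain_iff_prime _).1 inferInstance
  obtain ⟨r1, r2⟩ := reg_facts f g hfg
  have h2 := ht_I0 f g r1 r2
  have hP := line_prime (F := F) K v
  have hdf : ∀ i, (pderiv i f).IsHomogeneous 1 := fun i => hf.pderiv
  have hdg : ∀ i, (pderiv i g).IsHomogeneous 1 := fun i => hg.pderiv
  have mf : f ∈ RingHom.ker (lineHom (F := F) K v) := by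
    rw [RingHom.mem_ker, lineHom_hom K v f 2 hf, hfv]; simp
  have mg : g ∈ RingHom.ker (lineHom (F := F) K v) := by
    rw [RingHom.mem_ker, lineHom_hom K v g 2 hg, hgv]; simp
  by_contra hne
  have minor : ∀ i j, pderiv j g * pderiv i f + (-pderiv j f) * pderiv i g ∈ RingHom.ker (lineHom (F := F) K v) := by
    intro i j
    rw [RingHom.mem_ker, map_add, map_mul, map_mul, map_neg, lineHom_hom K v _ 1 (hdf i), lineHom_hom K v _ 1 (hdf j),
      lineHom_hom K v _ 1 (hdg i), lineHom_hom K v _ 1 (hdg j)]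
    have : aeval v (pderiv j g) * aeval v (pderiv i f) - aeval v (pderiv j f) * aeval v (pderiv i g) = (0 : K) := by
      by_cases hs : s = 0
      · have ht : t ≠ 0 := fun ht => hne ⟨hs, ht⟩
        apply mul_left_cancel₀ ht
        linear_combination aeval v (pderiv i f) * hst j - aeval v (pderiv j f) * hst i
      · apply mul_left_cancel₀ hs
        linear_combination aeval v (pderiv j g) * hst i - aeval v (pderiv i g) * hst j
    have := congrArg Polynomial.C this
    simp only [map_sub, map_mul, map_zero] at this
    linear_combination Polynomial.X ^ 2 * this
  have h1n : (1 : MvPolynomial (Fin 4) F) ∉ RingHom.ker (lineHom (F := F) K v) := fun h =>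
    hP.ne_top ((Ideal.eq_top_iff_one _).2 h)
  by_cases c1 : ∀ i, pderiv i g ∈ RingHom.ker (lineHom (F := F) K v)
  · have e : (Ideal.span {f, g} : Ideal (MvPolynomial (Fin 4) F)) = Ideal.span {g, f} := by rw [Set.pair_comm]
    have i1 : IsDomain (MvPolynomial (Fin 4) F ⧸ Ideal.span {g, f}) := e ▸ inferInstance
    have i2 : IsIntegrallyClosed (MvPolynomial (Fin 4) F ⧸ Ideal.span {g, f}) := e ▸ inferInstance
    exact M1_aux g f 1 0 (e ▸ h2) _ mg mf (line_ht K v hv) h1n (fun i => by simpa using c1 i)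
  · push Not at c1
    obtain ⟨j, hj⟩ := c1
    exact M1_aux f g _ _ h2 _ mf mg (line_ht K v hv) hj (fun i => minor i j)

end nrm2

/-! Part 11 -/

section morley
variable {A : Type} [CommRing A]

/-- determinant with given rows -/
def D4 (a b c e : Fin 4 → A) : A := (Matrix.of ![a, b, c, e]).det

lemma D4_eq (a b c e : Fin 4 → A) : D4 a b c e =
    a 0 * (b 1 * (c 2 * e 3 - c 3 * e 2) - b 2 * (c 1 * e 3 - c 3 * e 1) + b 3 * (c 1 * e 2 - c 2 * e 1))
    - a 1 * (b 0 * (c 2 * e 3 - c 3 * e 2) - b 2 * (c 0 * e 3 - c 3 * e 0) + b 3 * (c 0 * e 2 - c 2 * e 0))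
    + a 2 * (b 0 * (c 1 * e 3 - c 3 * e 1) - b 1 * (c 0 * e 3 - c 3 * e 0) + b 3 * (c 0 * e 1 - c 1 * e 0))
    - a 3 * (b 0 * (c 1 * e 2 - c 2 * e 1) - b 1 * (c 0 * e 2 - c 2 * e 0) + b 2 * (c 0 * e 1 - c 1 * e 0)) := by
  rw [D4, det_fin_four]; rfl

lemma D4_cramer (a b c e z : Fin 4 → A) (i : Fin 4) : z i * D4 a b c e =
    dotProduct a z * D4 (Pi.single i 1) b c e + dotProduct b z * D4 a (Pi.single i 1) c e
     + dotProduct c z * D4 a b (Pi.single i 1) e + dotProduct e z * D4 a b c (Pi.single i 1) := by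
  simp only [D4_eq, dotProduct, Fin.sum_univ_four]
  fin_cases i <;> simp <;> ring

lemma D4_trace (a b c e : Fin 4 → A) (H : Matrix (Fin 4) (Fin 4) A) :
    D4 (H.mulVec a) b c e + D4 a (H.mulVec b) c e + D4 a b (H.mulVec c) e + D4 a b c (H.mulVec e) = H.trace * D4 a b c e := by
  simp only [D4_eq, Matrix.mulVec, dotProduct, Fin.sum_univ_four, Matrix.trace, Matrix.diag]
  ring

/-- the bilinear form in the last two rows -/
def D2 (a b : Fin 4 → A) : (Fin 4 → A) →ₗ[A] (Fin 4 → A) →ₗ[A] A :=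
  LinearMap.mk₂ A (D4 a b) (fun _ _ _ => by simp only [D4_eq, Pi.add_apply]; ring)
    (fun _ _ _ => by simp only [D4_eq, Pi.smul_apply, smul_eq_mul]; ring)
    (fun _ _ _ => by simp only [D4_eq, Pi.add_apply]; ring)
    (fun _ _ _ => by simp only [D4_eq, Pi.smul_apply, smul_eq_mul]; ring)

lemma D2_apply (a b c e : Fin 4 → A) : D2 a b c e = D4 a b c e := rfl
lemma D4_zero1 (b c e : Fin 4 → A) : D4 0 b c e = 0 := by simp [D4_eq]
lemma D4_zero2 (b c e : Fin 4 → A) : D4 b 0 c e = 0 := by simp [D4_eq]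
lemma D4_swap (a b c e : Fin 4 → A) : D4 a b c e = - D4 a b e c := by simp only [D4_eq]; ring

lemma dot_symm (H : Matrix (Fin 4) (Fin 4) A) (hH : H.transpose = H) (u v : Fin 4 → A) :
    dotProduct (H.mulVec u) v = dotProduct (H.mulVec v) u := by
  rw [dotProduct_comm, Matrix.dotProduct_mulVec, ← Matrix.mulVec_transpose, hH]

lemma morley1 (L : Ideal A) (p q x t : Fin 4 → A) (H H' : Matrix (Fin 4) (Fin 4) A) (hH : H.transpose = H) (hH' : H'.transpose = H')
    (hp : dotProduct p x ∈ L) (hq : dotProduct q x ∈ L) (h1 : dotProduct (H.mulVec x) x ∈ L) (h2 : dotProduct (H'.mulVec x) x ∈ L)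
    (tp : dotProduct p t = 0) (tq : dotProduct q t = 0) (i : Fin 4) :
    x i * (D4 p q (H.mulVec x) (H'.mulVec t) + D4 p q (H.mulVec t) (H'.mulVec x)) - t i * D4 p q (H.mulVec x) (H'.mulVec x) ∈ L := by
  rw [mul_add, D4_cramer p q (H.mulVec x) (H'.mulVec t) x, D4_cramer p q (H.mulVec t) (H'.mulVec x) x,
    D4_cramer p q (H.mulVec x) (H'.mulVec x) t, tp, tq, dot_symm H hH t x, dot_symm H' hH' t x]
  have k : dotProduct p x * (D4 (Pi.single i 1) q (H.mulVec x) (H'.mulVec t) + D4 (Pi.single i 1) q (H.mulVec t) (H'.mulVec x))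
    + dotProduct q x * (D4 p (Pi.single i 1) (H.mulVec x) (H'.mulVec t) + D4 p (Pi.single i 1) (H.mulVec t) (H'.mulVec x))
    + dotProduct (H.mulVec x) x * D4 p q (Pi.single i 1) (H'.mulVec t) + dotProduct (H'.mulVec x) x * D4 p q (H.mulVec t) (Pi.single i 1) ∈ L :=
    Ideal.add_mem _ (Ideal.add_mem _ (Ideal.add_mem _ (Ideal.mul_mem_right _ _ hp) (Ideal.mul_mem_right _ _ hq))
      (Ideal.mul_mem_right _ _ h1)) (Ideal.mul_mem_right _ _ h2)
  convert k using 1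
  ring

lemma morley2 (L : Ideal A) (p q x : Fin 4 → A) (t H H' : Matrix (Fin 4) (Fin 4) A) (hH : H.transpose = H) (hH' : H'.transpose = H')
    (ht : t.transpose = t) (hp : dotProduct p x ∈ L) (hq : dotProduct q x ∈ L)
    (tp : t.mulVec p = 0) (tq : t.mulVec q = 0) (d1 : (H * t).trace = 0) (d2 : (H' * t).trace = 0) (l : Fin 4) :
    x l * (∑ i, ∑ j, t i j * D4 p q (H.mulVec (Pi.single i 1)) (H'.mulVec (Pi.single j 1)))
      - (D4 p q (H.mulVec x) (H'.mulVec (t l)) + D4 p q (H.mulVec (t l)) (H'.mulVec x)) ∈ L := by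
  have tl : t l = t.mulVec (Pi.single l 1) := by
    rw [Matrix.mulVec_single_one]; funext i; conv_lhs => rw [← ht]
    rfl
  have s1 := D4_trace p q (Pi.single l 1) (H.mulVec x) (H' * t)
  have s2 := D4_trace p q (H'.mulVec x) (Pi.single l 1) (H * t)
  simp only [← Matrix.mulVec_mulVec, tp, tq, Matrix.mulVec_zero, D4_zero1, D4_zero2, zero_add, d1, d2, zero_mul, ← tl] at s1 s2
  have tot : ∀ u : Fin 4 → A, ∑ i, u i • (Pi.single i 1 : Fin 4 → A) = u := by
    intro u; funext j; simp [Finset.sum_apply, Pi.single_apply]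
  have e1 : ∑ i, ∑ j, t i j * (dotProduct (H.mulVec (Pi.single i 1)) x * D4 p q (Pi.single l 1) (H'.mulVec (Pi.single j 1)))
      = D4 p q (Pi.single l 1) (H'.mulVec (t.mulVec (H.mulVec x))) := by
    have : t.mulVec (H.mulVec x) = ∑ j, (∑ i, t i j * dotProduct (H.mulVec (Pi.single i 1)) x) • (Pi.single j 1 : Fin 4 → A) := by
      rw [tot]
      funext j
      rw [Matrix.mulVec, dotProduct]
      refine Finset.sum_congr rfl fun i _ => ?_
      rw [dot_symm H hH, dotProduct_single_one]
      conv_lhs => rw [← ht]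
      rfl
    rw [this, ← D2_apply, ← Matrix.mulVecLin_apply, map_sum, map_sum, Finset.sum_comm]
    refine Finset.sum_congr rfl fun j _ => ?_
    rw [map_smul, map_smul, D2_apply, Matrix.mulVecLin_apply, smul_eq_mul, Finset.sum_mul]
    exact Finset.sum_congr rfl fun i _ => by ring
  have e2 : ∑ i, ∑ j, t i j * (dotProduct (H'.mulVec (Pi.single j 1)) x * D4 p q (H.mulVec (Pi.single i 1)) (Pi.single l 1))
      = D4 p q (H.mulVec (t.mulVec (H'.mulVec x))) (Pi.single l 1) := by
    have : t.mulVec (H'.mulVec x) = ∑ i, (∑ j, t i j * dotProduct (H'.mulVec (Pi.single j 1)) x) • (Pi.single i 1 : Fin 4 → A) := by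
      rw [tot]
      funext j
      rw [Matrix.mulVec, dotProduct]
      refine Finset.sum_congr rfl fun i _ => ?_
      rw [dot_symm H' hH', dotProduct_single_one]
    rw [this, ← D2_apply, ← Matrix.mulVecLin_apply, map_sum, map_sum, LinearMap.sum_apply]
    refine Finset.sum_congr rfl fun j _ => ?_
    rw [map_smul, map_smul, LinearMap.smul_apply, D2_apply, Matrix.mulVecLin_apply, smul_eq_mul, Finset.sum_mul]
    exact Finset.sum_congr rfl fun i _ => by ring
  have e3 : x l * (∑ i, ∑ j, t i j * D4 p q (H.mulVec (Pi.single i 1)) (H'.mulVec (Pi.single j 1))) =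
     dotProduct p x * (∑ i, ∑ j, t i j * D4 (Pi.single l 1) q (H.mulVec (Pi.single i 1)) (H'.mulVec (Pi.single j 1)))
     + dotProduct q x * (∑ i, ∑ j, t i j * D4 p (Pi.single l 1) (H.mulVec (Pi.single i 1)) (H'.mulVec (Pi.single j 1)))
     + D4 p q (Pi.single l 1) (H'.mulVec (t.mulVec (H.mulVec x)))
     + D4 p q (H.mulVec (t.mulVec (H'.mulVec x))) (Pi.single l 1) := by
    rw [← e1, ← e2]
    simp only [Finset.mul_sum, ← Finset.sum_add_distrib]
    refine Finset.sum_congr rfl fun i _ => Finset.sum_congr rfl fun j _ => ?_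
    linear_combination t i j * D4_cramer p q (H.mulVec (Pi.single i 1)) (H'.mulVec (Pi.single j 1)) x l
  rw [e3]
  have k := Ideal.add_mem _ (Ideal.mul_mem_right (∑ i, ∑ j, t i j * D4 (Pi.single l 1) q (H.mulVec (Pi.single i 1)) (H'.mulVec (Pi.single j 1))) _ hp)
     (Ideal.mul_mem_right (∑ i, ∑ j, t i j * D4 p (Pi.single l 1) (H.mulVec (Pi.single i 1)) (H'.mulVec (Pi.single j 1))) _ hq)
  convert k using 1
  have w1 := D4_swap p q (H'.mulVec (t l)) (H.mulVec x)
  have w2 := D4_swap p q (H'.mulVec x) (H.mulVec (t l))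
  linear_combination s1 + s2 - w1 - w2

end morley

/-! Part 12 -/

section homog
variable {K : Type} [Field K]

/-- `x`-degree component -/
def cmp (j : ℕ) : BB K →ₗ[K] BB K := weightedHomogeneousComponent (wx 4 4) j

section gr
attribute [local instance] MvPolynomial.weightedGradedAlgebra
lemma cmp_mul (a b : BB K) (i : ℕ) (hb : b.IsWeightedHomogeneous (wx 4 4) i) (m : ℕ) :
    cmp m (a * b) = if i ≤ m then cmp (m - i) a * b else 0 := by
  have hb' : b ∈ weightedHomogeneousSubmodule K (wx 4 4) i := hb
  split_ifs with h
  · have := DirectSum.coe_decompose_mul_of_right_mem_of_le (weightedHomogeneousSubmodule K (wx 4 4)) (a := a) hb' h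
    erw [weightedDecomposition.decompose'_apply, weightedDecomposition.decompose'_apply] at this
    exact this
  · have := DirectSum.coe_decompose_mul_of_right_mem_of_not_le (weightedHomogeneousSubmodule K (wx 4 4)) (a := a) hb' h
    erw [weightedDecomposition.decompose'_apply] at this
    exact this
end gr

lemma cmp_hom (a : BB K) (m : ℕ) : (cmp m a).IsWeightedHomogeneous (wx 4 4) m :=
  weightedHomogeneousComponent_isWeightedHomogeneous m a
lemma cmp_same {a : BB K} {m : ℕ} (h : a.IsWeightedHomogeneous (wx 4 4) m) : cmp m a = a :=
  weightedHomogeneousComponent_eq_self h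

lemma hom_fst {a : BB K} {p : ℕ × ℕ} (h : a.IsWeightedHomogeneous (bwt 4 4) p) :
    a.IsWeightedHomogeneous (wx 4 4) p.1 := by
  intro m hm
  rw [← h hm]
  simp only [Finsupp.weight_apply, Finsupp.sum, Prod.fst_sum]
  refine Finset.sum_congr rfl fun i _ => ?_
  rcases i with i | i <;> simp [wx, bwt]

lemma hom_eR {t : TT K} {m : ℕ} (h : t.IsHomogeneous m) :
    (rename Sum.inr t : BB K).IsWeightedHomogeneous (bwt 4 4) (0, m) := by
  intro e he
  obtain ⟨u, rfl, hu⟩ := coeff_rename_ne_zero _ _ _ he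
  have := h hu
  rw [← this]
  rw [Finsupp.weight_apply, Finsupp.sum_mapDomain_index_inj Sum.inr_injective, Finsupp.weight_apply]
  ext <;> simp [Finsupp.sum, Prod.fst_sum, Prod.snd_sum, bwt]

lemma hom0_eR (t : TT K) : (rename Sum.inr t : BB K).IsWeightedHomogeneous (wx 4 4) 0 := by
  intro e he
  obtain ⟨u, rfl, hu⟩ := coeff_rename_ne_zero _ _ _ he
  rw [Finsupp.weight_apply, Finsupp.sum_mapDomain_index_inj Sum.inr_injective]
  simp [Finsupp.sum, wx]

lemma hom_x (i : Fin 4) : (X (Sum.inl i) : BB K).IsWeightedHomogeneous (bwt 4 4) (1, 0) :=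
  isWeightedHomogeneous_X _ _ _
lemma hom_y (i : Fin 4) : (X (Sum.inr i) : BB K).IsWeightedHomogeneous (bwt 4 4) (0, 1) :=
  isWeightedHomogeneous_X _ _ _

lemma eR_of_hom0 {a : BB K} (h : a.IsWeightedHomogeneous (wx 4 4) 0) : ∃ t : TT K, a = rename Sum.inr t := by
  obtain ⟨q, hq⟩ := exists_rename_eq_of_vars_subset_range a (Sum.inr : Fin 4 → Fin 4 ⊕ Fin 4) Sum.inr_injective (by
    intro i hi
    rcases i with i | i
    · exfalso
      obtain ⟨e, he, hie⟩ := (mem_vars_iff_mem_support _).1 (Finset.mem_coe.1 hi)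
      have := h (mem_support_iff.1 he)
      rw [Finsupp.weight_apply, Finsupp.sum, Finset.sum_eq_zero_iff] at this
      have := this _ hie
      simp [wx] at this
      exact (Finsupp.mem_support_iff.1 hie) this
    · exact ⟨i, rfl⟩)
  exact ⟨q, hq.symm⟩

lemma span_vx : Ideal.span (Set.range (vx K)) = Ideal.span (X '' (Set.range (Sum.inl : Fin 4 → Fin 4 ⊕ Fin 4)) : Set (BB K)) := by
  rw [← Set.range_comp]; rfl

lemma mem_vx_of_hom {a : BB K} {m : ℕ} (h : a.IsWeightedHomogeneous (wx 4 4) m) (hm : m ≠ 0) :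
    a ∈ Ideal.span (Set.range (vx K)) := by
  rw [span_vx, mem_ideal_span_X_image]
  intro e he
  by_contra hc
  push Not at hc
  apply hm
  rw [← h (mem_support_iff.1 he), Finsupp.weight_apply, Finsupp.sum]
  refine Finset.sum_eq_zero fun i _ => ?_
  rcases i with i | i
  · rw [hc _ ⟨i, rfl⟩]; simp
  · simp [wx]

lemma eR_mem_vx {t : TT K} (h : (rename Sum.inr t : BB K) ∈ Ideal.span (Set.range (vx K))) : t = 0 := by
  let π : BB K →ₐ[K] TT K := aeval (Sum.elim (fun _ => 0) X)
  have h1 : Ideal.span (Set.range (vx K)) ≤ RingHom.ker π := by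
    rw [Ideal.span_le]
    rintro _ ⟨i, rfl⟩
    simp [π, RingHom.mem_ker]
  have := h1 h
  rw [RingHom.mem_ker] at this
  rw [← this]
  simp only [π, aeval_rename]
  exact (aeval_X_left_apply t).symm

lemma hom_D4 {σ W : Type} [AddCommMonoid W] (w : σ → W) (r : Fin 4 → Fin 4 → MvPolynomial σ K) (p : Fin 4 → W)
    (h : ∀ i j, (r i j).IsWeightedHomogeneous w (p i)) :
    (D4 (r 0) (r 1) (r 2) (r 3)).IsWeightedHomogeneous w (p 0 + p 1 + p 2 + p 3) := by
  have e : (Matrix.of ![r 0, r 1, r 2, r 3]) = Matrix.of r := by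
    ext i j; fin_cases i <;> rfl
  rw [D4, e, Matrix.det_apply]
  refine IsWeightedHomogeneous.sum _ _ _ fun τ _ => ?_
  have : (∏ i, (Matrix.of r) (τ i) i).IsWeightedHomogeneous w (∑ i, p (τ i)) :=
    IsWeightedHomogeneous.prod _ _ _ fun i _ => h _ _
  rw [Equiv.sum_comp τ p, Fin.sum_univ_four] at this
  rcases Int.units_eq_one_or (Equiv.Perm.sign τ) with hs | hs
  · rw [hs, one_smul]; exact this
  · rw [hs, Units.neg_smul, one_smul]; exact this.neg

lemma hom_mulVec {σ W : Type} [AddCommMonoid W] (w : σ → W) (M : Matrix (Fin 4) (Fin 4) K) (v : Fin 4 → MvPolynomial σ K) (p : W)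
    (h : ∀ i, (v i).IsWeightedHomogeneous w p) (i : Fin 4) : ((M.map C).mulVec v i).IsWeightedHomogeneous w p := by
  refine IsWeightedHomogeneous.sum _ _ _ fun j _ => ?_
  exact (h j).C_mul _

lemma hom_hx (M : Matrix (Fin 4) (Fin 4) K) (i) : (hx M i).IsWeightedHomogeneous (bwt 4 4) (1, 0) :=
  hom_mulVec _ _ _ _ hom_x i
lemma hom_hy (M : Matrix (Fin 4) (Fin 4) K) (i) : (hy M i).IsWeightedHomogeneous (bwt 4 4) (0, 1) :=
  hom_mulVec _ _ _ _ hom_y i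
lemma hom_ly (M : Matrix (Fin 4) (Fin 4) K) (i) : (ly M i).IsHomogeneous 1 :=
  hom_mulVec _ _ _ _ (fun j => isHomogeneous_X K j) i
lemma hom_qf (M : Matrix (Fin 4) (Fin 4) K) : (qf M).IsWeightedHomogeneous (bwt 4 4) (2, 0) :=
  IsWeightedHomogeneous.sum _ _ _ fun j _ => (hom_x j).mul (hom_hx M j)
lemma hom_bl (M : Matrix (Fin 4) (Fin 4) K) : (bl M).IsWeightedHomogeneous (bwt 4 4) (1, 1) := by
  refine IsWeightedHomogeneous.sum _ _ _ fun j _ => ?_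
  exact (hom_y j).mul (hom_hx M j)
lemma hom_Det (M N : Matrix (Fin 4) (Fin 4) K) : (Det M N).IsWeightedHomogeneous (bwt 4 4) (2, 2) :=
  hom_D4 (bwt 4 4) ![hy M, hy N, hx M, hx N] ![(0,1), (0,1), (1,0), (1,0)] (by
    intro i j; fin_cases i
    · exact hom_hy M j
    · exact hom_hy N j
    · exact hom_hx M j
    · exact hom_hx N j)
lemma hy_eq (M : Matrix (Fin 4) (Fin 4) K) : hy M = fun i => (rename Sum.inr (ly M i) : BB K) := by
  funext i; simp [hy, ly, Matrix.mulVec, dotProduct]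

lemma cmp_LL (M N : Matrix (Fin 4) (Fin 4) K) {a : BB K} (ha : a ∈ LL M N) (m : ℕ) : cmp m a ∈ LL M N := by
  have key : ∀ q ∈ ({qf M, qf N, bl M, bl N} : Set (BB K)), ∀ r, cmp m (r * q) ∈ LL M N := by
    intro q hq r
    have hqL : q ∈ LL M N := Ideal.subset_span hq
    obtain ⟨i, hi⟩ : ∃ i, q.IsWeightedHomogeneous (wx 4 4) i := by
      rcases hq with rfl | rfl | rfl | rfl
      exacts [⟨_, hom_fst (hom_qf _)⟩, ⟨_, hom_fst (hom_qf _)⟩, ⟨_, hom_fst (hom_bl _)⟩, ⟨_, hom_fst (hom_bl _)⟩]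
    rw [cmp_mul _ _ _ hi]
    split_ifs
    · exact Ideal.mul_mem_left _ _ hqL
    · exact zero_mem _
  rw [LL, mem_span4] at ha
  obtain ⟨r1, r2, r3, r4, rfl⟩ := ha
  simp only [map_add]
  exact add_mem (add_mem (add_mem (key _ (by simp) _) (key _ (by simp) _)) (key _ (by simp) _)) (key _ (by simp) _)

/-- killed by `N`-fold products of the `x_i` modulo `L` -/
def JN (L : Ideal (BB K)) : ℕ → BB K → Prop
  | 0, a => a ∈ L
  | m + 1, a => ∀ i, JN L m (vx K i * a)

lemma JN_mul (L : Ideal (BB K)) (m : ℕ) : ∀ a b, JN L m a → JN L m (b * a) := by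
  induction m with
  | zero => exact fun a b h => Ideal.mul_mem_left _ _ h
  | succ m ih => 
    intro a b h i
    rw [mul_left_comm]
    exact ih _ _ (h i)

lemma JN_iff (L : Ideal (BB K)) (m : ℕ) : ∀ a, JN L m a ↔ ∀ b ∈ mxB K 4 4 ^ m, b * a ∈ L := by
  induction m with
  | zero => 
    intro a
    simp only [pow_zero, Ideal.one_eq_top, Submodule.mem_top, true_imp_iff, JN]
    exact ⟨fun h b => Ideal.mul_mem_left _ _ h, fun h => by simpa using h 1⟩
  | succ m ih =>
    intro a
    simp only [JN, ih]
    constructor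
    · intro h b hb
      rw [pow_succ] at hb
      refine Submodule.mul_induction_on hb ?_ ?_
      · intro u hu v hv
        rw [mxB] at hv
        refine Submodule.span_induction (p := fun v _ => u * v * a ∈ L) ?_ ?_ ?_ ?_ hv
        · rintro _ ⟨i, rfl⟩
          have := h i u hu
          rwa [← mul_assoc] at this
        · simp
        · intro x y _ _ h1 h2
          rw [mul_add, add_mul]; exact add_mem h1 h2
        · intro c x _ h1
          have : u * c • x * a = c * (u * x * a) := by rw [smul_eq_mul]; ring
          rw [this]; exact Ideal.mul_mem_left _ _ h1
      · intro x y h1 h2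
        rw [add_mul]; exact add_mem h1 h2
    · intro h i b hb
      rw [← mul_assoc]
      apply h
      rw [pow_succ]
      exact Ideal.mul_mem_mul hb (Ideal.subset_span ⟨i, rfl⟩)

lemma mem_H0 (L : Ideal (BB K)) (a : BB K) : Ideal.Quotient.mk L a ∈ H0 K 4 4 L ↔ ∃ m, JN L m a := by
  rw [H0, Submodule.mem_iSup_of_directed]
  · refine exists_congr fun m => ?_
    rw [JN_iff, Submodule.mem_torsionBySet_iff]
    constructor
    · intro h b hb
      have := h ⟨b, hb⟩
      rw [← Ideal.Quotient.eq_zero_iff_mem]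
      exact this
    · rintro h ⟨b, hb⟩
      exact Ideal.Quotient.eq_zero_iff_mem.2 (h b hb)
  · refine Monotone.directed_le fun i j hij => ?_
    exact Submodule.torsionBySet_le_torsionBySet_of_subset (Ideal.pow_le_pow_right hij)

lemma JN_cmp (M N : Matrix (Fin 4) (Fin 4) K) (m : ℕ) : ∀ a j, JN (LL M N) m a → JN (LL M N) m (cmp j a) := by
  induction m with
  | zero => exact fun a j h => cmp_LL M N h j
  | succ m ih =>
    intro a j h i
    have := ih _ (j + 1) (h i)
    rw [mul_comm, cmp_mul _ _ 1 (hom_fst (hom_x i)), if_pos (by omega), mul_comm, Nat.add_sub_cancel] at this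
    exact this

lemma smul_mk (L : Ideal (BB K)) (t : TT K) (a : BB K) :
   (show T K 4 from t) • (Ideal.Quotient.mk L a : B K 4 4 ⧸ L) = Ideal.Quotient.mk L (rename Sum.inr t * a) := rfl

lemma mem_SxDeg (L : Ideal (BB K)) (j : ℕ) (z : B K 4 4 ⧸ L) :
    z ∈ SxDeg K 4 4 L j ↔ ∃ a : BB K, a.IsWeightedHomogeneous (wx 4 4) j ∧ z = Ideal.Quotient.mk L a := by
  constructor
  · intro h
    refine Submodule.span_induction ?_ ?_ ?_ ?_ h
    · rintro _ ⟨a, ha, rfl⟩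
      exact ⟨a, ha, rfl⟩
    · exact ⟨0, isWeightedHomogeneous_zero _ _ _, by simp⟩
    · rintro _ _ _ _ ⟨a, ha, rfl⟩ ⟨b, hb, rfl⟩
      exact ⟨a + b, ha.add hb, by simp⟩
    · rintro t _ _ ⟨a, ha, rfl⟩
      refine ⟨rename Sum.inr t * a, ?_, smul_mk L t a⟩
      simpa using (hom0_eR t).mul ha
  · rintro ⟨a, ha, rfl⟩
    exact Submodule.subset_span ⟨a, ha, rfl⟩

lemma mem_Acomp (L : Ideal (BB K)) (j : ℕ) (z : B K 4 4 ⧸ L) :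
    z ∈ AcompZ K 4 4 L (j : ℤ) ↔ ∃ a : BB K, a.IsWeightedHomogeneous (wx 4 4) j ∧ (∃ m, JN L m a) ∧ z = Ideal.Quotient.mk L a := by
  rw [AcompZ, Submodule.mem_inf, SxDegZ, if_pos (by omega), Int.toNat_natCast, mem_SxDeg, Submodule.restrictScalars_mem]
  constructor
  · rintro ⟨h, a, ha, rfl⟩
    exact ⟨a, ha, (mem_H0 L a).1 h, rfl⟩
  · rintro ⟨a, ha, h, rfl⟩
    exact ⟨(mem_H0 L a).2 h, a, ha, rfl⟩

end homog

/-! Part 13 -/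

section levels
variable {K : Type} [Field K] {M N : Matrix (Fin 4) (Fin 4) K}

/-- the inclusion of `T` in `B` -/
abbrev eR : TT K →ₐ[K] BB K := rename Sum.inr

lemma hy_dot (hM : M.transpose = M) : dotProduct (hy M) (vx K) = bl M := by
  rw [hy, bl, hx, dot_symm _ (by rw [← Matrix.transpose_map, hM]), dotProduct_comm]
lemma hx_dot : dotProduct (hx M) (vx K) = qf M := by
  rw [qf, dotProduct_comm]
lemma qf_mem1 : qf M ∈ LL M N := Ideal.subset_span (by simp)
lemma qf_mem2 : qf N ∈ LL M N := Ideal.subset_span (by simp)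
lemma bl_mem1 : bl M ∈ LL M N := Ideal.subset_span (by simp)
lemma bl_mem2 : bl N ∈ LL M N := Ideal.subset_span (by simp)

lemma x_Det (hM : M.transpose = M) (hN : N.transpose = N) (i : Fin 4) : vx K i * Det M N ∈ LL M N := by
  change vx K i * D4 (hy M) (hy N) (hx M) (hx N) ∈ _
  rw [D4_cramer, hy_dot hM, hy_dot hN, hx_dot, hx_dot]
  exact add_mem (add_mem (add_mem (Ideal.mul_mem_right _ _ bl_mem1) (Ideal.mul_mem_right _ _ bl_mem2))
    (Ideal.mul_mem_right _ _ qf_mem1)) (Ideal.mul_mem_right _ _ qf_mem2)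

lemma vx_Det (hM : M.transpose = M) (hN : N.transpose = N) {a : BB K} (ha : a ∈ Ideal.span (Set.range (vx K))) :
    a * Det M N ∈ LL M N := by
  refine Submodule.span_induction (p := fun v _ => v * Det M N ∈ LL M N) ?_ ?_ ?_ ?_ ha
  · rintro _ ⟨i, rfl⟩; exact x_Det hM hN i
  · simp
  · intro x y _ _ h1 h2
    rw [add_mul]; exact add_mem h1 h2
  · intro c x _ h1
    rw [smul_eq_mul, mul_assoc]; exact Ideal.mul_mem_left _ _ h1

/-- the linear form giving equations of bidegree `(1,*)` -/
def apL (M N : Matrix (Fin 4) (Fin 4) K) : (Fin 4 → BB K) →ₗ[BB K] BB K :=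
  (D2 (hy M) (hy N) (hx M)) ∘ₗ (N.map C).mulVecLin + ((D2 (hy M) (hy N)).flip (hx N)) ∘ₗ (M.map C).mulVecLin

lemma apL_apply (t : Fin 4 → BB K) : apL M N t = D4 (hy M) (hy N) (hx M) ((N.map C).mulVec t)
   + D4 (hy M) (hy N) ((M.map C).mulVec t) (hx N) := rfl

/-- the equation of bidegree `(1,*)` from `t` in the kernel -/
def ap (M N : Matrix (Fin 4) (Fin 4) K) (t : Fin 4 → TT K) : BB K := apL M N (fun i => eR (t i))

/-- the equation of bidegree `(0,*)` -/
def app (M N : Matrix (Fin 4) (Fin 4) K) (t : Matrix (Fin 4) (Fin 4) (TT K)) : BB K :=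
  ∑ i, ∑ j, eR (t i j) * D4 (hy M) (hy N) ((M.map C).mulVec (Pi.single i 1)) ((N.map C).mulVec (Pi.single j 1))

lemma map_symm {A : Type} [CommRing A] (f : K → A) (hM : M.transpose = M) : (M.map f).transpose = M.map f := by
  rw [← Matrix.transpose_map, hM]

lemma eR_dot (t : Fin 4 → TT K) (ht : dotProduct t (ly M) = 0) : dotProduct (hy M) (fun i => (eR (t i) : BB K)) = 0 := by
  rw [hy_eq, dotProduct]
  have := congrArg (eR : TT K → BB K) ht
  simp only [dotProduct, map_sum, map_mul, map_zero] at this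
  rw [← this]
  exact Finset.sum_congr rfl fun i _ => mul_comm _ _

lemma x_ap (hM : M.transpose = M) (hN : N.transpose = N) (t : Fin 4 → TT K)
   (h1 : dotProduct t (ly M) = 0) (h2 : dotProduct t (ly N) = 0) (i : Fin 4) :
    vx K i * ap M N t - eR (t i) * Det M N ∈ LL M N := by
  refine morley1 (LL M N) (hy M) (hy N) (vx K) (fun i => eR (t i)) (M.map C) (N.map C) (map_symm _ hM) (map_symm _ hN) ?_ ?_ ?_ ?_
    (eR_dot t h1) (eR_dot t h2) i
  · rw [hy_dot hM]; exact bl_mem1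
  · rw [hy_dot hN]; exact bl_mem2
  · change dotProduct (hx M) _ ∈ _
    rw [hx_dot]; exact qf_mem1
  · change dotProduct (hx N) _ ∈ _
    rw [hx_dot]; exact qf_mem2

lemma eR_tr (H : Matrix (Fin 4) (Fin 4) K) (t : Matrix (Fin 4) (Fin 4) (TT K)) (d : (H.map C * t).trace = 0) :
    (H.map C * t.map (eR : TT K → BB K)).trace = 0 := by
  have := congrArg (eR : TT K → BB K) d
  simp only [Matrix.trace, Matrix.diag, Matrix.mul_apply, map_sum, map_mul, map_zero, Matrix.map_apply, rename_C] at this ⊢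
  exact this

lemma eR_mv (t : Matrix (Fin 4) (Fin 4) (TT K)) (d : t.mulVec (ly M) = 0) : (t.map (eR : TT K → BB K)).mulVec (hy M) = 0 := by
  funext i
  have := congrArg (eR : TT K → BB K) (congrFun d i)
  simp only [Matrix.mulVec, dotProduct, map_sum, map_mul, Pi.zero_apply, map_zero] at this
  simp only [hy_eq, Matrix.mulVec, dotProduct, Matrix.map_apply, Pi.zero_apply]
  exact this

lemma x_app (hM : M.transpose = M) (hN : N.transpose = N) (t : Matrix (Fin 4) (Fin 4) (TT K))
   (h : Sol M N t) (l : Fin 4) :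
    vx K l * app M N t - ap M N (t l) ∈ LL M N := by
  refine morley2 (LL M N) (hy M) (hy N) (vx K) (t.map (eR : TT K → BB K)) (M.map C) (N.map C) (map_symm _ hM) (map_symm _ hN)
    (by rw [← Matrix.transpose_map, h.symm]) ?_ ?_ (eR_mv t h.e1) (eR_mv t h.e2) (eR_tr M t h.d1) (eR_tr N t h.d2) l
  · rw [hy_dot hM]; exact bl_mem1
  · rw [hy_dot hN]; exact bl_mem2

lemma hom_ap (t : Fin 4 → TT K) (m : ℕ) (ht : ∀ i, (t i).IsHomogeneous m) :
    (ap M N t).IsWeightedHomogeneous (bwt 4 4) (1, m + 2) := by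
  rw [ap, apL_apply]
  have e : ∀ (H : Matrix (Fin 4) (Fin 4) K) j, ((H.map C).mulVec (fun i => (eR (t i) : BB K)) j).IsWeightedHomogeneous (bwt 4 4) (0, m) :=
    fun H j => hom_mulVec _ _ _ _ (fun i => hom_eR (ht i)) j
  refine IsWeightedHomogeneous.add ?_ ?_
  · have := hom_D4 (bwt 4 4) ![hy M, hy N, hx M, (N.map C).mulVec (fun i => (eR (t i) : BB K))] ![(0,1), (0,1), (1,0), (0,m)] (by
      intro i j; fin_cases i
      · exact hom_hy M j
      · exact hom_hy N j
      · exact hom_hx M j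
      · exact e N j)
    have e2 : ((0,1) + (0,1) + (1,0) + (0,m) : ℕ × ℕ) = (1, m+2) := by ext <;> simp <;> omega
    rw [← e2]; exact this
  · have := hom_D4 (bwt 4 4) ![hy M, hy N, (M.map C).mulVec (fun i => (eR (t i) : BB K)), hx N] ![(0,1), (0,1), (0,m), (1,0)] (by
      intro i j; fin_cases i
      · exact hom_hy M j
      · exact hom_hy N j
      · exact e M j
      · exact hom_hx N j)
    have e2 : ((0,1) + (0,1) + (0,m) + (1,0) : ℕ × ℕ) = (1, m+2) := by ext <;> simp <;> omega
    rw [← e2]; exact this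

lemma homx_ap (t : Fin 4 → TT K) : (ap M N t).IsWeightedHomogeneous (wx 4 4) 1 := by
  rw [ap, apL_apply]
  have e : ∀ (H : Matrix (Fin 4) (Fin 4) K) j, ((H.map C).mulVec (fun i => (eR (t i) : BB K)) j).IsWeightedHomogeneous (wx 4 4) 0 :=
    fun H j => hom_mulVec _ _ _ _ (fun i => hom0_eR (t i)) j
  refine IsWeightedHomogeneous.add ?_ ?_
  · exact hom_D4 (wx 4 4) ![hy M, hy N, hx M, (N.map C).mulVec (fun i => (eR (t i) : BB K))] ![0,0,1,0] (by
      intro i j; fin_cases i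
      · exact hom_fst (hom_hy M j)
      · exact hom_fst (hom_hy N j)
      · exact hom_fst (hom_hx M j)
      · exact e N j)
  · exact hom_D4 (wx 4 4) ![hy M, hy N, (M.map C).mulVec (fun i => (eR (t i) : BB K)), hx N] ![0,0,0,1] (by
      intro i j; fin_cases i
      · exact hom_fst (hom_hy M j)
      · exact hom_fst (hom_hy N j)
      · exact e M j
      · exact hom_fst (hom_hx N j))

lemma hom_D0 (i j : Fin 4) : (D4 (hy M) (hy N) ((M.map C).mulVec (Pi.single i 1)) ((N.map C).mulVec (Pi.single j 1))).IsWeightedHomogeneous (bwt 4 4) (0, 2) := by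
  have e : ∀ (H : Matrix (Fin 4) (Fin 4) K) i j, ((H.map C).mulVec (Pi.single i 1) j : BB K).IsWeightedHomogeneous (bwt 4 4) (0, 0) := by
    intro H i j
    rw [Matrix.mulVec_single_one]
    exact isWeightedHomogeneous_C _ _
  exact hom_D4 (bwt 4 4) ![hy M, hy N, (M.map C).mulVec (Pi.single i 1), (N.map C).mulVec (Pi.single j 1)] ![(0,1), (0,1), (0,0), (0,0)] (by
      intro i j; fin_cases i
      · exact hom_hy M j
      · exact hom_hy N j
      · exact e M _ j
      · exact e N _ j)

lemma hom_app (t : Matrix (Fin 4) (Fin 4) (TT K)) (m : ℕ) (ht : ∀ i j, (t i j).IsHomogeneous m) :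
    (app M N t).IsWeightedHomogeneous (bwt 4 4) (0, m + 2) :=
  IsWeightedHomogeneous.sum _ _ _ fun i _ => IsWeightedHomogeneous.sum _ _ _ fun j _ => (hom_eR (ht i j)).mul (hom_D0 i j)

lemma homx_app (t : Matrix (Fin 4) (Fin 4) (TT K)) :
    (app M N t).IsWeightedHomogeneous (wx 4 4) 0 :=
  IsWeightedHomogeneous.sum _ _ _ fun i _ => IsWeightedHomogeneous.sum _ _ _ fun j _ => (hom0_eR (t i j)).mul (hom_fst (hom_D0 i j))

lemma app_smul (s : TT K) (t φ : Matrix (Fin 4) (Fin 4) (TT K)) (h : ∀ i j, t i j = s * φ i j) :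
    app M N t = eR s * app M N φ := by
  simp only [app, Finset.mul_sum, h, map_mul, mul_assoc]

lemma ap_cr (v : Fin 4 → TT K) : ap M N (cr M N v) = ∑ l, eR (v l) * ap M N (cr M N (Pi.single l 1)) := by
  have : (fun i => (eR (cr M N v i) : BB K)) = ∑ l, eR (v l) • (fun i => (eR (cr M N (Pi.single l 1) i) : BB K)) := by
    funext i
    rw [cr_lin]
    simp [mul_comm, Finset.sum_apply]
  rw [ap, this, map_sum]
  exact Finset.sum_congr rfl fun l _ => map_smul _ _ _

lemma cr_dot (v : Fin 4 → TT K) : dotProduct (cr M N v) (ly M) = 0 ∧ dotProduct (cr M N v) (ly N) = 0 := by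
  simp only [cr, det_rows, dotProduct, Fin.sum_univ_four]
  constructor <;> simp <;> ring

lemma hom_cr (l i : Fin 4) : (cr M N (Pi.single l 1) i).IsHomogeneous 2 :=
  hom_D4 (1 : Fin 4 → ℕ) ![ly M, ly N, Pi.single l 1, Pi.single i 1] ![1, 1, 0, 0] (by
    have e : ∀ l j : Fin 4, ((Pi.single l 1 : Fin 4 → TT K) j).IsHomogeneous 0 := by
      intro l j
      by_cases h : j = l
      · subst h; simpa using isHomogeneous_one _ _
      · simpa [h] using isHomogeneous_zero _ _ _
    intro a j; fin_cases a
    · exact hom_ly M j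
    · exact hom_ly N j
    · exact e _ j
    · exact e _ j)


lemma soc_cmp (hG : Good M N) {a : BB K} {j : ℕ} (ha : a.IsWeightedHomogeneous (wx 4 4) j) (h : ∀ i, vx K i * a ∈ LL M N) :
    ∃ t : BB K, a - (if 2 ≤ j then cmp (j - 2) t * Det M N else 0) ∈ LL M N := by
  obtain ⟨t, ht⟩ := hG.soc a h
  refine ⟨t, ?_⟩
  have := cmp_LL M N ht j
  rwa [map_sub, cmp_same ha, cmp_mul _ _ 2 (hom_fst (hom_Det M N))] at this

lemma soc'_eR (hG : Good M N) (t : TT K) (h : eR t * Det M N ∈ LL M N) : t = 0 := eR_mem_vx (hG.soc' _ h)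

lemma hom_xmul {a : BB K} {j : ℕ} (ha : a.IsWeightedHomogeneous (wx 4 4) j) (i : Fin 4) :
    (vx K i * a).IsWeightedHomogeneous (wx 4 4) (j + 1) := by
  rw [mul_comm]; exact ha.mul (hom_fst (hom_x i))

lemma lvl3 (hG : Good M N) (hM : M.transpose = M) (hN : N.transpose = N) (m : ℕ) : ∀ (a : BB K) (j : ℕ), 3 ≤ j → a.IsWeightedHomogeneous (wx 4 4) j → JN (LL M N) m a → a ∈ LL M N := by
  induction m with
  | zero => exact fun a j _ _ h => h
  | succ m ih =>
    intro a j hj ha h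
    obtain ⟨t, ht⟩ := soc_cmp hG ha (fun i => ih _ (j + 1) (by omega) (hom_xmul ha i) (h i))
    rw [if_pos (by omega)] at ht
    have := vx_Det hM hN (mem_vx_of_hom (cmp_hom t (j - 2)) (by omega))
    simpa using add_mem ht this

lemma lvl2 (hG : Good M N) (hM : M.transpose = M) (hN : N.transpose = N) (m : ℕ) (a : BB K) (ha : a.IsWeightedHomogeneous (wx 4 4) 2) (h : JN (LL M N) m a) :
    ∃ t : TT K, a - eR t * Det M N ∈ LL M N := by
  obtain ⟨t, ht⟩ := soc_cmp hG ha (fun i => lvl3 hG hM hN m _ 3 le_rfl (hom_xmul ha i) (JN_mul _ _ _ _ h))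
  rw [if_pos le_rfl] at ht
  obtain ⟨u, hu⟩ := eR_of_hom0 (cmp_hom t 0)
  exact ⟨u, by rwa [← hu]⟩

lemma lvlS (hG : Good M N) {a : BB K} {j : ℕ} (hj : j < 2) (ha : a.IsWeightedHomogeneous (wx 4 4) j) (h : ∀ i, vx K i * a ∈ LL M N) : a ∈ LL M N := by
  obtain ⟨t, ht⟩ := soc_cmp hG ha h
  rwa [if_neg (by omega), sub_zero] at ht

lemma lin_aux {A : Type} [CommRing A] (c x t : Fin 4 → A) (D a : A) :
    (∑ i, t i * c i) * D = (∑ i, c i * x i) * a - ∑ i, c i * (x i * a - t i * D) := by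
  rw [Finset.sum_mul, Finset.sum_mul, ← Finset.sum_sub_distrib]
  exact Finset.sum_congr rfl fun i _ => by ring
lemma lin_aux2 {A : Type} [CommRing A] (c : Fin 4 → Fin 4 → A) (x : Fin 4 → A) (t : Fin 4 → Fin 4 → A) (D a : A) :
    (∑ i, ∑ j, c i j * t j i) * D = (∑ i, x i * ∑ j, c i j * x j) * a - ∑ i, ∑ j, c i j * (x i * (x j * a) - t j i * D) := by
  simp only [Finset.sum_mul, Finset.mul_sum, ← Finset.sum_sub_distrib]
  exact Finset.sum_congr rfl fun i _ => Finset.sum_congr rfl fun j _ => by ring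

lemma dot_aux (M' : Fin 4 → TT K) (t : Fin 4 → TT K) (a b : BB K) (hb : ∑ i, eR (M' i) * vx K i = b) (hbL : b ∈ LL M N)
    (ht : ∀ i, vx K i * a - eR (t i) * Det M N ∈ LL M N) : eR (dotProduct t M') * Det M N ∈ LL M N := by
  have h1 : ∑ i, eR (M' i) * (vx K i * a - eR (t i) * Det M N) ∈ LL M N :=
    sum_mem fun i _ => Ideal.mul_mem_left _ _ (ht i)
  have h2 := sub_mem (Ideal.mul_mem_right a _ hbL) h1
  convert h2 using 1
  rw [← hb]
  simp only [dotProduct, map_sum, map_mul]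
  exact lin_aux _ _ _ _ _

lemma lvl1' (hG : Good M N) (hM : M.transpose = M) (hN : N.transpose = N) (m : ℕ) (a : BB K) (ha : a.IsWeightedHomogeneous (wx 4 4) 1) (h : JN (LL M N) m a) :
    ∃ t : Fin 4 → TT K, dotProduct t (ly M) = 0 ∧ dotProduct t (ly N) = 0 ∧ ∀ i, vx K i * a - eR (t i) * Det M N ∈ LL M N := by
  have : ∀ i, ∃ t : TT K, vx K i * a - eR t * Det M N ∈ LL M N := fun i =>
    lvl2 hG hM hN m _ (hom_xmul ha i) (JN_mul _ _ _ _ h)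
  choose t ht using this
  refine ⟨t, soc'_eR hG _ (dot_aux (ly M) t a (bl M) ?_ bl_mem1 ht), soc'_eR hG _ (dot_aux (ly N) t a (bl N) ?_ bl_mem2 ht), ht⟩
  · rw [← hy_dot hM, hy_eq]; rfl
  · rw [← hy_dot hN, hy_eq]; rfl

lemma lvl1_ap (hG : Good M N) (hM : M.transpose = M) (hN : N.transpose = N) {t : Fin 4 → TT K} {a : BB K} (ha : a.IsWeightedHomogeneous (wx 4 4) 1)
   (h1 : dotProduct t (ly M) = 0) (h2 : dotProduct t (ly N) = 0) (ht : ∀ i, vx K i * a - eR (t i) * Det M N ∈ LL M N) :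
    a - ap M N t ∈ LL M N := by
  refine lvlS hG (by norm_num) (ha.sub (homx_ap t)) fun i => ?_
  have := sub_mem (ht i) (x_ap hM hN t h1 h2 i)
  convert this using 1
  ring

lemma lvl1 (hG : Good M N) (hM : M.transpose = M) (hN : N.transpose = N) (m : ℕ) (a : BB K) (ha : a.IsWeightedHomogeneous (wx 4 4) 1) (h : JN (LL M N) m a) :
    ∃ v : Fin 4 → TT K, a - ∑ l, eR (v l) * ap M N (cr M N (Pi.single l 1)) ∈ LL M N := by
  obtain ⟨t, h1, h2, ht⟩ := lvl1' hG hM hN m a ha h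
  obtain ⟨v, rfl⟩ := hG.ker t h1 h2
  refine ⟨v, ?_⟩
  rw [← ap_cr]
  exact lvl1_ap hG hM hN ha h1 h2 ht

lemma lvl0 (hG : Good M N) (hM : M.transpose = M) (hN : N.transpose = N) (m : ℕ) (a : BB K) (ha : a.IsWeightedHomogeneous (wx 4 4) 0) (h : JN (LL M N) m a) :
    ∃ t, Sol M N t ∧ a - app M N t ∈ LL M N := by
  have : ∀ i, ∃ t : Fin 4 → TT K, dotProduct t (ly M) = 0 ∧ dotProduct t (ly N) = 0 ∧
      ∀ j, vx K j * (vx K i * a) - eR (t j) * Det M N ∈ LL M N := fun i =>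
    lvl1' hG hM hN m _ (hom_xmul ha i) (JN_mul _ _ _ _ h)
  choose t h1 h2 ht using this
  have tr : ∀ H : Matrix (Fin 4) (Fin 4) K, qf H ∈ LL M N → (H.map C * Matrix.of t).trace = 0 := by
    intro H hH
    apply soc'_eR hG
    have e1 : ∑ i, ∑ j, C (H i j) * (vx K i * (vx K j * a) - eR (t j i) * Det M N) ∈ LL M N :=
      sum_mem fun i _ => sum_mem fun j _ => Ideal.mul_mem_left _ _ (ht j i)
    have e2 := sub_mem (Ideal.mul_mem_right a _ hH) e1
    convert e2 using 1
    simp only [qf, hx, dotProduct, Matrix.mulVec, Matrix.trace, Matrix.diag, Matrix.mul_apply, Matrix.map_apply, Matrix.of_apply,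
      map_sum, map_mul, rename_C]
    exact lin_aux2 (fun i j => C (H i j)) (vx K) (fun i j => eR (t i j)) _ _
  have hS : Sol M N (Matrix.of t) := by
    refine ⟨?_, ?_, ?_, tr M qf_mem1, tr N qf_mem2⟩
    · ext1 i j
      rw [Matrix.transpose_apply, Matrix.of_apply, Matrix.of_apply, ← sub_eq_zero]
      apply soc'_eR hG
      have := sub_mem (ht i j) (ht j i)
      convert this using 1
      rw [map_sub]; ring
    · funext i; exact h1 i
    · funext i; exact h2 i
  refine ⟨_, hS, ?_⟩
  refine lvlS hG (by norm_num) (ha.sub (homx_app _)) fun l => ?_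
  have := sub_mem (lvl1_ap hG hM hN (hom_xmul ha l) (h1 l) (h2 l) (ht l)) (x_app hM hN _ hS l)
  convert this using 1
  have : (Matrix.of t) l = t l := rfl
  rw [this]
  ring

lemma JN_Det (hM : M.transpose = M) (hN : N.transpose = N) : JN (LL M N) 1 (Det M N) := fun i => x_Det hM hN i

lemma JN_add {L : Ideal (BB K)} {m : ℕ} : ∀ {a b : BB K}, JN L m a → JN L m b → JN L m (a + b) := by
  induction m with
  | zero => exact fun h1 h2 => add_mem h1 h2
  | succ m ih =>
    intro a b h1 h2 i
    rw [mul_add]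
    exact ih (h1 i) (h2 i)
lemma JN_of_mem {L : Ideal (BB K)} {m : ℕ} : ∀ {a : BB K}, a ∈ L → JN L m a := by
  induction m with
  | zero => exact fun h => h
  | succ m ih => exact fun h i => ih (Ideal.mul_mem_left _ _ h)
lemma JN_congr {L : Ideal (BB K)} {m : ℕ} {a b : BB K} (h : a - b ∈ L) (hb : JN L m b) : JN L m a := by
  have := JN_add (JN_of_mem h) hb
  simpa using this

lemma JN_ap (hM : M.transpose = M) (hN : N.transpose = N) (t : Fin 4 → TT K) (h1 : dotProduct t (ly M) = 0) (h2 : dotProduct t (ly N) = 0) : JN (LL M N) 2 (ap M N t) :=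
  fun i => JN_congr (x_ap hM hN t h1 h2 i) (JN_mul _ _ _ _ (JN_Det hM hN))

lemma JN_app (hM : M.transpose = M) (hN : N.transpose = N) (t : Matrix (Fin 4) (Fin 4) (TT K)) (h : Sol M N t) : JN (LL M N) 3 (app M N t) :=
  fun i => JN_congr (x_app hM hN t h i) (JN_ap hM hN _ (congrFun h.e1 i) (congrFun h.e2 i))

end levels

/-! Part 14 -/

section gr
attribute [local instance] MvPolynomial.weightedGradedAlgebra
lemma hcmp_mul {K : Type} [Field K] (a b : TT K) (i : ℕ) (hb : b.IsHomogeneous i) :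
    homogeneousComponent i (b * a) = b * C (constantCoeff a) := by
  have hb' : b ∈ weightedHomogeneousSubmodule K (1 : Fin 4 → ℕ) i := hb
  have := DirectSum.coe_decompose_mul_of_left_mem_of_le (weightedHomogeneousSubmodule K (1 : Fin 4 → ℕ)) (b := a) hb' (le_refl i)
  erw [weightedDecomposition.decompose'_apply, weightedDecomposition.decompose'_apply] at this
  rw [Nat.sub_self] at this
  have h0 : weightedHomogeneousComponent (1 : Fin 4 → ℕ) 0 a = C (constantCoeff a) := homogeneousComponent_zero a
  rw [h0] at this
  exact this
end gr

section struct
variable {K : Type} [Field K] {M N : Matrix (Fin 4) (Fin 4) K}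

lemma A2_eq (hG : Good M N) (hM : M.transpose = M) (hN : N.transpose = N) : AcompZ K 4 4 (LL M N) 2 = Submodule.span (T K 4) {Ideal.Quotient.mk (LL M N) (Det M N)} := by
  ext z
  rw [Submodule.mem_span_singleton]
  have := mem_Acomp (LL M N) 2 z
  rw [Nat.cast_ofNat] at this
  rw [this]
  constructor
  · rintro ⟨a, ha, ⟨m, hm⟩, rfl⟩
    obtain ⟨t, ht⟩ := lvl2 hG hM hN m a ha hm
    exact ⟨t, (smul_mk _ _ _).trans (Ideal.Quotient.eq.2 ht).symm⟩
  · rintro ⟨t, rfl⟩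
    refine ⟨eR t * Det M N, ?_, ⟨1, JN_mul _ _ _ _ (JN_Det hM hN)⟩, smul_mk _ _ _⟩
    simpa using (hom0_eR t).mul (hom_fst (hom_Det M N))

/-- the four equations of bidegree `(1,4)` -/
def gEq (M N : Matrix (Fin 4) (Fin 4) K) (l : Fin 4) : BB K := ap M N (cr M N (Pi.single l 1))

lemma hom_gEq (l : Fin 4) : (gEq M N l).IsWeightedHomogeneous (bwt 4 4) (1, 4) := hom_ap _ 2 (hom_cr l)

lemma sum_smul_mk (L : Ideal (BB K)) (v : Fin 4 → TT K) (g : Fin 4 → BB K) :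
    ∑ l, (show T K 4 from v l) • (Ideal.Quotient.mk L (g l) : B K 4 4 ⧸ L) = Ideal.Quotient.mk L (∑ l, eR (v l) * g l) := by
  rw [map_sum]; rfl

lemma A1_mem (hG : Good M N) (hM : M.transpose = M) (hN : N.transpose = N) (z : B K 4 4 ⧸ LL M N) : z ∈ AcompZ K 4 4 (LL M N) 1 ↔
    ∃ v : Fin 4 → TT K, z = Ideal.Quotient.mk (LL M N) (∑ l, eR (v l) * gEq M N l) := by
  have := mem_Acomp (LL M N) 1 z
  rw [Nat.cast_one] at this
  rw [this]
  constructor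
  · rintro ⟨a, ha, ⟨m, hm⟩, rfl⟩
    obtain ⟨v, hv⟩ := lvl1 hG hM hN m a ha hm
    exact ⟨v, Ideal.Quotient.eq.2 hv⟩
  · rintro ⟨v, rfl⟩
    refine ⟨_, ?_, ⟨2, ?_⟩, rfl⟩
    · refine IsWeightedHomogeneous.sum _ _ _ fun l _ => ?_
      simpa using (hom0_eR (v l)).mul (hom_fst (hom_gEq (M := M) (N := N) l))
    · have := JN_ap hM hN (cr M N v) (cr_dot v).1 (cr_dot v).2
      rwa [ap_cr] at this

lemma A1_eq (hG : Good M N) (hM : M.transpose = M) (hN : N.transpose = N) : AcompZ K 4 4 (LL M N) 1 =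
    Submodule.span (T K 4) (Set.range fun l => Ideal.Quotient.mk (LL M N) (gEq M N l)) := by
  ext z
  rw [A1_mem hG hM hN, Submodule.mem_span_range_iff_exists_fun]
  constructor
  · rintro ⟨v, rfl⟩
    exact ⟨v, sum_smul_mk _ _ _⟩
  · rintro ⟨v, rfl⟩
    exact ⟨v, sum_smul_mk _ _ _⟩

lemma rel_const (hG : Good M N) (hM : M.transpose = M) (hN : N.transpose = N) (r : Fin 4 → TT K) (h : ∑ l, eR (r l) * gEq M N l ∈ LL M N) (l : Fin 4) : constantCoeff (r l) = 0 := by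
  have h1 : ap M N (cr M N r) ∈ LL M N := by rw [ap_cr]; exact h
  have h2 : ∀ i, cr M N r i = 0 := by
    intro i
    apply soc'_eR hG
    have := sub_mem (Ideal.mul_mem_left _ (vx K i) h1) (x_ap hM hN (cr M N r) (cr_dot r).1 (cr_dot r).2 i)
    simpa using this
  have h3 : cr M N (fun i => C (constantCoeff (r i))) = 0 := by
    funext i
    have := congrArg (homogeneousComponent 2) (h2 i)
    rw [cr_lin, map_sum, map_zero] at this
    rw [cr_lin, Pi.zero_apply, ← this]
    exact Finset.sum_congr rfl fun j _ => (hcmp_mul _ _ _ (hom_cr j i)).symm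
  exact congrFun (hG.kerc _ h3) l

lemma A1_min (hG : Good M N) (hM : M.transpose = M) (hN : N.transpose = N) (s : Finset (B K 4 4 ⧸ LL M N)) (hs : Submodule.span (T K 4) (s : Set (B K 4 4 ⧸ LL M N)) = AcompZ K 4 4 (LL M N) 1) :
    4 ≤ s.card := by
  have h1 : ∀ w : s, ∃ v : Fin 4 → TT K, (w : B K 4 4 ⧸ LL M N) = Ideal.Quotient.mk (LL M N) (∑ l, eR (v l) * gEq M N l) := by
    intro w
    rw [← A1_mem hG hM hN, ← hs]
    exact Submodule.subset_span w.2
  choose U hU using h1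
  have h2 : ∀ l, ∃ c : s → TT K, Ideal.Quotient.mk (LL M N) (gEq M N l) = Ideal.Quotient.mk (LL M N) (∑ w, eR (c w) * ∑ m, eR (U w m) * gEq M N m) := by
    intro l
    have : (Ideal.Quotient.mk (LL M N) (gEq M N l) : B K 4 4 ⧸ LL M N) ∈ Submodule.span (T K 4) (Set.range fun w : s => (w : B K 4 4 ⧸ LL M N)) := by
      have e : (Set.range fun w : s => (w : B K 4 4 ⧸ LL M N)) = s := Subtype.range_coe
      rw [e, hs, A1_eq hG hM hN]
      exact Submodule.subset_span ⟨l, rfl⟩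
    rw [Submodule.mem_span_range_iff_exists_fun] at this
    obtain ⟨c, hc⟩ := this
    refine ⟨c, hc.symm.trans ?_⟩
    rw [map_sum]
    refine Finset.sum_congr rfl fun w _ => ?_
    conv_lhs => rw [hU w]
    exact smul_mk _ _ _
  choose c hc using h2
  have h3 : ∀ l m, (if l = m then 1 else 0) - ∑ w, constantCoeff (c l w) * constantCoeff (U w m) = 0 := by
    intro l m
    have := rel_const hG hM hN (fun m => (if l = m then 1 else 0) - ∑ w, c l w * U w m) (by
      have := Ideal.Quotient.eq.1 (hc l)
      convert this using 1
      simp only [map_sub, sub_mul, Finset.sum_sub_distrib, map_sum, map_mul, Finset.sum_mul, Finset.mul_sum]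
      congr 1
      · rw [Finset.sum_eq_single l]
        · simp
        · intro b _ hb; rw [if_neg (Ne.symm hb)]; simp
        · simp
      · rw [Finset.sum_comm]
        exact Finset.sum_congr rfl fun i _ => Finset.sum_congr rfl fun j _ => mul_assoc _ _ _) m
    rw [map_sub, map_sum] at this
    refine Eq.trans ?_ this
    congr 1
    · split_ifs
      · exact (map_one constantCoeff).symm
      · exact (map_zero constantCoeff).symm
    · exact Finset.sum_congr rfl fun w _ => (map_mul _ _ _).symm
  let P : Matrix (Fin 4) s K := Matrix.of fun l w => constantCoeff (c l w)
  let Q : Matrix s (Fin 4) K := Matrix.of fun w m => constantCoeff (U w m)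
  have h4 : P * Q = 1 := by
    ext l m
    rw [Matrix.mul_apply, Matrix.one_apply]
    exact (sub_eq_zero.1 (h3 l m)).symm
  have h5 := Matrix.rank_mul_le_left P Q
  rw [h4, Matrix.rank_one, Fintype.card_fin] at h5
  have := h5.trans (Matrix.rank_le_card_width P)
  simpa using this

lemma A0_eq (hG : Good M N) (hM : M.transpose = M) (hN : N.transpose = N) (φ : Matrix (Fin 4) (Fin 4) (TT K)) (hφ : Sol M N φ) (h : ∀ t, Sol M N t → ∃ s, ∀ i j, t i j = s * φ i j) :
    AcompZ K 4 4 (LL M N) 0 = Submodule.span (T K 4) {Ideal.Quotient.mk (LL M N) (app M N φ)} := by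
  ext z
  rw [Submodule.mem_span_singleton]
  have := mem_Acomp (LL M N) 0 z
  rw [Nat.cast_zero] at this
  rw [this]
  constructor
  · rintro ⟨a, ha, ⟨m, hm⟩, rfl⟩
    obtain ⟨t, hS, ht⟩ := lvl0 hG hM hN m a ha hm
    obtain ⟨s, hs⟩ := h t hS
    rw [app_smul s t φ hs] at ht
    exact ⟨s, (smul_mk _ _ _).trans (Ideal.Quotient.eq.2 ht).symm⟩
  · rintro ⟨t, rfl⟩
    refine ⟨eR t * app M N φ, ?_, ⟨3, JN_mul _ _ _ _ (JN_app hM hN φ hφ)⟩, smul_mk _ _ _⟩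
    simpa using (hom0_eR t).mul (homx_app (M := M) (N := N) φ)

/-- the ten generators -/
def gJJ (M N : Matrix (Fin 4) (Fin 4) K) (φ : Matrix (Fin 4) (Fin 4) (TT K)) : Fin 10 → BB K :=
  ![qf M, qf N, bl M, bl N, Det M N, gEq M N 0, gEq M N 1, gEq M N 2, gEq M N 3, app M N φ]

lemma JN_gJJ (hG : Good M N) (hM : M.transpose = M) (hN : N.transpose = N) (φ : Matrix (Fin 4) (Fin 4) (TT K)) (hφ : Sol M N φ) (h : ∀ t, Sol M N t → ∃ s, ∀ i j, t i j = s * φ i j) (a : BB K) :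
    (∃ m, JN (LL M N) m a) ↔ a ∈ Ideal.span (Set.range (gJJ M N φ)) := by
  have hgE : ∀ l, ∃ m, JN (LL M N) m (gEq M N l) := fun l => ⟨2, JN_ap hM hN _ (cr_dot _).1 (cr_dot _).2⟩
  have hLJ : LL M N ≤ Ideal.span (Set.range (gJJ M N φ)) := by
    refine Ideal.span_mono ?_
    rintro _ (rfl | rfl | rfl | rfl)
    exacts [⟨0, rfl⟩, ⟨1, rfl⟩, ⟨2, rfl⟩, ⟨3, rfl⟩]
  have mm : ∀ i, gJJ M N φ i ∈ Ideal.span (Set.range (gJJ M N φ)) := fun i => Ideal.subset_span ⟨i, rfl⟩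
  have mE : ∀ l, gEq M N l ∈ Ideal.span (Set.range (gJJ M N φ)) := by
    intro l; fin_cases l
    exacts [mm 5, mm 6, mm 7, mm 8]
  constructor
  · rintro ⟨m, hm⟩
    have key : ∀ j, cmp j a ∈ Ideal.span (Set.range (gJJ M N φ)) := by
      intro j
      have hj := JN_cmp M N m a j hm
      have hh := cmp_hom a j
      rcases j with _ | _ | _ | j
      · obtain ⟨t, hS, ht⟩ := lvl0 hG hM hN m _ hh hj
        obtain ⟨s, hs⟩ := h t hS
        rw [app_smul s t φ hs] at ht
        have := add_mem (hLJ ht) (Ideal.mul_mem_left _ (eR s) (mm 9))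
        change _ - _ + _ * app M N φ ∈ _ at this
        rwa [sub_add_cancel] at this
      · obtain ⟨v, hv⟩ := lvl1 hG hM hN m _ hh hj
        have h2 : ∑ l, eR (v l) * gEq M N l ∈ Ideal.span (Set.range (gJJ M N φ)) := 
          sum_mem fun l _ => Ideal.mul_mem_left _ _ (mE l)
        have := add_mem (hLJ hv) h2
        unfold gEq at this
        rwa [sub_add_cancel] at this
      · obtain ⟨t, ht⟩ := lvl2 hG hM hN m _ hh hj
        have := add_mem (hLJ ht) (Ideal.mul_mem_left _ (eR t) (mm 4))
        change _ - _ + _ * Det M N ∈ _ at this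
        rwa [sub_add_cancel] at this
      · exact hLJ (lvl3 hG hM hN m _ _ (by omega) hh hj)
    rw [← finsum_weightedHomogeneousComponent (wx 4 4) a]
    exact finsum_induction (· ∈ Ideal.span (Set.range (gJJ M N φ))) (zero_mem _) (fun _ _ h1 h2 => add_mem h1 h2) key
  · intro ha
    have e : ∀ b ∈ Ideal.span (Set.range (gJJ M N φ)), Ideal.Quotient.mk (LL M N) b ∈ H0 K 4 4 (LL M N) := by
      have : Ideal.span (Set.range (gJJ M N φ)) ≤ Submodule.comap (Ideal.Quotient.mkₐ (B K 4 4) (LL M N)).toLinearMap (H0 K 4 4 (LL M N)) := by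
        rw [Ideal.span_le]
        rintro _ ⟨i, rfl⟩
        refine (mem_H0 _ _).2 ?_
        fin_cases i
        exacts [⟨0, qf_mem1⟩, ⟨0, qf_mem2⟩, ⟨0, bl_mem1⟩, ⟨0, bl_mem2⟩, ⟨1, JN_Det hM hN⟩, hgE 0, hgE 1, hgE 2, hgE 3, ⟨3, JN_app hM hN φ hφ⟩]
      exact fun b hb => this hb
    exact (mem_H0 _ _).1 (e a ha)

lemma J_eq (hG : Good M N) (hM : M.transpose = M) (hN : N.transpose = N) (φ : Matrix (Fin 4) (Fin 4) (TT K)) (hφ : Sol M N φ) (h : ∀ t, Sol M N t → ∃ s, ∀ i j, t i j = s * φ i j) :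
    Submodule.comap (Ideal.Quotient.mkₐ (B K 4 4) (LL M N)).toLinearMap (H0 K 4 4 (LL M N)) = Ideal.span (Set.range (gJJ M N φ)) := by
  ext a
  rw [← JN_gJJ hG hM hN φ hφ h, ← mem_H0]
  rfl

lemma vec10 {α : Type} (P : α → Prop) (a0 a1 a2 a3 a4 a5 a6 a7 a8 a9 : α) (h0 : P a0) (h1 : P a1) (h2 : P a2) (h3 : P a3) (h4 : P a4)
   (h5 : P a5) (h6 : P a6) (h7 : P a7) (h8 : P a8) (h9 : P a9) (i : Fin 10) : P ((![a0, a1, a2, a3, a4, a5, a6, a7, a8, a9] : Fin 10 → α) i) := by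
  fin_cases i <;> assumption
lemma vec6 {α : Type} (P : α → Prop) (a0 a1 a2 a3 a4 a5 : α) (h0 : P a0) (h1 : P a1) (h2 : P a2) (h3 : P a3) (h4 : P a4)
   (h5 : P a5) (i : Fin 6) : P ((![a0, a1, a2, a3, a4, a5] : Fin 6 → α) i) := by
  fin_cases i <;> assumption

/-- the six generators -/
def gH (M N : Matrix (Fin 4) (Fin 4) K) (φ : Matrix (Fin 4) (Fin 4) (TT K)) : Fin 6 → B K 4 4 ⧸ LL M N :=
  fun i => Ideal.Quotient.mk (LL M N) ((![Det M N, gEq M N 0, gEq M N 1, gEq M N 2, gEq M N 3, app M N φ] : Fin 6 → BB K) i)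

lemma H0_eq (hG : Good M N) (hM : M.transpose = M) (hN : N.transpose = N) (φ : Matrix (Fin 4) (Fin 4) (TT K)) (hφ : Sol M N φ) (h : ∀ t, Sol M N t → ∃ s, ∀ i j, t i j = s * φ i j) :
    H0 K 4 4 (LL M N) = Submodule.span (B K 4 4) (Set.range (gH M N φ)) := by
  have mm : ∀ i, gH M N φ i ∈ Submodule.span (B K 4 4) (Set.range (gH M N φ)) := fun i => Submodule.subset_span ⟨i, rfl⟩
  have hJ := J_eq hG hM hN φ hφ h
  have z : ∀ b ∈ LL M N, Ideal.Quotient.mk (LL M N) b ∈ Submodule.span (B K 4 4) (Set.range (gH M N φ)) := by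
    intro b hb
    rw [Ideal.Quotient.eq_zero_iff_mem.2 hb]; exact zero_mem _
  have key := vec10 (fun b => Ideal.Quotient.mk (LL M N) b ∈ Submodule.span (B K 4 4) (Set.range (gH M N φ))) _ _ _ _ _ _ _ _ _ _
    (z _ qf_mem1) (z _ qf_mem2) (z _ bl_mem1) (z _ bl_mem2) (mm 0) (mm 1) (mm 2) (mm 3) (mm 4) (mm 5)
  apply le_antisymm
  · intro z hz
    obtain ⟨a, rfl⟩ := Ideal.Quotient.mk_surjective z
    have ha : a ∈ Ideal.span (Set.range (gJJ M N φ)) := by rw [← hJ]; exact hz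
    have : Ideal.span (Set.range (gJJ M N φ)) ≤ Submodule.comap (Ideal.Quotient.mkₐ (B K 4 4) (LL M N)).toLinearMap 
        (Submodule.span (B K 4 4) (Set.range (gH M N φ))) := by
      rw [Ideal.span_le]
      rintro _ ⟨i, rfl⟩
      exact key i
    exact this ha
  · rw [Submodule.span_le]
    rintro _ ⟨i, rfl⟩
    have : ∀ j, Ideal.Quotient.mk (LL M N) (gJJ M N φ j) ∈ H0 K 4 4 (LL M N) := by
      intro j
      have : gJJ M N φ j ∈ Submodule.comap (Ideal.Quotient.mkₐ (B K 4 4) (LL M N)).toLinearMap (H0 K 4 4 (LL M N)) := by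
        rw [hJ]; exact Ideal.subset_span ⟨j, rfl⟩
      exact this
    exact vec6 (fun b => Ideal.Quotient.mk (LL M N) b ∈ H0 K 4 4 (LL M N)) _ _ _ _ _ _ (this 4) (this 5) (this 6) (this 7) (this 8) (this 9) i

end struct

/-! Part 15 -/

section bridge
variable {F : Type} [Field F]

lemma hom_one_eq (p : MvPolynomial (Fin 4) F) (hp : p.IsHomogeneous 1) :
    p = ∑ j, C (coeff (Finsupp.single j 1) p) * X j := by
  classical
  ext m
  simp only [coeff_sum, coeff_C_mul, coeff_X, mul_ite, mul_one, mul_zero]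
  by_cases hm : m.degree = 1
  · obtain ⟨j, rfl⟩ : ∃ j, m = Finsupp.single j 1 := by
      rw [Finsupp.degree_eq_sum] at hm
      obtain ⟨j, -, hj⟩ := Finset.exists_ne_zero_of_sum_ne_zero (hm.trans_ne one_ne_zero)
      refine ⟨j, ?_⟩
      rw [← Finset.add_sum_erase _ _ (Finset.mem_univ j)] at hm
      have h0 : ∑ x ∈ Finset.univ.erase j, m x = 0 := by omega
      ext l
      by_cases hl : l = j
      · subst hl; rw [Finsupp.single_eq_same]; omega
      · rw [Finset.sum_eq_zero_iff] at h0
        rw [h0 l (by simp [hl]), Finsupp.single_eq_of_ne hl]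
    rw [Finset.sum_eq_single j]
    · simp
    · intro b _ hb
      rw [if_neg]
      intro h
      rw [Finsupp.single_left_inj one_ne_zero] at h
      exact hb h
    · simp
  · rw [hp.coeff_eq_zero hm, Finset.sum_eq_zero]
    intro j _
    rw [if_neg]
    rintro rfl
    exact hm (by simp)

/-- the Hessian matrix -/
def Hs (f : MvPolynomial (Fin 4) F) : Matrix (Fin 4) (Fin 4) F :=
  Matrix.of fun i j => coeff (Finsupp.single j 1) (pderiv i f)

lemma pderiv_Hs (f : MvPolynomial (Fin 4) F) (hf : f.IsHomogeneous 2) (i : Fin 4) : pderiv i f = ly (Hs f) i := by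
  rw [hom_one_eq (pderiv i f) hf.pderiv]
  rfl

lemma pderiv_comm' (f : MvPolynomial (Fin 4) F) (i j : Fin 4) : pderiv i (pderiv j f) = pderiv j (pderiv i f) := by
  have : ⁅(pderiv i : Derivation F (MvPolynomial (Fin 4) F) (MvPolynomial (Fin 4) F)), (pderiv j : Derivation F (MvPolynomial (Fin 4) F) (MvPolynomial (Fin 4) F))⁆ = 0 := by
    apply MvPolynomial.derivation_ext
    intro l
    rw [Derivation.commutator_apply]
    simp only [pderiv_X, Derivation.coe_zero, Pi.zero_apply]
    rw [Pi.single_apply, Pi.single_apply]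
    split_ifs <;> simp
  have h := congrArg (fun D => D f) this
  simp only [Derivation.commutator_apply, Derivation.coe_zero, Pi.zero_apply] at h
  exact sub_eq_zero.1 h

lemma pderiv_ly (H : Matrix (Fin 4) (Fin 4) F) (i j) : pderiv j (ly H i) = C (H i j) := by
  simp only [ly, Matrix.mulVec, dotProduct, Matrix.map_apply, map_sum, Derivation.leibniz, pderiv_X, pderiv_C, smul_eq_mul, mul_zero, add_zero]
  rw [Finset.sum_eq_single j]
  · simp
  · intro b _ hb
    rw [Pi.single_apply, if_neg (by tauto), mul_zero]
  · simp

lemma Hs_symm (f : MvPolynomial (Fin 4) F) (hf : f.IsHomogeneous 2) : (Hs f).transpose = Hs f := by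
  ext i j
  apply C_injective (Fin 4) F
  rw [Matrix.transpose_apply, ← pderiv_ly, ← pderiv_ly, ← pderiv_Hs f hf, ← pderiv_Hs f hf, pderiv_comm']

lemma rename_ly (H : Matrix (Fin 4) (Fin 4) F) (i) : (rename Sum.inl (ly H i) : BB F) = hx H i := by
  simp only [ly, hx, Matrix.mulVec, dotProduct, Matrix.map_apply, map_sum, map_mul, rename_C, rename_X, vx]

lemma two_f (f : MvPolynomial (Fin 4) F) (hf : f.IsHomogeneous 2) : 2 * f = ∑ i, X i * ly (Hs f) i := by
  have := hf.sum_X_mul_pderiv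
  simp only [pderiv_Hs f hf] at this
  rw [this]; simp

lemma qf_Hs (f : MvPolynomial (Fin 4) F) (hf : f.IsHomogeneous 2) : qf (Hs f) = 2 * (rename Sum.inl f : BB F) := by
  have := congrArg (rename Sum.inl : _ →ₐ[F] BB F) (two_f f hf)
  rw [map_mul, map_ofNat] at this
  rw [this]
  simp only [map_sum, map_mul, rename_ly, rename_X]
  rfl

lemma aeval_ly (K : Type) [Field K] [Algebra F K] (H : Matrix (Fin 4) (Fin 4) F) (v : Fin 4 → K) (i) :
    aeval v (ly H i) = (bc K H).mulVec v i := by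
  simp only [ly, Matrix.mulVec, dotProduct, Matrix.map_apply, map_sum, map_mul, aeval_X, aeval_C]

lemma aeval_f (K : Type) [Field K] [Algebra F K] (f : MvPolynomial (Fin 4) F) (hf : f.IsHomogeneous 2) (v : Fin 4 → K) :
    2 * aeval v f = dotProduct v ((bc K (Hs f)).mulVec v) := by
  have := congrArg (aeval v) (two_f f hf)
  rw [map_mul, map_ofNat] at this
  rw [this]
  simp only [map_sum, map_mul, aeval_ly, aeval_X]
  rfl

lemma L_eq [CharZero F] (f g : MvPolynomial (Fin 4) F) (hf : f.IsHomogeneous 2) (hg : g.IsHomogeneous 2)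
    (Θ : Matrix (Fin 4) (Fin 2) (MvPolynomial (Fin 4) F)) (hΘ : ∀ i j, Θ i j = pderiv i (![f, g] j))
    (ℓ : Fin 2 → B F 4 4) (hℓ : ∀ j, ℓ j = ∑ i : Fin 4, (rename Sum.inl (Θ i j)) * X (Sum.inr i)) :
    ℓ 0 = bl (Hs f) ∧ ℓ 1 = bl (Hs g) ∧ Ideal.span (Set.range ℓ ∪ {rename Sum.inl f, rename Sum.inl g}) = LL (Hs f) (Hs g) := by
  have e0 : ℓ 0 = bl (Hs f) := by
    rw [hℓ]
    simp only [hΘ, Matrix.cons_val_zero, pderiv_Hs f hf, rename_ly, bl, dotProduct, vy]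
    exact Finset.sum_congr rfl fun i _ => mul_comm _ _
  have e1 : ℓ 1 = bl (Hs g) := by
    rw [hℓ]
    simp only [hΘ, Matrix.cons_val_one, Matrix.cons_val_fin_one, pderiv_Hs g hg, rename_ly, bl, dotProduct, vy]
    exact Finset.sum_congr rfl fun i _ => mul_comm _ _
  refine ⟨e0, e1, ?_⟩
  have inv : ∀ a : BB F, C (2⁻¹ : F) * (2 * a) = a := by
    intro a
    have : (2 : BB F) = C 2 := (map_ofNat C 2).symm
    rw [this, ← mul_assoc, ← C_mul, inv_mul_cancel₀ two_ne_zero, C_1, one_mul]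
  apply le_antisymm
  · rw [Ideal.span_le]
    rintro a (⟨j, rfl⟩ | rfl | rfl)
    · fin_cases j
      · exact e0 ▸ bl_mem1
      · exact e1 ▸ bl_mem2
    · rw [← inv (rename Sum.inl f), ← qf_Hs f hf]; exact Ideal.mul_mem_left _ _ qf_mem1
    · rw [← inv (rename Sum.inl g), ← qf_Hs g hg]; exact Ideal.mul_mem_left _ _ qf_mem2
  · rw [LL, Ideal.span_le]
    rintro a (rfl | rfl | rfl | rfl)
    · rw [qf_Hs f hf]; exact Ideal.mul_mem_left _ _ (Ideal.subset_span (by simp))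
    · rw [qf_Hs g hg]; exact Ideal.mul_mem_left _ _ (Ideal.subset_span (by simp))
    · exact Ideal.subset_span (Or.inl ⟨0, e0⟩)
    · exact Ideal.subset_span (Or.inl ⟨1, e1⟩)

lemma jac_dual (H : Matrix (Fin 4) (Fin 4) F) (hH : H.transpose = H) (b : Fin 4 → MvPolynomial (Fin 4) F)
    (h : bl H = ∑ t : Fin 4, X (Sum.inl t) * (rename Sum.inr (b t) : BB F)) : b = ly H := by
  funext t0
  rw [← hy_dot hH, hy_eq] at h
  have h2 := congrArg (aeval (Sum.elim (fun t => if t = t0 then (1 : TT F) else 0) X) : BB F →ₐ[F] TT F) h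
  simp only [dotProduct, vx, map_sum, map_mul, aeval_X, Sum.elim_inl, aeval_rename, Sum.elim_comp_inr, aeval_X_left_apply, mul_ite, mul_one, mul_zero,
    ite_mul, one_mul, zero_mul, Finset.sum_ite_eq', Finset.mem_univ, if_true] at h2
  exact h2.symm

lemma det_eq (f g : MvPolynomial (Fin 4) F) (hf : f.IsHomogeneous 2) (hg : g.IsHomogeneous 2)
    (Θ : Matrix (Fin 4) (Fin 2) (MvPolynomial (Fin 4) F)) (hΘ : ∀ i j, Θ i j = pderiv i (![f, g] j))
    (ℓ : Fin 2 → B F 4 4) (h0 : ℓ 0 = bl (Hs f)) (h1 : ℓ 1 = bl (Hs g))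
    (BΘ : Matrix (Fin 4) (Fin 2) (MvPolynomial (Fin 4) F))
    (hB : ∀ j, ℓ j = ∑ t : Fin 4, X (Sum.inl t) * (rename Sum.inr (BΘ t j) : B F 4 4))
    (𝔅 : Matrix (Fin 4) (Fin 4) (B F 4 4))
    (c0 : ∀ t, 𝔅 t 0 = rename Sum.inr (BΘ t 0)) (c1 : ∀ t, 𝔅 t 1 = rename Sum.inr (BΘ t 1))
    (c2 : ∀ t, 𝔅 t 2 = rename Sum.inl (Θ t 0)) (c3 : ∀ t, 𝔅 t 3 = rename Sum.inl (Θ t 1)) :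
    𝔅.det = Det (Hs f) (Hs g) := by
  have b0 := jac_dual (Hs f) (Hs_symm f hf) (fun t => BΘ t 0) (by rw [← h0]; exact hB 0)
  have b1 := jac_dual (Hs g) (Hs_symm g hg) (fun t => BΘ t 1) (by rw [← h1]; exact hB 1)
  rw [Det, ← Matrix.det_transpose]
  congr 1
  ext1 j t
  rw [Matrix.transpose_apply]
  have d0 : BΘ t 0 = _ := congrFun b0 t
  have d1 : BΘ t 1 = _ := congrFun b1 t
  fin_cases j
  · simp [c0, d0, hy_eq]
  · simp [c1, d1, hy_eq]
  · simp [c2, hΘ, pderiv_Hs f hf, rename_ly]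
  · simp [c3, hΘ, pderiv_Hs g hg, rename_ly]

lemma diag_data [CharZero F] (f g : MvPolynomial (Fin 4) F) (hf : f.IsHomogeneous 2) (hg : g.IsHomogeneous 2)
    (hfg : RingTheory.Sequence.IsRegular (MvPolynomial (Fin 4) F) [f, g])
    [IsDomain (MvPolynomial (Fin 4) F ⧸ (Ideal.span {f, g} : Ideal (MvPolynomial (Fin 4) F)))]
    [IsIntegrallyClosed (MvPolynomial (Fin 4) F ⧸ (Ideal.span {f, g} : Ideal (MvPolynomial (Fin 4) F)))]
    (K : Type) [Field K] [Algebra F K] [IsAlgClosed K] : 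
    ∃ (P Q : Matrix (Fin 4) (Fin 4) K) (α β : Fin 4 → K), P * Q = 1 ∧ P.transpose * bc K (Hs f) * P = Matrix.diagonal α ∧ 
      P.transpose * bc K (Hs g) * P = Matrix.diagonal β ∧ ∀ i j, i ≠ j → DD α β i j ≠ 0 := by
  have : CharZero K := charZero_of_injective_algebraMap (algebraMap F K).injective
  apply exists_diag
  · exact map_symm _ (Hs_symm f hf)
  · exact map_symm _ (Hs_symm g hg)
  · intro v hv h1 h2 s t hst
    rw [← aeval_f K f hf] at h1
    rw [← aeval_f K g hg] at h2
    have h1 := (mul_eq_zero.1 h1).resolve_left two_ne_zero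
    have h2 := (mul_eq_zero.1 h2).resolve_left two_ne_zero
    refine M1 f g hf hg hfg K v hv h1 h2 s t ?_
    intro i
    rw [pderiv_Hs f hf, pderiv_Hs g hg, aeval_ly, aeval_ly]
    exact congrFun hst i

lemma Good_Hs [CharZero F] (f g : MvPolynomial (Fin 4) F) (hf : f.IsHomogeneous 2) (hg : g.IsHomogeneous 2)
    (hfg : RingTheory.Sequence.IsRegular (MvPolynomial (Fin 4) F) [f, g])
    [IsDomain (MvPolynomial (Fin 4) F ⧸ (Ideal.span {f, g} : Ideal (MvPolynomial (Fin 4) F)))]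
    [IsIntegrallyClosed (MvPolynomial (Fin 4) F ⧸ (Ideal.span {f, g} : Ideal (MvPolynomial (Fin 4) F)))] : Good (Hs f) (Hs g) := by
  obtain ⟨P, Q, α, β, hPQ, h1, h2, hD⟩ := diag_data f g hf hg hfg (AlgebraicClosure F)
  have : CharZero (AlgebraicClosure F) := charZero_of_injective_algebraMap (algebraMap F _).injective
  apply Good_desc (K := AlgebraicClosure F)
  apply Good_trans P Q _ _ hPQ
  rw [h1, h2]
  exact Good_diag α β hD

end bridge

/-! Part 16 -/

section heights
variable {F : Type} [Field F] {K : Type} [Field K] [Algebra F K]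

lemma aeval_sub {R : Type} [CommRing R] [Algebra K R] (P Q : Matrix (Fin 4) (Fin 4) K) (hQP : Q * P = 1) (w : Fin 4 → R) (i : Fin 4) :
    aeval ((P.map (algebraMap K R)).mulVec w) (ly Q i) = w i := by
  have : aeval ((P.map (algebraMap K R)).mulVec w) (ly Q i) = (Q.map (algebraMap K R)).mulVec ((P.map (algebraMap K R)).mulVec w) i := by
    simp only [ly, Matrix.mulVec, dotProduct, Matrix.map_apply, map_sum, map_mul, aeval_X, aeval_C]
  rw [this, Matrix.mulVec_mulVec, ← Matrix.map_mul, hQP, Matrix.map_one _ (map_zero _) (map_one _), Matrix.one_mulVec]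

/-- coordinate projection -/
def wz (s : Finset (Fin 4)) : Fin 4 → MvPolynomial (Fin 4) K := fun i => if i ∈ s then 0 else X i

/-- the substitution killing `z_i`, `i ∈ s` -/
def kap (P : Matrix (Fin 4) (Fin 4) K) (s : Finset (Fin 4)) : MvPolynomial (Fin 4) K →ₐ[K] MvPolynomial (Fin 4) K :=
  aeval ((P.map (algebraMap K (MvPolynomial (Fin 4) K))).mulVec (wz s))

lemma kap_ly (P Q : Matrix (Fin 4) (Fin 4) K) (hQP : Q * P = 1) (s : Finset (Fin 4)) (i : Fin 4) : kap P s (ly Q i) = wz s i :=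
  aeval_sub P Q hQP _ i

lemma kap_comp {R : Type} [CommRing R] [Algebra K R] (P : Matrix (Fin 4) (Fin 4) K) (s : Finset (Fin 4)) (w : Fin 4 → R) (hw : ∀ i ∈ s, w i = 0)
    (a : MvPolynomial (Fin 4) K) :
    aeval w (kap P s a) = aeval ((P.map (algebraMap K R)).mulVec w) a := by
  have : (aeval w).comp (kap P s) = aeval ((P.map (algebraMap K R)).mulVec w) := by
    apply MvPolynomial.algHom_ext
    intro j
    simp only [kap, AlgHom.comp_apply, aeval_X, Matrix.mulVec, dotProduct, Matrix.map_apply, map_sum, map_mul, algebraMap_eq, aeval_C]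
    refine Finset.sum_congr rfl fun i _ => ?_
    rw [wz]
    split_ifs with h
    · rw [map_zero, hw i h]
    · rw [aeval_X]
  exact congrArg (fun φ => φ a) this

/-- the linear prime -/
def qz (P : Matrix (Fin 4) (Fin 4) K) (s : Finset (Fin 4)) : Ideal (MvPolynomial (Fin 4) K) := RingHom.ker (kap P s)

instance (P : Matrix (Fin 4) (Fin 4) K) (s : Finset (Fin 4)) : (qz P s).IsPrime := RingHom.ker_isPrime _

lemma qz_le (P : Matrix (Fin 4) (Fin 4) K) (s t : Finset (Fin 4)) (h : s ⊆ t) : qz P s ≤ qz P t := by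
  intro a ha
  change kap P s a = 0 at ha
  change kap P t a = 0
  have := kap_comp P s (wz (K := K) t) (fun i hi => if_pos (h hi)) a
  rw [ha, map_zero] at this
  exact this.symm

lemma qz_lt (P Q : Matrix (Fin 4) (Fin 4) K) (hQP : Q * P = 1) (s : Finset (Fin 4)) (a : Fin 4) (h : a ∉ s) :
    qz P s < qz P (insert a s) := by
  refine lt_of_le_of_ne (qz_le P _ _ (Finset.subset_insert _ _)) ?_
  intro he
  have h1 : ly Q a ∈ qz P (insert a s) := by
    change kap P _ _ = 0
    rw [kap_ly P Q hQP, wz, if_pos (Finset.mem_insert_self _ _)]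
  rw [← he] at h1
  change kap P _ _ = 0 at h1
  rw [kap_ly P Q hQP, wz, if_neg h] at h1
  exact X_ne_zero a h1

lemma qz_le' (P Q : Matrix (Fin 4) (Fin 4) K) (hPQ : P * Q = 1) (s : Finset (Fin 4)) (p : Ideal (MvPolynomial (Fin 4) K))
    (h : ∀ i ∈ s, ly Q i ∈ p) : qz P s ≤ p := by
  intro a ha
  change kap P s a = 0 at ha
  have h1 := kap_comp P s (fun i => Ideal.Quotient.mk p (ly Q i)) (fun i hi => Ideal.Quotient.eq_zero_iff_mem.2 (h i hi)) a
  rw [ha, map_zero] at h1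
  rw [← Ideal.Quotient.eq_zero_iff_mem, h1]
  have : Ideal.Quotient.mkₐ K p = aeval ((P.map (algebraMap K (MvPolynomial (Fin 4) K ⧸ p))).mulVec (fun i => Ideal.Quotient.mk p (ly Q i))) := by
    apply MvPolynomial.algHom_ext
    intro j
    have e : (P.map C).mulVec (ly Q) = (X : Fin 4 → MvPolynomial (Fin 4) K) := by
      rw [ly, Matrix.mulVec_mulVec, ← Matrix.map_mul, hPQ, Matrix.map_one _ (map_zero _) (map_one _), Matrix.one_mulVec]
    rw [aeval_X, ← congrFun e j]
    simp only [Matrix.mulVec, dotProduct, Matrix.map_apply, map_sum, map_mul, Ideal.Quotient.mkₐ_eq_mk]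
    rfl
  exact congrArg (fun φ => φ a) this

attribute [local instance] MvPolynomial.algebraMvPolynomial

lemma qz_height [Algebra.IsAlgebraic F K] (P Q : Matrix (Fin 4) (Fin 4) K) (hQP : Q * P = 1) (s : Finset (Fin 4)) :
    (s.card : ℕ∞) ≤ ((qz P s).comap (algebraMap (MvPolynomial (Fin 4) F) (MvPolynomial (Fin 4) K))).height := by
  induction s using Finset.induction_on with
  | empty => simp
  | insert a s h ih =>
    rw [Finset.card_insert_of_notMem h]
    have h1 := Ideal.IsIntegral.comap_lt_comap (R := MvPolynomial (Fin 4) F) (qz_lt P Q hQP s a h)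
    have h2 := Ideal.height_add_one_le_of_lt_of_isPrime h1
    push_cast
    exact (add_le_add ih le_rfl).trans h2

lemma zz_mem (M N P Q : Matrix (Fin 4) (Fin 4) K) (α β : Fin 4 → K) (hPQ : P * Q = 1) (h1 : P.transpose * M * P = Matrix.diagonal α)
    (h2 : P.transpose * N * P = Matrix.diagonal β) (hD : ∀ i j, i ≠ j → DD α β i j ≠ 0) (p : Ideal (MvPolynomial (Fin 4) K))
    (hp : ∀ i j, ly M i * ly N j - ly M j * ly N i ∈ p) (i j : Fin 4) (hij : i ≠ j) : ly Q i * ly Q j ∈ p := by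
  have key : ∀ (M : Matrix (Fin 4) (Fin 4) K) (α : Fin 4 → K), P.transpose * M * P = Matrix.diagonal α → ∀ i, 
      ∑ a, C (P a i) * ly M a = C (α i) * ly Q i := by
    intro M α h i
    have e : P.transpose * M = Matrix.diagonal α * Q := by rw [← h, Matrix.mul_assoc, hPQ, Matrix.mul_one]
    have e2 : ((P.transpose * M).map (C : K →+* MvPolynomial (Fin 4) K)).mulVec X = ((Matrix.diagonal α * Q).map C).mulVec X := by rw [e]
    rw [Matrix.map_mul, Matrix.map_mul, ← Matrix.mulVec_mulVec, ← Matrix.mulVec_mulVec] at e2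
    have e3 := congrFun e2 i
    rw [Matrix.diagonal_map (map_zero _), Matrix.mulVec_diagonal] at e3
    exact e3
  have e1 := key M α h1
  have e2 := key N β h2
  have : C (DD α β i j) * (ly Q i * ly Q j) = ∑ a, ∑ b, C (P a i) * C (P b j) * (ly M a * ly N b - ly M b * ly N a) := by
    have s1 : ∑ a, ∑ b, C (P a i) * C (P b j) * (ly M a * ly N b - ly M b * ly N a) = 
        (∑ a, C (P a i) * ly M a) * (∑ b, C (P b j) * ly N b) - (∑ a, C (P a i) * ly N a) * (∑ b, C (P b j) * ly M b) := by
      rw [Finset.sum_mul_sum, Finset.sum_mul_sum, ← Finset.sum_sub_distrib]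
      refine Finset.sum_congr rfl fun a _ => ?_
      rw [← Finset.sum_sub_distrib]
      refine Finset.sum_congr rfl fun b _ => ?_
      ring
    rw [s1, e1, e1, e2, e2]
    simp only [DD, map_sub, map_mul]
    ring
  have hm : C (DD α β i j) * (ly Q i * ly Q j) ∈ p := by
    rw [this]
    exact Ideal.sum_mem _ fun a _ => Ideal.sum_mem _ fun b _ => Ideal.mul_mem_left _ _ (hp a b)
  have h3 := Ideal.mul_mem_left p (C (DD α β i j)⁻¹) hm
  rwa [← mul_assoc, ← C_mul, inv_mul_cancel₀ (hD i j hij), C_1, one_mul] at h3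

lemma map_ly' (M : Matrix (Fin 4) (Fin 4) F) (i) : algebraMap (MvPolynomial (Fin 4) F) (MvPolynomial (Fin 4) K) (ly M i) = ly (bc K M) i :=
  map_ly M i

lemma ht_three [Algebra.IsAlgebraic F K] (M N : Matrix (Fin 4) (Fin 4) F) (P Q : Matrix (Fin 4) (Fin 4) K) (α β : Fin 4 → K) (hPQ : P * Q = 1) 
    (h1 : P.transpose * bc K M * P = Matrix.diagonal α)
    (h2 : P.transpose * bc K N * P = Matrix.diagonal β) (hD : ∀ i j, i ≠ j → DD α β i j ≠ 0) (p : Ideal (MvPolynomial (Fin 4) F)) [p.IsPrime]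
    (hp : ∀ i j, ly M i * ly N j - ly M j * ly N i ∈ p) : 3 ≤ p.height := by
  have hinj : Function.Injective (algebraMap (MvPolynomial (Fin 4) F) (MvPolynomial (Fin 4) K)) := map_injective _ (algebraMap F K).injective
  obtain ⟨p', hp', rfl⟩ := Ideal.exists_ideal_over_prime_of_isIntegral_of_isDomain (S := MvPolynomial (Fin 4) K) p 
    (by rw [(RingHom.injective_iff_ker_eq_bot _).1 hinj]; exact bot_le)
  have hz := zz_mem (bc K M) (bc K N) P Q α β hPQ h1 h2 hD p' (by
    intro i j
    have := hp i j
    rw [Ideal.mem_comap, map_sub, map_mul, map_mul, map_ly', map_ly', map_ly', map_ly'] at this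
    exact this)
  obtain ⟨i0, hi0⟩ : ∃ i0, ∀ i, i ≠ i0 → ly Q i ∈ p' := by
    by_cases h : ∀ i, ly Q i ∈ p'
    · exact ⟨0, fun i _ => h i⟩
    · push Not at h
      obtain ⟨i0, h⟩ := h
      exact ⟨i0, fun i hi => (hp'.mem_or_mem (hz i i0 hi)).resolve_right h⟩
  have hle := qz_le' P Q hPQ (Finset.univ.erase i0) p' (fun i hi => hi0 i (Finset.ne_of_mem_erase hi))
  have h3 := qz_height (F := F) P Q (mul_eq_one_comm.1 hPQ) (Finset.univ.erase i0)
  refine le_trans ?_ (h3.trans (Ideal.height_mono (Ideal.comap_mono hle)))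
  rw [Finset.card_erase_of_mem (Finset.mem_univ _)]
  norm_num

lemma htGE_three [CharZero F] (f g : MvPolynomial (Fin 4) F) (hf : f.IsHomogeneous 2) (hg : g.IsHomogeneous 2)
    (hfg : RingTheory.Sequence.IsRegular (MvPolynomial (Fin 4) F) [f, g])
    [IsDomain (MvPolynomial (Fin 4) F ⧸ (Ideal.span {f, g} : Ideal (MvPolynomial (Fin 4) F)))]
    [IsIntegrallyClosed (MvPolynomial (Fin 4) F ⧸ (Ideal.span {f, g} : Ideal (MvPolynomial (Fin 4) F)))] 
    (Θ : Matrix (Fin 4) (Fin 2) (MvPolynomial (Fin 4) F)) (hΘ : ∀ i j, Θ i j = pderiv i (![f, g] j)) :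
    htGE (minorsIdeal Θ 2) 3 ∧ ¬ htGE (minorsIdeal Θ 2) 4 := by
  obtain ⟨P, Q, α, β, hPQ, h1, h2, hD⟩ := diag_data f g hf hg hfg (AlgebraicClosure F)
  have t0 : ∀ i, Θ i 0 = ly (Hs f) i := fun i => by rw [hΘ, ← pderiv_Hs f hf]; rfl
  have t1 : ∀ i, Θ i 1 = ly (Hs g) i := fun i => by rw [hΘ, ← pderiv_Hs g hg]; rfl
  constructor
  · intro p hp hle
    rw [IsLocalization.AtPrime.ringKrullDim_eq_height p (Localization.AtPrime p)]
    have := ht_three (Hs f) (Hs g) P Q α β hPQ h1 h2 hD p (by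
      intro i j
      apply hle
      refine Ideal.subset_span ⟨![i, j], ![0, 1], ?_⟩
      rw [Matrix.det_fin_two]
      simp [t0, t1, mul_comm])
    exact WithBot.coe_le_coe.2 this
  · intro h
    let v : Fin 4 → AlgebraicClosure F := fun i => P i 0
    have hv : v ≠ 0 := by
      intro hv
      have e := mul_eq_one_comm.1 hPQ
      have e2 := congrFun (congrFun e 0) 0
      rw [Matrix.mul_apply, Matrix.one_apply_eq] at e2
      have : ∀ i, P i 0 = 0 := fun i => congrFun hv i
      simp [this] at e2
    have hpr := line_prime (F := F) (AlgebraicClosure F) v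
    have key : ∀ (M : Matrix (Fin 4) (Fin 4) F) (γ : Fin 4 → AlgebraicClosure F), P.transpose * bc _ M * P = Matrix.diagonal γ → ∀ i, 
        aeval v (ly M i) = γ 0 * Q 0 i := by
      intro M γ hM i
      have hPQt : Q.transpose * P.transpose = 1 := by rw [← Matrix.transpose_mul, hPQ, Matrix.transpose_one]
      have e : bc _ M * P = Q.transpose * Matrix.diagonal γ := by
        rw [← hM, ← Matrix.mul_assoc, ← Matrix.mul_assoc, hPQt, Matrix.one_mul]
      have e2 := congrFun (congrFun e i) 0
      rw [Matrix.mul_diagonal, Matrix.mul_apply] at e2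
      rw [aeval_ly, Matrix.mulVec, dotProduct, e2, Matrix.transpose_apply, mul_comm]
    have hl : ∀ i, (ly (Hs f) i).IsHomogeneous 1 := fun i => by rw [← pderiv_Hs f hf]; exact hf.pderiv
    have hl' : ∀ i, (ly (Hs g) i).IsHomogeneous 1 := fun i => by rw [← pderiv_Hs g hg]; exact hg.pderiv
    have t : ∀ (i : Fin 4) (j : Fin 2), ∃ c d : AlgebraicClosure F, (∀ i, lineHom _ v (Θ i j) = Polynomial.C (c * Q 0 i) * Polynomial.X) := by
      intro i j
      fin_cases j
      · refine ⟨α 0, 0, fun i => ?_⟩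
        simp only [Fin.zero_eta, t0]
        rw [lineHom_hom _ v _ 1 (hl i), key _ α h1, pow_one]
      · refine ⟨β 0, 0, fun i => ?_⟩
        simp only [Fin.mk_one, t1]
        rw [lineHom_hom _ v _ 1 (hl' i), key _ β h2, pow_one]
    have hle : minorsIdeal Θ 2 ≤ RingHom.ker (lineHom (F := F) (AlgebraicClosure F) v) := by
      rw [minorsIdeal, Ideal.span_le]
      rintro _ ⟨a, b, rfl⟩
      change lineHom _ v _ = 0
      rw [Matrix.det_fin_two]
      obtain ⟨c, _, hc⟩ := t 0 (b 0)
      obtain ⟨c', _, hc'⟩ := t 0 (b 1)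
      simp only [Matrix.submatrix_apply, map_sub, map_mul, hc, hc', Polynomial.C_mul]
      ring
    have h4 := h _ hpr hle
    rw [IsLocalization.AtPrime.ringKrullDim_eq_height (RingHom.ker (lineHom (F := F) (AlgebraicClosure F) v)) (Localization.AtPrime (RingHom.ker (lineHom (F := F) (AlgebraicClosure F) v)))] at h4
    have h5 := (WithBot.coe_le_coe.1 h4).trans (line_ht (F := F) (AlgebraicClosure F) v hv)
    norm_num at h5

end heights

theorem tangent_algebra_defining_ideal
    (k : Type) [Field k] [CharZero k]
    (f g : MvPolynomial (Fin 4) k)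
    (hf : f ∈ homogeneousSubmodule (Fin 4) k 2)
    (hg : g ∈ homogeneousSubmodule (Fin 4) k 2)
    (hfg : RingTheory.Sequence.IsRegular (MvPolynomial (Fin 4) k) [f, g])
    -- `R = S/(f,g)` is normal (hence a normal domain)
    [IsDomain (MvPolynomial (Fin 4) k ⧸
      (Ideal.span {f, g} : Ideal (MvPolynomial (Fin 4) k)))]
    [IsIntegrallyClosed (MvPolynomial (Fin 4) k ⧸
      (Ideal.span {f, g} : Ideal (MvPolynomial (Fin 4) k)))]
    -- `Θ`: the transposed Jacobian matrix of `f,g`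
    (Θ : Matrix (Fin 4) (Fin 2) (MvPolynomial (Fin 4) k))
    (hΘ : ∀ i j, Θ i j = pderiv i (![f, g] j))
    -- `S(Ω_{R/k}) ≅ B/L`, `L = (ℓ_1, ℓ_2, f, g)`, `[ℓ_1 ℓ_2] = [y_1 … y_4]·Θ`
    (ℓ : Fin 2 → B k 4 4)
    (hℓ : ∀ j, ℓ j = ∑ i : Fin 4, (rename Sum.inl (Θ i j)) * X (Sum.inr i))
    (L : Ideal (B k 4 4))
    (hL : L = Ideal.span (Set.range ℓ ∪ {rename Sum.inl f, rename Sum.inl g})) :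
    -- (i)  `A_2 = ⟨det 𝔅⟩` for `𝔅 = [B(Θ) | Θ]` any modified Jacobian dual, an
    -- equation of bidegree `(2,2)`
    (∀ (BΘ : Matrix (Fin 4) (Fin 2) (MvPolynomial (Fin 4) k)),
      (∀ t j, BΘ t j ∈ homogeneousSubmodule (Fin 4) k 1) →
      (∀ j, ℓ j = ∑ t : Fin 4, X (Sum.inl t) * (rename Sum.inr (BΘ t j) : B k 4 4)) →
      ∀ 𝔅 : Matrix (Fin 4) (Fin 4) (B k 4 4),
        (∀ (t : Fin 4) (j : Fin 4), 𝔅 t j =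
          if h : (j : ℕ) < 2 then rename Sum.inr (BΘ t ⟨j, h⟩)
          else rename Sum.inl (Θ t ⟨(j : ℕ) - 2, by omega⟩)) →
        AcompZ k 4 4 L 2 = Submodule.span (T k 4) {Ideal.Quotient.mk L 𝔅.det} ∧
        𝔅.det ∈ weightedHomogeneousSubmodule k (bwt 4 4) (2, 2)) ∧
    -- (ii)  `ht I_2(Θ) = 3` and `A_1` is minimally generated by four equations of
    -- bidegree `(1,4)`
    (htGE (minorsIdeal Θ 2) 3 ∧ ¬ htGE (minorsIdeal Θ 2) 4) ∧
    (∃ gE : Fin 4 → B k 4 4,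
      (∀ i, gE i ∈ weightedHomogeneousSubmodule k (bwt 4 4) (1, 4)) ∧
      AcompZ k 4 4 L 1 =
        Submodule.span (T k 4) (Set.range fun i => Ideal.Quotient.mk L (gE i)) ∧
      (∀ s : Finset (B k 4 4 ⧸ L),
        Submodule.span (T k 4) (s : Set (B k 4 4 ⧸ L)) = AcompZ k 4 4 L 1 →
        4 ≤ s.card)) ∧
    -- (iii)  `A_0` is a principal ideal of `T`, of bidegree `(0,8)` if `ht I(ρ) ≥ 2`
    (∃ z : B k 4 4 ⧸ L, AcompZ k 4 4 L 0 = Submodule.span (T k 4) {z}) ∧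
    (∀ (ι κ : Type) [Fintype ι] [Fintype κ] [DecidableEq ι] [DecidableEq κ]
        (ρ : Matrix ι κ (T k 4)),
      (∃ πρ : (ι → T k 4) →ₗ[T k 4] (SxDeg k 4 4 L 2),
        Function.Surjective πρ ∧ LinearMap.ker πρ = LinearMap.range ρ.mulVecLin) →
      htGE (minorsIdeal ρ ρ.rank) 2 →
      ∃ gA : B k 4 4,
        gA ∈ weightedHomogeneousSubmodule k (bwt 4 4) (0, 8) ∧
        AcompZ k 4 4 L 0 = Submodule.span (T k 4) {Ideal.Quotient.mk L gA}) ∧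
    -- `A` is generated by six elements …
    (∃ gens : Fin 6 → B k 4 4 ⧸ L,
      H0 k 4 4 L = Submodule.span (B k 4 4) (Set.range gens)) ∧
    -- … and the defining ideal `J` of the Rees algebra by ten elements
    (∃ gJ : Fin 10 → B k 4 4,
      Submodule.comap (Ideal.Quotient.mkₐ (B k 4 4) L).toLinearMap (H0 k 4 4 L) =
        Ideal.span (Set.range gJ)) := by
  have hf' : f.IsHomogeneous 2 := hf
  have hg' : g.IsHomogeneous 2 := hg
  have hG := Good_Hs f g hf' hg' hfg
  have sf := Hs_symm f hf'
  have sg := Hs_symm g hg'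
  obtain ⟨e0, e1, eL⟩ := L_eq f g hf' hg' Θ hΘ ℓ hℓ
  rw [eL] at hL
  subst hL
  obtain ⟨φ, hφ, -, hhom, huni⟩ := hG.sol
  have hA0 := A0_eq hG sf sg φ hφ huni
  refine ⟨?_, htGE_three f g hf' hg' hfg Θ hΘ, ⟨gEq (Hs f) (Hs g), fun i => hom_gEq i, A1_eq hG sf sg, A1_min hG sf sg⟩,
    ⟨_, hA0⟩, ?_, ⟨_, H0_eq hG sf sg φ hφ huni⟩, ⟨_, J_eq hG sf sg φ hφ huni⟩⟩
  · intro BΘ _ hB 𝔅 h𝔅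
    rw [det_eq f g hf' hg' Θ hΘ ℓ e0 e1 BΘ hB 𝔅 (fun t => h𝔅 t 0) (fun t => h𝔅 t 1) (fun t => h𝔅 t 2) (fun t => h𝔅 t 3)]
    exact ⟨A2_eq hG sf sg, hom_Det _ _⟩
  · intro ι κ _ _ _ _ ρ _ _
    exact ⟨app (Hs f) (Hs g) φ, hom_app φ 6 hhom, hA0⟩

end Stmt19
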